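/- There is an absolute constant C > 0 such that for every integer q ≥ 16, all reals y with 3 ≤ y ≤ q^{11/21}, and every real δ with 1/log y ≤ δ ≤ 1, one has (1/φ(q))·#{χ mod q : S_{y, q^{11/21}}(χ) > e^γ·δ} ≤ C·( exp(−(δ²·y/log y)·(1 − C·(log log y)/(log y))) + q^{−1/(500·log log q)} ). -/

import Mathlib

open Real Complex MeasureTheory
open scoped BigOperators

attribute [local instance] Classical.propDecidable

/-- `e(x) = exp(2πix)` -/
noncomputable def e2pi (x : ℝ) : ℂ := Complex.exp (2 * Real.pi * Complex.I * x)

/-- `∑_{n ≤ x} χ(n)` -/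
noncomputable def charSum {q : ℕ} (χ : DirichletCharacter ℂ q) (x : ℝ) : ℂ :=
  ∑ n ∈ Finset.Icc 1 ⌊x⌋₊, χ (n : ZMod q)

/-- `M(χ) = max_{1 ≤ N ≤ q} |∑_{n ≤ N} χ(n)|` -/
noncomputable def Mchi {q : ℕ} (χ : DirichletCharacter ℂ q) : ℝ :=
  ⨆ N ∈ Finset.Icc 1 q, ‖charSum χ (N : ℝ)‖

/-- `m(χ) = π M(χ)/(e^γ √q)` -/
noncomputable def mchi {q : ℕ} (χ : DirichletCharacter ℂ q) : ℝ :=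
  Real.pi * Mchi χ / (Real.exp Real.eulerMascheroniConstant * Real.sqrt q)

/-- the modified Bessel function `I₀` -/
noncomputable def I0 (t : ℝ) : ℝ := ∑' n : ℕ, (t ^ 2 / 4) ^ n / ((n.factorial : ℝ)) ^ 2

/-- the constant `A` -/
noncomputable def Aconst : ℝ :=
  Real.log 2 - 1 - (∫ t in (0:ℝ)..2, Real.log (I0 t) / t ^ 2)
    - ∫ t in Set.Ioi (2:ℝ), (Real.log (I0 t) - t) / t ^ 2

/-- `Φ_q(τ)` -/
noncomputable def Phi (q : ℕ) (τ : ℝ) : ℝ :=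
  (Nat.card {χ : DirichletCharacter ℂ q // χ ≠ 1 ∧ τ < mchi χ} : ℝ) / q.totient

/-- `S_𝒜(χ) = max_{α ∈ [0,1]} |∑_{n ∈ 𝒜} χ(n) e(nα)/n|` -/
noncomputable def SA {q : ℕ} (χ : DirichletCharacter ℂ q) (A : Finset ℕ) : ℝ :=
  ⨆ α : Set.Icc (0:ℝ) 1, ‖∑ n ∈ A, χ (n : ZMod q) * e2pi (n * (α : ℝ)) / n‖

/-- `S_{y,z}(χ)` -/
noncomputable def Syz {q : ℕ} (χ : DirichletCharacter ℂ q) (y z : ℝ) : ℝ :=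
  SA χ ((Finset.Icc 1 ⌊z⌋₊).filter fun n => ∃ p : ℕ, p.Prime ∧ p ∣ n ∧ y < (p : ℝ))

/-- `L(1,χ)` -/
noncomputable def Lone {q : ℕ} (χ : DirichletCharacter ℂ q) : ℂ :=
  ∑' n : ℕ, χ (n : ZMod q) / n

/-- the Gauss sum `G(χ) = ∑_{a=1}^{q} χ(a) e(a/q)` -/
noncomputable def gaussS {q : ℕ} (χ : DirichletCharacter ℂ q) : ℂ :=
  ∑ a ∈ Finset.Icc 1 q, χ (a : ZMod q) * e2pi ((a : ℝ) / q)

/-- the pretentious distance `𝔻(χ, ξ; y)` -/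
noncomputable def Ddist {q D : ℕ} (χ : DirichletCharacter ℂ q) (ξ : DirichletCharacter ℂ D)
    (y : ℝ) : ℝ :=
  Real.sqrt (∑ p ∈ (Finset.Icc 1 ⌊y⌋₊).filter Nat.Prime,
    (1 - (χ (p : ZMod q) * (starRingEnd ℂ) (ξ (p : ZMod D))).re) / p)

section PrimeNumberTheorem

open scoped FourierTransform ArithmeticFunction.vonMangoldt

/-- The summands of the series for `(s - 1) ζ(s)`. -/
noncomputable def zetaRegTerm (n : ℕ) (s : ℂ) : ℂ :=
  (s - 1) * ((n + 1 : ℝ) : ℂ) ^ (-s) + ((n + 2 : ℝ) : ℂ) ^ (1 - s) - ((n + 1 : ℝ) : ℂ) ^ (1 - s)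

/-- `(s - 1) ζ(s)`, continued to a half plane containing `Re s ≥ 1`. -/
noncomputable def zetaReg (s : ℂ) : ℂ := 1 + ∑' n, zetaRegTerm n s

lemma norm_cpow_neg_sub_le {a u : ℝ} (ha : 0 < a) (hu : a ≤ u) (hu1 : u ≤ a + 1) {s : ℂ}
    (hs : 0 ≤ s.re) : ‖(a : ℂ) ^ (-s) - (u : ℂ) ^ (-s)‖ ≤ ‖s‖ * a ^ (-s.re - 1) := by
  have key := norm_image_sub_le_of_norm_deriv_le_segment' (f := fun v : ℝ => (v : ℂ) ^ (-s))
    (f' := fun v : ℝ => -s * (v : ℂ) ^ (-s - 1)) (a := a) (b := u) (C := ‖s‖ * a ^ (-s.re - 1))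
    ?_ ?_ u ⟨hu, le_rfl⟩
  · rw [norm_sub_rev]
    refine key.trans ?_
    have : 0 ≤ ‖s‖ * a ^ (-s.re - 1) := by positivity
    nlinarith
  · intro v hv
    have hv0 : 0 < v := lt_of_lt_of_le ha hv.1
    have h := (HasDerivAt.cpow_const (c := -s) (hasDerivAt_id (v : ℂ)) (Or.inl (by simpa using hv0)))
    simpa using! h.comp_ofReal.hasDerivWithinAt
  · intro v hv
    have hv0 : 0 < v := lt_of_lt_of_le ha hv.1
    rw [norm_mul, norm_neg, Complex.norm_cpow_eq_rpow_re_of_pos hv0]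
    simp only [sub_re, neg_re, one_re]
    gcongr ?_ * ?_
    exact Real.rpow_le_rpow_of_nonpos ha hv.1 (by linarith)

lemma norm_cpow_neg_sub_le' {a u : ℝ} (ha : 0 < a) (hu : a ≤ u) {s : ℂ}
    (hs : 0 ≤ s.re) : ‖(a : ℂ) ^ (-s) - (u : ℂ) ^ (-s)‖ ≤ 2 * a ^ (-s.re) := by
  refine (norm_sub_le _ _).trans ?_
  rw [Complex.norm_cpow_eq_rpow_re_of_pos ha, Complex.norm_cpow_eq_rpow_re_of_pos (ha.trans_le hu)]
  simp only [neg_re]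
  have := Real.rpow_le_rpow_of_nonpos ha hu (by linarith : -s.re ≤ 0)
  linarith

lemma norm_cpow_neg_sub_le_interp {a u : ℝ} (ha : 1 ≤ a) (hu : a ≤ u) (hu1 : u ≤ a + 1) {s : ℂ}
    (hs : 59 / 60 ≤ s.re) : ‖(a : ℂ) ^ (-s) - (u : ℂ) ^ (-s)‖ ≤
      2 * ‖s‖ ^ (1 / 30 : ℝ) * a ^ (-(61 / 60) : ℝ) := by
  have ha0 : 0 < a := by linarith
  set x := ‖(a : ℂ) ^ (-s) - (u : ℂ) ^ (-s)‖ with hx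
  have hx0 : 0 ≤ x := norm_nonneg _
  have h1 : x ≤ ‖s‖ * a ^ (-s.re - 1) := norm_cpow_neg_sub_le ha0 hu hu1 (by linarith)
  have h2 : x ≤ 2 * a ^ (-s.re) := norm_cpow_neg_sub_le' ha0 hu (by linarith)
  have h3 : x = x ^ (1 / 30 : ℝ) * x ^ (29 / 30 : ℝ) := by
    rw [← Real.rpow_add_of_nonneg hx0 (by norm_num) (by norm_num)]; norm_num
  calc x = x ^ (1 / 30 : ℝ) * x ^ (29 / 30 : ℝ) := h3
    _ ≤ (‖s‖ * a ^ (-s.re - 1)) ^ (1 / 30 : ℝ) * (2 * a ^ (-s.re)) ^ (29 / 30 : ℝ) := by gcongr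
    _ = ‖s‖ ^ (1 / 30 : ℝ) * 2 ^ (29 / 30 : ℝ) * a ^ (-s.re - 1 / 30) := by
        rw [Real.mul_rpow (norm_nonneg _) (by positivity), Real.mul_rpow (by norm_num) (by positivity),
          ← Real.rpow_mul ha0.le, ← Real.rpow_mul ha0.le]
        have : a ^ (-s.re - 1 / 30) = a ^ ((-s.re - 1) * (1 / 30)) * a ^ (-s.re * (29 / 30)) := by
          rw [← Real.rpow_add ha0]; ring_nf
        rw [this]; ring
    _ ≤ ‖s‖ ^ (1 / 30 : ℝ) * 2 * a ^ (-(61 / 60) : ℝ) := by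
        gcongr ?_ * ?_ * ?_
        · exact (Real.rpow_le_rpow_of_exponent_le (by norm_num) (by norm_num : (29 / 30 : ℝ) ≤ 1)).trans_eq
            (Real.rpow_one 2)
        · exact Real.rpow_le_rpow_of_exponent_le ha (by linarith)
    _ = _ := by ring

lemma norm_zetaRegTerm_le (n : ℕ) {s : ℂ} (hs : 59 / 60 ≤ s.re) :
    ‖zetaRegTerm n s‖ ≤ 2 * ‖s - 1‖ * ‖s‖ ^ (1 / 30 : ℝ) * (n + 1 : ℝ) ^ (-(61 / 60) : ℝ) := by
  have ha0 : (0 : ℝ) < n + 1 := by positivity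
  have key := norm_image_sub_le_of_norm_deriv_le_segment'
    (f := fun v : ℝ => (s - 1) * ((n + 1 : ℝ) : ℂ) ^ (-s) * (v : ℂ) + (v : ℂ) ^ (1 - s))
    (f' := fun v : ℝ => (s - 1) * (((n + 1 : ℝ) : ℂ) ^ (-s) - (v : ℂ) ^ (-s)))
    (a := n + 1) (b := n + 2)
    (C := 2 * ‖s - 1‖ * ‖s‖ ^ (1 / 30 : ℝ) * (n + 1 : ℝ) ^ (-(61 / 60) : ℝ))
    ?_ ?_ (n + 2) ⟨by linarith, le_rfl⟩
  · refine (le_of_eq ?_).trans (key.trans (le_of_eq ?_))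
    · congr 1
      simp only [zetaRegTerm]
      push_cast
      ring
    · ring
  · intro v hv
    have hv0 : 0 < v := lt_of_lt_of_le ha0 hv.1
    have h := (HasDerivAt.cpow_const (c := 1 - s) (hasDerivAt_id (v : ℂ))
      (Or.inl (by simpa using hv0)))
    have h2 := ((hasDerivAt_id (v : ℂ)).const_mul ((s - 1) * ((n + 1 : ℝ) : ℂ) ^ (-s))).add h
    convert h2.comp_ofReal.hasDerivWithinAt using 1
    · rfl
    · simp only [id]
      rw [show (1 - s - 1 : ℂ) = -s by ring]
      ring
  · intro v hv
    rw [norm_mul]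
    calc _ ≤ ‖s - 1‖ * (2 * ‖s‖ ^ (1 / 30 : ℝ) * (n + 1 : ℝ) ^ (-(61 / 60) : ℝ)) := by
          gcongr
          exact norm_cpow_neg_sub_le_interp (by linarith [Nat.cast_nonneg (α := ℝ) n]) hv.1
            (by linarith [hv.2]) hs
      _ = _ := by ring

lemma summable_nat_succ_rpow : Summable fun n : ℕ => (n + 1 : ℝ) ^ (-(61 / 60) : ℝ) := by
  have := (summable_nat_add_iff 1).2 (Real.summable_nat_rpow.2 (by norm_num : (-(61 / 60) : ℝ) < -1))
  simpa using this

lemma exists_norm_zetaReg_le : ∃ C : ℝ, 1 ≤ C ∧ ∀ s : ℂ, 59 / 60 ≤ s.re → s.re ≤ 4 →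
    ‖zetaReg s‖ ≤ C * (1 + |s.im|) ^ (31 / 30 : ℝ) := by
  set S := ∑' n : ℕ, (n + 1 : ℝ) ^ (-(61 / 60) : ℝ) with hS
  have hS0 : 0 ≤ S := tsum_nonneg fun n => by positivity
  refine ⟨1 + 2 * 4 * 5 * S, by linarith, fun s h1 h2 => ?_⟩
  set T := 1 + |s.im| with hT
  have hT1 : 1 ≤ T := by have := abs_nonneg s.im; linarith
  have hs : ‖s‖ ≤ 4 * T := by
    refine (Complex.norm_le_abs_re_add_abs_im s).trans ?_
    rw [abs_of_nonneg (by linarith : 0 ≤ s.re)]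
    have := abs_nonneg s.im; linarith
  have hs1 : ‖s - 1‖ ≤ 4 * T := by
    refine (Complex.norm_le_abs_re_add_abs_im (s - 1)).trans ?_
    simp only [sub_re, one_re, sub_im, one_im, sub_zero]
    have : |s.re - 1| ≤ 3 := by rw [abs_le]; constructor <;> linarith
    have := abs_nonneg s.im; linarith
  have hb : ‖∑' n, zetaRegTerm n s‖ ≤ (2 * ‖s - 1‖ * ‖s‖ ^ (1 / 30 : ℝ)) * S :=
    tsum_of_norm_bounded (summable_nat_succ_rpow.hasSum.mul_left _) fun n =>
      norm_zetaRegTerm_le n h1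
  have h5 : ‖s‖ ^ (1 / 30 : ℝ) ≤ 5 * T ^ (1 / 30 : ℝ) := by
    calc ‖s‖ ^ (1 / 30 : ℝ) ≤ (4 * T) ^ (1 / 30 : ℝ) := by gcongr
      _ = 4 ^ (1 / 30 : ℝ) * T ^ (1 / 30 : ℝ) := Real.mul_rpow (by norm_num) (by linarith)
      _ ≤ 5 * T ^ (1 / 30 : ℝ) := by
        gcongr
        exact (Real.rpow_le_rpow_of_exponent_le (by norm_num) (by norm_num : (1 / 30 : ℝ) ≤ 1)).trans
          (by norm_num)
  have hTT : T * T ^ (1 / 30 : ℝ) = T ^ (31 / 30 : ℝ) := by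
    rw [← Real.rpow_one_add' (by linarith) (by norm_num)]; norm_num
  have hone : 1 ≤ T ^ (31 / 30 : ℝ) := Real.one_le_rpow hT1 (by norm_num)
  calc ‖zetaReg s‖ ≤ 1 + ‖∑' n, zetaRegTerm n s‖ := by
        unfold zetaReg
        exact (norm_add_le _ _).trans (by simp)
    _ ≤ 1 + (2 * (4 * T) * (5 * T ^ (1 / 30 : ℝ))) * S := by
        refine add_le_add le_rfl (hb.trans ?_)
        gcongr
    _ = 1 + 40 * S * T ^ (31 / 30 : ℝ) := by rw [← hTT]; ring
    _ ≤ _ := by nlinarith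

lemma differentiableOn_zetaReg : DifferentiableOn ℂ zetaReg {s | 59 / 60 < s.re} := by
  intro s hs
  have hs' : 59 / 60 < s.re := hs
  set U : Set ℂ := {s | 59 / 60 < s.re} ∩ Metric.ball 0 (‖s‖ + 1) with hU
  have hUo : IsOpen U := (isOpen_lt continuous_const Complex.continuous_re).inter Metric.isOpen_ball
  have hsU : s ∈ U := ⟨hs, by simp⟩
  have h := differentiableOn_tsum_of_summable_norm (F := zetaRegTerm) (U := U)
    (u := fun n : ℕ => 2 * (‖s‖ + 2) * (‖s‖ + 1) ^ (1 / 30 : ℝ) * (n + 1 : ℝ) ^ (-(61 / 60) : ℝ))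
    (summable_nat_succ_rpow.mul_left _) ?_ hUo ?_
  · have := ((differentiableOn_const (1 : ℂ)).add h).differentiableAt (hUo.mem_nhds hsU)
    exact this.differentiableWithinAt
  · intro n
    have h1 : (((n + 1 : ℝ)) : ℂ) ≠ 0 := by exact_mod_cast (by positivity : (n + 1 : ℝ) ≠ 0)
    have h2 : (((n + 2 : ℝ)) : ℂ) ≠ 0 := by exact_mod_cast (by positivity : (n + 2 : ℝ) ≠ 0)
    refine Differentiable.differentiableOn ?_
    unfold zetaRegTerm
    refine ((Differentiable.mul (by fun_prop) ?_).add ?_).sub ?_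
    · exact fun z => (differentiableAt_id.neg).const_cpow (Or.inl h1)
    · exact fun z => ((differentiableAt_const _).sub differentiableAt_id).const_cpow (Or.inl h2)
    · exact fun z => ((differentiableAt_const _).sub differentiableAt_id).const_cpow (Or.inl h1)
  · intro n w hw
    have hw1 : 59 / 60 < w.re := hw.1
    have hw2 : ‖w‖ < ‖s‖ + 1 := by simpa using hw.2
    refine (norm_zetaRegTerm_le n hw1.le).trans ?_
    have : ‖w - 1‖ ≤ ‖s‖ + 2 := (norm_sub_le _ _).trans (by simp; linarith)
    gcongr

lemma zetaReg_one : zetaReg 1 = 1 := by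
  simp [zetaReg, zetaRegTerm]

lemma zetaReg_eq_of_one_lt {s : ℂ} (hs : 1 < s.re) : zetaReg s = (s - 1) * riemannZeta s := by
  have hz := zeta_eq_tsum_one_div_nat_add_one_cpow hs
  have hsum : HasSum (fun n : ℕ => ((n + 1 : ℝ) : ℂ) ^ (-s)) (riemannZeta s) := by
    have h0 : Summable fun n : ℕ => (1 : ℂ) / ((n : ℂ) + 1) ^ s := by
      have := (summable_nat_add_iff 1).2 (Complex.summable_one_div_nat_cpow.2 hs)
      simpa using this
    rw [hz]
    convert h0.hasSum using 2 with n
    rw [Complex.cpow_neg, one_div]; push_cast; rfl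
  have htel : HasSum (fun n : ℕ => ((n + 2 : ℝ) : ℂ) ^ (1 - s) - ((n + 1 : ℝ) : ℂ) ^ (1 - s))
      (-1) := by
    have hsm : Summable fun n : ℕ =>
        ((n + 2 : ℝ) : ℂ) ^ (1 - s) - ((n + 1 : ℝ) : ℂ) ^ (1 - s) := by
      have h1 : Summable fun n => zetaRegTerm n s :=
        Summable.of_norm_bounded (summable_nat_succ_rpow.mul_left _) fun n =>
          norm_zetaRegTerm_le n (by linarith)
      have h2 := h1.sub (hsum.summable.mul_left (s - 1))
      refine h2.congr fun n => ?_
      simp only [zetaRegTerm]; ring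
    rw [hsm.hasSum_iff_tendsto_nat]
    have hpart : ∀ N : ℕ, ∑ n ∈ Finset.range N,
        (((n + 2 : ℝ) : ℂ) ^ (1 - s) - ((n + 1 : ℝ) : ℂ) ^ (1 - s)) =
        ((N + 1 : ℝ) : ℂ) ^ (1 - s) - 1 := by
      intro N
      have := Finset.sum_range_sub (fun n : ℕ => ((n + 1 : ℝ) : ℂ) ^ (1 - s)) N
      simp only [Nat.cast_zero, zero_add, Complex.ofReal_one, Complex.one_cpow] at this
      rw [← this]
      refine Finset.sum_congr rfl fun n _ => ?_
      push_cast
      rw [show (n : ℂ) + 1 + 1 = n + 2 by ring]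
    simp_rw [hpart]
    have hlim : Filter.Tendsto (fun N : ℕ => ((N + 1 : ℝ) : ℂ) ^ (1 - s)) Filter.atTop (nhds 0) := by
      rw [tendsto_zero_iff_norm_tendsto_zero]
      have : ∀ N : ℕ, ‖((N + 1 : ℝ) : ℂ) ^ (1 - s)‖ = (N + 1 : ℝ) ^ (-(s.re - 1)) := by
        intro N
        rw [Complex.norm_cpow_eq_rpow_re_of_pos (by positivity)]
        simp
      simp_rw [this]
      exact (tendsto_rpow_neg_atTop (by linarith : 0 < s.re - 1)).comp
        (Filter.tendsto_atTop_add_const_right _ _ tendsto_natCast_atTop_atTop)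
    simpa using hlim.sub_const 1
  have htot := (hsum.mul_left (s - 1)).add htel
  unfold zetaReg
  rw [(htot.congr_fun (fun n => by simp only [zetaRegTerm]; ring)).tsum_eq]
  ring

lemma zetaReg_eq {s : ℂ} (hs : 1 ≤ s.re) (h1 : s ≠ 1) : zetaReg s = (s - 1) * riemannZeta s := by
  have hc1 : ContinuousAt zetaReg s :=
    (differentiableOn_zetaReg.differentiableAt
      ((isOpen_lt continuous_const Complex.continuous_re).mem_nhds
        (show 59 / 60 < s.re by linarith))).continuousAt
  have hc2 : ContinuousAt (fun s => (s - 1) * riemannZeta s) s :=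
    (continuousAt_id.sub continuousAt_const).mul (differentiableAt_riemannZeta h1).continuousAt
  have hlim : Filter.Tendsto (fun n : ℕ => s + (1 / ((n : ℂ) + 1))) Filter.atTop (nhds s) := by
    simpa using tendsto_const_nhds.add (tendsto_one_div_add_atTop_nhds_zero_nat (𝕜 := ℂ))
  refine tendsto_nhds_unique (hc1.tendsto.comp hlim) ?_
  refine (hc2.tendsto.comp hlim).congr fun n => ?_
  simp only [Function.comp]
  rw [zetaReg_eq_of_one_lt]
  have : ((1 : ℂ) / ((n : ℂ) + 1)).re = 1 / ((n : ℝ) + 1) := by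
    have : (1 : ℂ) / ((n : ℂ) + 1) = ((1 / ((n : ℝ) + 1) : ℝ) : ℂ) := by push_cast; rfl
    rw [this, Complex.ofReal_re]
  rw [Complex.add_re, this]
  have : 0 < 1 / ((n : ℝ) + 1) := by positivity
  linarith

lemma zetaReg_ne_zero {s : ℂ} (hs : 1 ≤ s.re) : zetaReg s ≠ 0 := by
  by_cases h : s = 1
  · rw [h, zetaReg_one]; exact one_ne_zero
  · rw [zetaReg_eq hs h]
    exact mul_ne_zero (sub_ne_zero.2 h) (riemannZeta_ne_zero_of_one_le_re hs)

/-- A small power of the height of `s`. -/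
noncomputable def heightPow (s : ℂ) : ℝ := (1 + |s.im|) ^ (1 / 120 : ℝ)

lemma one_le_heightPow (s : ℂ) : 1 ≤ heightPow s :=
  Real.one_le_rpow (by linarith [abs_nonneg s.im]) (by norm_num)

lemma height_rpow_eq (s : ℂ) :
    (1 + |s.im|) ^ (31 / 30 : ℝ) = (1 + |s.im|) * heightPow s ^ 4 := by
  have h : (0 : ℝ) ≤ 1 + |s.im| := by positivity
  have hp : (0 : ℝ) < 1 + |s.im| := by positivity
  rw [heightPow, ← Real.rpow_natCast, ← Real.rpow_mul h, ← Real.rpow_one_add' h (by norm_num)]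
  norm_num

lemma height_le_of_dist {s w : ℂ} (h : ‖w - s‖ ≤ 1) : 1 + |w.im| ≤ 2 * (1 + |s.im|) := by
  have h1 : |(w - s).im| ≤ 1 := (Complex.abs_im_le_norm _).trans h
  have h2 : |w.im| ≤ |s.im| + |(w - s).im| := by
    have : w.im = s.im + (w - s).im := by simp
    rw [this]; exact abs_add_le _ _
  have := abs_nonneg s.im
  linarith

lemma two_mul_rpow_le {T : ℝ} (hT : 0 ≤ T) : (2 * T) ^ (31 / 30 : ℝ) ≤ 4 * T ^ (31 / 30 : ℝ) := by
  rw [Real.mul_rpow (by norm_num) hT]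
  gcongr
  calc (2 : ℝ) ^ (31 / 30 : ℝ) ≤ 2 ^ (2 : ℝ) :=
        Real.rpow_le_rpow_of_exponent_le (by norm_num) (by norm_num)
    _ = 4 := by norm_num

lemma re_le_of_dist {s w : ℂ} {r : ℝ} (h : ‖w - s‖ ≤ r) : s.re - r ≤ w.re ∧ w.re ≤ s.re + r := by
  have h1 : |(w - s).re| ≤ r := (Complex.abs_re_le_norm _).trans h
  rw [abs_le] at h1
  simp only [sub_re] at h1
  constructor <;> linarith [h1.1, h1.2]

lemma exists_norm_deriv_zetaReg_le : ∃ C : ℝ, 1 ≤ C ∧ ∀ s : ℂ, 119 / 120 ≤ s.re → s.re ≤ 3 →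
    ‖deriv zetaReg s‖ ≤ C * (1 + |s.im|) ^ (31 / 30 : ℝ) := by
  obtain ⟨C, hC, h⟩ := exists_norm_zetaReg_le
  refine ⟨C * 4 * 240, by linarith, fun s h1 h2 => ?_⟩
  have hd : DiffContOnCl ℂ zetaReg (Metric.ball s (1 / 240)) := by
    apply DifferentiableOn.diffContOnCl
    refine differentiableOn_zetaReg.mono fun w hw => ?_
    have hw' : ‖w - s‖ ≤ 1 / 240 := by
      have := Metric.closure_ball_subset_closedBall hw
      simpa [dist_eq_norm] using this
    have := (re_le_of_dist hw').1
    show 59 / 60 < w.re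
    linarith
  have := Complex.norm_deriv_le_of_forall_mem_sphere_norm_le
    (C := C * (4 * (1 + |s.im|) ^ (31 / 30 : ℝ))) (by norm_num) hd ?_
  · refine this.trans (le_of_eq ?_); ring
  · intro w hw
    have hw' : ‖w - s‖ ≤ 1 / 240 := by
      rw [mem_sphere_iff_norm] at hw; exact hw.le
    have hre := re_le_of_dist hw'
    refine (h w (by linarith) (by linarith)).trans ?_
    gcongr
    refine le_trans ?_ (two_mul_rpow_le (by positivity))
    gcongr
    exact height_le_of_dist (hw'.trans (by norm_num))

lemma zetaReg_three_four_one {κ : ℝ} (hκ : 0 < κ) (t : ℝ) :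
    κ ^ 3 * |t| ^ 5 ≤ ‖zetaReg (1 + κ)‖ ^ 3 * ‖zetaReg (1 + κ + I * t)‖ ^ 4 *
      ‖zetaReg (1 + κ + 2 * I * t)‖ := by
  have h := DirichletCharacter.norm_LFunction_product_ge_one (1 : DirichletCharacter ℂ 1) hκ t
  rw [DirichletCharacter.LFunctionTrivChar] at h
  simp only [DirichletCharacter.LFunction_modOne_eq, norm_mul, norm_pow] at h
  rw [zetaReg_eq_of_one_lt (by simpa using hκ), zetaReg_eq_of_one_lt (by simpa using hκ),
    zetaReg_eq_of_one_lt (by simpa using hκ)]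
  simp only [norm_mul]
  have e1 : ‖(1 + κ - 1 : ℂ)‖ = κ := by
    rw [add_sub_cancel_left, Complex.norm_real, Real.norm_of_nonneg hκ.le]
  have e2 : |t| ≤ ‖(1 + κ + I * t - 1 : ℂ)‖ := by
    refine le_trans (le_of_eq ?_) (Complex.abs_im_le_norm _)
    simp
  have e3 : |t| ≤ ‖(1 + κ + 2 * I * t - 1 : ℂ)‖ := by
    refine le_trans ?_ (Complex.abs_im_le_norm _)
    simp [abs_mul]
    linarith [abs_nonneg t]
  rw [e1]
  calc κ ^ 3 * |t| ^ 5 = (κ ^ 3 * |t| ^ 4 * |t|) * 1 := by ring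
    _ ≤ (κ ^ 3 * ‖(1 + κ + I * t - 1 : ℂ)‖ ^ 4 * ‖(1 + κ + 2 * I * t - 1 : ℂ)‖) *
        (‖riemannZeta (1 + κ)‖ ^ 3 * ‖riemannZeta (1 + κ + I * t)‖ ^ 4 *
          ‖riemannZeta (1 + κ + 2 * I * t)‖) := by
        gcongr
    _ = _ := by ring

lemma exists_le_norm_zetaReg_pow_four : ∃ a : ℝ, 0 < a ∧ a ≤ 1 ∧ ∀ s : ℂ, 1 < s.re → s.re ≤ 2 →
    1 ≤ |s.im| → (s.re - 1) ^ 3 * (a * (1 + |s.im|)) ^ 4 ≤ ‖zetaReg s‖ ^ 4 * heightPow s ^ 4 := by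
  obtain ⟨C, hC, h⟩ := exists_norm_zetaReg_le
  have hC0 : 0 < C := by linarith
  refine ⟨1 / (4 * C), by positivity, ?_, fun s h1 h2 h3 => ?_⟩
  · rw [div_le_one (by positivity)]; linarith
  set T := 1 + |s.im| with hT
  have hs : s = 1 + ((s.re - 1 : ℝ) : ℂ) + I * (s.im : ℝ) := by
    apply Complex.ext <;> simp
  have h341 := zetaReg_three_four_one (by linarith : 0 < s.re - 1) s.im
  rw [← hs] at h341
  have b1 : ‖zetaReg (1 + ((s.re - 1 : ℝ) : ℂ))‖ ≤ C := by
    have := h (1 + ((s.re - 1 : ℝ) : ℂ)) (by simp; linarith) (by simp; linarith)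
    simpa using this
  have b2 : ‖zetaReg (1 + ((s.re - 1 : ℝ) : ℂ) + 2 * I * (s.im : ℝ))‖ ≤
      C * (4 * (T * heightPow s ^ 4)) := by
    have := h (1 + ((s.re - 1 : ℝ) : ℂ) + 2 * I * (s.im : ℝ)) (by simp; linarith)
      (by simp; linarith)
    refine this.trans ?_
    rw [← height_rpow_eq]
    gcongr
    refine le_trans ?_ (two_mul_rpow_le (by positivity))
    gcongr
    simp [abs_mul]
    linarith
  have hT2 : T / 2 ≤ |s.im| := by rw [hT]; linarith
  have hT0 : 0 < T := by rw [hT]; positivity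
  have hX := one_le_heightPow s
  have step : (s.re - 1) ^ 3 * (T / 2) ^ 5 ≤
      C ^ 3 * ‖zetaReg s‖ ^ 4 * (C * (4 * (T * heightPow s ^ 4))) := by
    have h0 : 0 ≤ s.re - 1 := by linarith
    calc (s.re - 1) ^ 3 * (T / 2) ^ 5 ≤ (s.re - 1) ^ 3 * |s.im| ^ 5 := by gcongr
      _ ≤ _ := h341
      _ ≤ _ := by gcongr
  have e : (s.re - 1) ^ 3 * (1 / (4 * C) * T) ^ 4 * (256 * C ^ 4) = (s.re - 1) ^ 3 * T ^ 4 := by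
    field_simp; norm_num
  have step2 : (s.re - 1) ^ 3 * T ^ 4 ≤ 128 * C ^ 4 * (‖zetaReg s‖ ^ 4 * heightPow s ^ 4) := by
    have : (s.re - 1) ^ 3 * T ^ 4 * T ≤ (128 * C ^ 4 * (‖zetaReg s‖ ^ 4 * heightPow s ^ 4)) * T := by
      nlinarith [step]
    exact le_of_mul_le_mul_right this hT0
  have hnn : 0 ≤ ‖zetaReg s‖ ^ 4 * heightPow s ^ 4 := by positivity
  have hC4 : 0 < C ^ 4 := by positivity
  rw [← e] at step2
  have : (s.re - 1) ^ 3 * (1 / (4 * C) * T) ^ 4 * (256 * C ^ 4) ≤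
      (‖zetaReg s‖ ^ 4 * heightPow s ^ 4) * (256 * C ^ 4) := by nlinarith
  exact le_of_mul_le_mul_right this (by positivity)

lemma norm_zetaReg_sub_le {C : ℝ} (hC : ∀ s : ℂ, 119 / 120 ≤ s.re → s.re ≤ 3 →
    ‖deriv zetaReg s‖ ≤ C * (1 + |s.im|) ^ (31 / 30 : ℝ)) (hC1 : 1 ≤ C) {s w : ℂ} {r : ℝ}
    (hs1 : 119 / 120 ≤ s.re - r) (hs2 : s.re + r ≤ 3) (hr : r ≤ 1) (hw : ‖w - s‖ ≤ r) :
    ‖zetaReg w - zetaReg s‖ ≤ 4 * C * ((1 + |s.im|) * heightPow s ^ 4) * ‖w - s‖ := by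
  have hr0 : 0 ≤ r := (norm_nonneg _).trans hw
  refine (convex_closedBall s r).norm_image_sub_le_of_norm_deriv_le (f := zetaReg) ?_ ?_
    (Metric.mem_closedBall_self hr0) (by simpa [dist_eq_norm] using hw)
  · intro v hv
    have hv' : ‖v - s‖ ≤ r := by simpa [dist_eq_norm] using hv
    refine differentiableOn_zetaReg.differentiableAt ((Complex.isOpen_re_gt _).mem_nhds ?_)
    show 59 / 60 < v.re
    linarith [(re_le_of_dist hv').1]
  · intro v hv
    have hv' : ‖v - s‖ ≤ r := by simpa [dist_eq_norm] using hv
    have hre := re_le_of_dist hv'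
    refine (hC v (by linarith) (by linarith)).trans ?_
    rw [← height_rpow_eq, mul_comm 4 C, mul_assoc]
    gcongr
    refine le_trans ?_ (two_mul_rpow_le (by positivity))
    gcongr
    exact height_le_of_dist (hv'.trans hr)

lemma exists_le_norm_zetaReg_of_one_le_im : ∃ c : ℝ, 0 < c ∧ ∀ s : ℂ, 1 ≤ s.re → s.re ≤ 2 →
    1 ≤ |s.im| → c * (1 + |s.im|) ≤ ‖zetaReg s‖ * heightPow s ^ 16 := by
  obtain ⟨a, ha, ha1, h4⟩ := exists_le_norm_zetaReg_pow_four
  obtain ⟨C, hC, hd⟩ := exists_norm_deriv_zetaReg_le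
  have hC0 : 0 < C := by linarith
  set b := a / (8 * C) with hb
  have hb0 : 0 < b := by positivity
  have hb1 : b ≤ 1 := by
    rw [hb, div_le_one (by positivity)]; linarith
  refine ⟨a * b ^ 3 / 2, by positivity, fun s h1 h2 h3 => ?_⟩
  set T := 1 + |s.im| with hT
  set X := heightPow s with hX
  have hX1 : 1 ≤ X := one_le_heightPow s
  have hX0 : 0 < X := by linarith
  have hT0 : 0 < T := by rw [hT]; positivity
  have hlow : ∀ w : ℂ, w.im = s.im → 1 + b ^ 4 / X ^ 20 ≤ w.re → w.re ≤ 2 →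
      a * b ^ 3 * T ≤ ‖zetaReg w‖ * X ^ 16 := by
    intro w hw1 hw2 hw3
    have hk : 0 < b ^ 4 / X ^ 20 := by positivity
    have := h4 w (by linarith) hw3 (by rw [hw1]; exact h3)
    have hXw : heightPow w = X := by rw [hX, heightPow, heightPow, hw1]
    rw [hXw, hw1] at this
    refine le_of_pow_le_pow_left₀ (n := 4) (by norm_num) (by positivity) ?_
    calc (a * b ^ 3 * T) ^ 4 = ((b ^ 4 / X ^ 20) ^ 3 * (a * T) ^ 4) * X ^ 60 := by
          field_simp
      _ ≤ ((w.re - 1) ^ 3 * (a * T) ^ 4) * X ^ 60 := by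
          gcongr; linarith
      _ ≤ (‖zetaReg w‖ ^ 4 * X ^ 4) * X ^ 60 := by gcongr
      _ = (‖zetaReg w‖ * X ^ 16) ^ 4 := by ring
  rcases le_or_gt (1 + b ^ 4 / X ^ 20) s.re with hcase | hcase
  · have := hlow s rfl hcase h2
    have h0 : 0 < a * b ^ 3 * T := by positivity
    linarith
  · set κ := b ^ 4 / X ^ 20 with hκ
    have hκ0 : 0 < κ := by positivity
    have hκ1 : κ ≤ 1 := by
      rw [hκ, div_le_one (by positivity)]
      exact (pow_le_one₀ hb0.le hb1).trans (one_le_pow₀ hX1)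
    set w : ℂ := ⟨1 + κ, s.im⟩ with hw
    have hw1 := hlow w rfl le_rfl (by simp [hw]; linarith)
    have hsw : ‖s - w‖ ≤ κ := by
      have : s - w = ((s.re - (1 + κ) : ℝ) : ℂ) := by
        apply Complex.ext <;> simp [hw]
      rw [this, Complex.norm_real, Real.norm_eq_abs, abs_le]
      constructor <;> linarith
    have hXw : heightPow w = X := rfl
    have hdiff := norm_zetaReg_sub_le hd hC (s := w) (w := s) (r := κ)
      (by simp [hw]; linarith) (by simp [hw]; linarith) hκ1 hsw
    rw [hXw] at hdiff
    have hdiff2 : ‖zetaReg s - zetaReg w‖ * X ^ 16 ≤ a * b ^ 3 * T / 2 := by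
      calc ‖zetaReg s - zetaReg w‖ * X ^ 16 ≤ (4 * C * (T * X ^ 4) * κ) * X ^ 16 := by
            gcongr
            refine hdiff.trans ?_
            have : (1 + |w.im|) = T := rfl
            rw [this]
            gcongr
        _ = 4 * C * b ^ 3 * b * T := by rw [hκ]; field_simp
        _ = a * b ^ 3 * T / 2 := by rw [hb]; field_simp; norm_num
    have htri : ‖zetaReg w‖ ≤ ‖zetaReg s‖ + ‖zetaReg s - zetaReg w‖ := by
      rw [norm_sub_rev]
      calc ‖zetaReg w‖ = ‖zetaReg s + (zetaReg w - zetaReg s)‖ := by ring_nf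
        _ ≤ _ := norm_add_le _ _
    have hX16 : 0 < X ^ 16 := by positivity
    nlinarith

lemma exists_le_norm_zetaReg : ∃ c : ℝ, 0 < c ∧ ∀ s : ℂ, 1 ≤ s.re → s.re ≤ 2 →
    c * (1 + |s.im|) ≤ ‖zetaReg s‖ * heightPow s ^ 16 := by
  obtain ⟨c, hc, h⟩ := exists_le_norm_zetaReg_of_one_le_im
  have hK : IsCompact (Set.Icc (1 : ℝ) 2 ×ℂ Set.Icc (-1 : ℝ) 1) :=
    isCompact_Icc.reProdIm isCompact_Icc
  have hcont : ContinuousOn (fun s => ‖zetaReg s‖) (Set.Icc (1 : ℝ) 2 ×ℂ Set.Icc (-1 : ℝ) 1) := by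
    refine (differentiableOn_zetaReg.continuousOn.mono fun s hs => ?_).norm
    have : s.re ∈ Set.Icc (1 : ℝ) 2 := hs.1
    show 59 / 60 < s.re
    linarith [this.1]
  obtain ⟨s0, hs0, hmin⟩ := hK.exists_isMinOn ⟨1, by simp [Complex.mem_reProdIm]⟩ hcont
  have hm : 0 < ‖zetaReg s0‖ := norm_pos_iff.2 (zetaReg_ne_zero hs0.1.1)
  refine ⟨min c (‖zetaReg s0‖ / 2), by positivity, fun s h1 h2 => ?_⟩
  rcases le_or_gt 1 |s.im| with h3 | h3
  · refine le_trans ?_ (h s h1 h2 h3)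
    gcongr
    exact min_le_left _ _
  · have hle : ‖zetaReg s0‖ ≤ ‖zetaReg s‖ :=
      hmin (show s ∈ Set.Icc (1 : ℝ) 2 ×ℂ Set.Icc (-1 : ℝ) 1 from
        ⟨⟨h1, h2⟩, (abs_le.1 h3.le)⟩)
    calc min c (‖zetaReg s0‖ / 2) * (1 + |s.im|) ≤ (‖zetaReg s0‖ / 2) * 2 := by
          gcongr
          · exact min_le_right _ _
          · linarith
      _ = ‖zetaReg s0‖ * 1 := by ring
      _ ≤ ‖zetaReg s‖ * heightPow s ^ 16 := by
          gcongr
          exact one_le_pow₀ (one_le_heightPow s)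

/-- Minus the logarithmic derivative of `(s - 1) ζ(s)`. -/
noncomputable def zetaLogDeriv (s : ℂ) : ℂ := -deriv zetaReg s / zetaReg s

lemma exists_zetaLogDeriv_bound : ∃ r C : ℝ, 0 < r ∧ r ≤ 1 / 240 ∧ 0 < C ∧
    ∀ s : ℂ, 1 ≤ s.re → s.re ≤ 2 → ∀ w : ℂ, ‖w - s‖ ≤ r / heightPow s ^ 20 →
      DifferentiableAt ℂ zetaLogDeriv w ∧ ‖zetaLogDeriv w‖ ≤ C * heightPow s ^ 20 := by
  obtain ⟨c, hc, hlow⟩ := exists_le_norm_zetaReg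
  obtain ⟨C, hC, hd⟩ := exists_norm_deriv_zetaReg_le
  have hC0 : 0 < C := by linarith
  refine ⟨min (1 / 240) (c / (8 * C)), 8 * C / c, by positivity, min_le_left _ _, by positivity,
    fun s h1 h2 w hw => ?_⟩
  set r := min (1 / 240) (c / (8 * C)) with hr
  have hr0 : 0 < r := by positivity
  set T := 1 + |s.im| with hT
  set X := heightPow s with hX
  have hX1 : 1 ≤ X := one_le_heightPow s
  have hX0 : 0 < X := by linarith
  have hT0 : 0 < T := by rw [hT]; positivity
  have hwr : ‖w - s‖ ≤ 1 / 240 := hw.trans ((div_le_self hr0.le (one_le_pow₀ hX1)).trans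
    (min_le_left _ _))
  have hre := re_le_of_dist hwr
  have hls := hlow s h1 h2
  have hdiff := norm_zetaReg_sub_le hd hC (s := s) (w := w) (r := 1 / 240)
    (by linarith) (by linarith) (by norm_num) hwr
  have hdiff2 : ‖zetaReg w - zetaReg s‖ * X ^ 16 ≤ c * T / 2 := by
    calc ‖zetaReg w - zetaReg s‖ * X ^ 16 ≤ (4 * C * (T * X ^ 4) * (r / X ^ 20)) * X ^ 16 := by
          gcongr
          exact hdiff.trans (by gcongr)
      _ = 4 * C * T * r := by field_simp
      _ ≤ 4 * C * T * (c / (8 * C)) := by gcongr; exact min_le_right _ _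
      _ = c * T / 2 := by field_simp; norm_num
  have htri : ‖zetaReg s‖ ≤ ‖zetaReg w‖ + ‖zetaReg w - zetaReg s‖ := by
    rw [norm_sub_rev]
    calc ‖zetaReg s‖ = ‖zetaReg w + (zetaReg s - zetaReg w)‖ := by ring_nf
      _ ≤ _ := norm_add_le _ _
  have hX16 : 0 < X ^ 16 := by positivity
  have hlw : c * T / 2 ≤ ‖zetaReg w‖ * X ^ 16 := by nlinarith
  have hpos : 0 < ‖zetaReg w‖ := by
    have : 0 < c * T / 2 := by positivity
    by_contra hcon
    have h0 : ‖zetaReg w‖ = 0 := le_antisymm (not_lt.1 hcon) (norm_nonneg _)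
    rw [h0] at hlw; linarith
  have hmem : {s : ℂ | 59 / 60 < s.re} ∈ nhds w :=
    (Complex.isOpen_re_gt _).mem_nhds (show 59 / 60 < w.re by linarith)
  constructor
  · exact ((differentiableOn_zetaReg.deriv (Complex.isOpen_re_gt _)).differentiableAt hmem).neg.div
      (differentiableOn_zetaReg.differentiableAt hmem) (norm_pos_iff.1 hpos)
  · have hdw : ‖deriv zetaReg w‖ ≤ 4 * C * (T * X ^ 4) := by
      refine (hd w (by linarith) (by linarith)).trans ?_
      rw [hT, hX, ← height_rpow_eq, mul_comm 4 C, mul_assoc]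
      gcongr
      refine le_trans ?_ (two_mul_rpow_le (by positivity))
      gcongr
      exact height_le_of_dist (hwr.trans (by norm_num))
    rw [zetaLogDeriv, norm_div, norm_neg, div_le_iff₀ hpos]
    calc ‖deriv zetaReg w‖ ≤ 4 * C * (T * X ^ 4) := hdw
      _ = 8 * C / c * X ^ 4 * (c * T / 2) := by field_simp; norm_num
      _ ≤ 8 * C / c * X ^ 4 * (‖zetaReg w‖ * X ^ 16) := by gcongr
      _ = _ := by ring

/-- The two-sided exponential kernel, equal to `e^{-u}` for `u ≥ 0` and `e^{(R-1)u}` for `u ≤ 0`. -/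
noncomputable def expKernel (R u : ℝ) : ℝ := Real.exp (min (-u) ((R - 1) * u))

/-- The Fourier transform of `expKernel`, as a function of `2πiξ`. -/
noncomputable def expKernelHat (R : ℝ) (z : ℂ) : ℂ := R / ((1 + z) * (R - 1 - z))

lemma expKernel_of_nonneg {R u : ℝ} (hR : 0 ≤ R) (hu : 0 ≤ u) : expKernel R u = Real.exp (-u) := by
  rw [expKernel, min_eq_left (by nlinarith)]

lemma expKernel_of_nonpos {R u : ℝ} (hR : 0 ≤ R) (hu : u ≤ 0) :
    expKernel R u = Real.exp ((R - 1) * u) := by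
  rw [expKernel, min_eq_right (by nlinarith)]

lemma expKernel_pos (R u : ℝ) : 0 < expKernel R u := Real.exp_pos _

lemma continuous_expKernel (R : ℝ) : Continuous (expKernel R) := by
  unfold expKernel; fun_prop

lemma integrableOn_expKernel_Ioi {R : ℝ} (hR : 3 ≤ R) :
    IntegrableOn (expKernel R) (Set.Ioi 0) := by
  refine (integrableOn_exp_mul_Ioi (a := -1) (by norm_num) 0).congr_fun (fun u hu => ?_)
    measurableSet_Ioi
  have hu' : (0 : ℝ) < u := hu
  simp only
  rw [expKernel_of_nonneg (by linarith) hu'.le]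
  congr 1; ring

lemma integrableOn_expKernel_Iic {R : ℝ} (hR : 3 ≤ R) :
    IntegrableOn (expKernel R) (Set.Iic 0) := by
  refine (integrableOn_exp_mul_Iic (a := R - 1) (by linarith) 0).congr_fun (fun u hu => ?_)
    measurableSet_Iic
  have hu' : u ≤ (0 : ℝ) := hu
  simp only
  rw [expKernel_of_nonpos (by linarith) hu']

lemma integrable_expKernel {R : ℝ} (hR : 3 ≤ R) : Integrable (expKernel R) := by
  rw [← integrableOn_univ, ← Set.Iic_union_Ioi (a := (0 : ℝ))]
  exact (integrableOn_expKernel_Iic hR).union (integrableOn_expKernel_Ioi hR)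

lemma fourier_expKernel {R : ℝ} (hR : 3 ≤ R) (ξ : ℝ) :
    𝓕 (fun u => (expKernel R u : ℂ)) ξ = expKernelHat R (2 * π * ξ * I) := by
  rw [Real.fourier_real_eq_integral_exp_smul]
  have hInt : Integrable (fun v : ℝ => cexp (↑(-2 * π * v * ξ) * I) • (expKernel R v : ℂ)) := by
    refine (integrable_expKernel hR).ofReal.bdd_mul (c := 1) ?_ ?_
    · exact Continuous.aestronglyMeasurable (by fun_prop)
    · exact Filter.Eventually.of_forall fun v => (Complex.norm_exp_ofReal_mul_I _).le
  rw [← intervalIntegral.integral_Iic_add_Ioi (b := 0) hInt.integrableOn hInt.integrableOn]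
  have h1 : ∫ v in Set.Iic (0 : ℝ), cexp (↑(-2 * π * v * ξ) * I) • (expKernel R v : ℂ)
      = 1 / (R - 1 - 2 * π * ξ * I) := by
    have := integral_exp_mul_complex_Iic (a := R - 1 - 2 * π * ξ * I)
      (by simp; linarith) 0
    simp only [ofReal_zero, mul_zero, Complex.exp_zero] at this
    rw [← this]
    refine setIntegral_congr_fun measurableSet_Iic fun u hu => ?_
    rw [expKernel_of_nonpos (by linarith) hu, smul_eq_mul, Complex.ofReal_exp, ← Complex.exp_add]
    congr 1
    push_cast
    ring
  have h2 : ∫ v in Set.Ioi (0 : ℝ), cexp (↑(-2 * π * v * ξ) * I) • (expKernel R v : ℂ)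
      = 1 / (1 + 2 * π * ξ * I) := by
    have := integral_exp_mul_complex_Ioi (a := -(1 + 2 * π * ξ * I)) (by simp) 0
    simp only [ofReal_zero, mul_zero, Complex.exp_zero] at this
    rw [neg_div_neg_eq] at this
    rw [← this]
    refine setIntegral_congr_fun measurableSet_Ioi fun u hu => ?_
    rw [expKernel_of_nonneg (by linarith) (le_of_lt hu), smul_eq_mul, Complex.ofReal_exp,
      ← Complex.exp_add]
    congr 1
    push_cast
    ring
  rw [h1, h2, expKernelHat]
  have n1 : (R - 1 - 2 * π * ξ * I : ℂ) ≠ 0 := by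
    intro h
    have := congrArg Complex.re h
    simp at this; linarith
  have n2 : (1 + 2 * π * ξ * I : ℂ) ≠ 0 := by
    intro h
    have := congrArg Complex.re h
    simp at this
  field_simp
  ring

lemma integral_expKernel {R : ℝ} (hR : 3 ≤ R) : ∫ u, expKernel R u = 1 + 1 / (R - 1) := by
  have := fourier_expKernel hR 0
  rw [Real.fourier_real_eq_integral_exp_smul] at this
  have e : ∀ v : ℝ, cexp (↑(-2 * π * v * 0) * I) • (expKernel R v : ℂ) = (expKernel R v : ℂ) := by
    intro v; simp
  simp_rw [e] at this
  rw [integral_complex_ofReal] at this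
  have h2 : expKernelHat R (2 * π * (0 : ℝ) * I) = ((1 + 1 / (R - 1) : ℝ) : ℂ) := by
    have n1 : (R - 1 : ℂ) ≠ 0 := by
      have : R - 1 ≠ 0 := by linarith
      exact_mod_cast this
    simp only [expKernelHat]
    push_cast
    simp only [mul_zero, zero_mul, add_zero, sub_zero, one_mul]
    field_simp
    ring
  rw [h2] at this
  exact_mod_cast this

/-- Bound for `expKernelHat` near a point `σ + it` where `|σ|` is small. -/
lemma norm_expKernelHat_le {R : ℝ} (hR : 3 ≤ R) {z : ℂ} (hz : |z.re| ≤ 1 / 2) :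
    ‖expKernelHat R z‖ ≤ 16 * R / (1 + |z.im|) ^ 2 := by
  rw [abs_le] at hz
  have key : ∀ w : ℂ, 1 / 2 ≤ w.re → |w.im| = |z.im| → (1 + |z.im|) / 4 ≤ ‖w‖ := by
    intro w hw hi
    have h1 := Complex.abs_re_le_norm w
    have h2 := Complex.abs_im_le_norm w
    rw [hi] at h2
    have h3 := le_abs_self w.re
    linarith
  have k1 := key (1 + z) (by simp; linarith) (by simp)
  have k2 := key (R - 1 - z) (by simp; linarith) (by simp)
  have hT : 0 < 1 + |z.im| := by positivity
  rw [expKernelHat, norm_div, norm_mul, Complex.norm_real, Real.norm_of_nonneg (by linarith)]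
  calc R / (‖1 + z‖ * ‖(R : ℂ) - 1 - z‖) ≤ R / ((1 + |z.im|) / 4 * ((1 + |z.im|) / 4)) := by
        gcongr
    _ = _ := by field_simp; norm_num

lemma differentiableAt_expKernelHat {R : ℝ} (hR : 3 ≤ R) {z : ℂ} (hz : |z.re| ≤ 1 / 2) :
    DifferentiableAt ℂ (expKernelHat R) z := by
  rw [abs_le] at hz
  unfold expKernelHat
  refine DifferentiableAt.div (by fun_prop) (by fun_prop) (mul_ne_zero ?_ ?_)
  · intro h
    have := congrArg Complex.re h
    simp at this; linarith
  · intro h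
    have := congrArg Complex.re h
    simp at this; linarith

lemma integrable_height (a : ℝ) (ha : 1 < a) : Integrable fun ξ : ℝ => (1 + |ξ|) ^ (-a) := by
  have := integrable_one_add_norm (E := ℝ) (μ := volume) (r := a) (by simpa using ha)
  simpa using this

lemma integrable_expKernelHat {R : ℝ} (hR : 3 ≤ R) :
    Integrable fun ξ : ℝ => expKernelHat R (2 * π * ξ * I) := by
  have hre : ∀ ξ : ℝ, |(2 * π * ξ * I : ℂ).re| ≤ 1 / 2 := by intro ξ; simp
  refine ((integrable_height 2 (by norm_num)).const_mul (16 * R)).mono' ?_ ?_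
  · refine Continuous.aestronglyMeasurable ?_
    rw [continuous_iff_continuousAt]
    intro ξ
    refine (differentiableAt_expKernelHat hR (hre ξ)).continuousAt.comp
      (f := fun ξ : ℝ => (2 * π * ξ * I : ℂ)) ?_
    fun_prop
  · refine Filter.Eventually.of_forall fun ξ => (norm_expKernelHat_le hR (hre ξ)).trans ?_
    have him : |(2 * π * ξ * I : ℂ).im| = 2 * π * |ξ| := by
      simp [abs_mul, abs_of_pos Real.pi_pos]
    rw [him, Real.rpow_neg (by positivity), div_eq_mul_inv]
    have : |ξ| ≤ 2 * π * |ξ| := by nlinarith [abs_nonneg ξ, Real.pi_gt_three]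
    norm_cast
    gcongr

lemma expKernel_eq_integral {R : ℝ} (hR : 3 ≤ R) (u : ℝ) :
    (expKernel R u : ℂ) = ∫ ξ : ℝ, cexp (2 * π * ξ * u * I) * expKernelHat R (2 * π * ξ * I) := by
  have hF : 𝓕 (fun u => (expKernel R u : ℂ)) = fun ξ : ℝ => expKernelHat R (2 * π * ξ * I) :=
    funext fun ξ => fourier_expKernel hR ξ
  have h := Continuous.fourierInv_fourier_eq (f := fun u => (expKernel R u : ℂ))
    (Complex.continuous_ofReal.comp (continuous_expKernel R)) (integrable_expKernel hR).ofReal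
    (by rw [hF]; exact integrable_expKernelHat hR)
  have h' := congrFun h u
  rw [hF, Real.fourierInv_eq'] at h'
  rw [← h']
  refine integral_congr_ae (Filter.Eventually.of_forall fun ξ => ?_)
  simp only [smul_eq_mul, RCLike.inner_apply, conj_trivial]
  congr 2
  push_cast
  ring

/-- The integrand of the smoothed explicit formula, as a function of `z = 2πiξ`. -/
noncomputable def smoothedLogDeriv (R η : ℝ) (z : ℂ) : ℂ :=
  expKernelHat R z * zetaLogDeriv (1 + η - z)

lemma exists_norm_iteratedDeriv_smoothedLogDeriv_le : ∃ C : ℝ, 0 < C ∧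
    ∀ R η ξ : ℝ, 3 ≤ R → 0 ≤ η → η ≤ 1 →
      AnalyticAt ℂ (smoothedLogDeriv R η) (2 * π * ξ * I) ∧
      ∀ n : ℕ, n ≤ 2 → ‖iteratedDeriv n (smoothedLogDeriv R η) (2 * π * ξ * I)‖ ≤
        C * R * (1 + |ξ|) ^ (-(3 / 2 : ℝ)) := by
  obtain ⟨r, C, hr0, hr1, hC0, h⟩ := exists_zetaLogDeriv_bound
  refine ⟨128 * C / r ^ 2, by positivity, fun R η ξ hR hη0 hη1 => ?_⟩
  set c : ℂ := 2 * π * ξ * I with hc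
  set s : ℂ := 1 + η - c with hs
  have hcre : c.re = 0 := by simp [hc]
  have hcim : |c.im| = 2 * π * |ξ| := by simp [hc, abs_mul, abs_of_pos Real.pi_pos]
  have hsre : s.re = 1 + η := by simp [hs, hcre]
  have hsim : |s.im| = |c.im| := by simp [hs]
  set X := heightPow s with hX
  set T := 1 + |c.im| with hT
  have hT0 : 0 < T := by positivity
  have hX1 : 1 ≤ X := one_le_heightPow s
  have hX0 : 0 < X := by linarith
  have hX60 : X ^ 60 = T ^ (1 / 2 : ℝ) := by
    rw [hX, heightPow, hsim, ← hT, ← Real.rpow_natCast, ← Real.rpow_mul hT0.le]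
    norm_num
  set ρ := r / X ^ 20 with hρ
  have hρ0 : 0 < ρ := by positivity
  have hρ1 : ρ ≤ 1 / 240 := (div_le_self hr0.le (one_le_pow₀ hX1)).trans hr1
  have hloc : ∀ w : ℂ, ‖w - c‖ ≤ ρ → DifferentiableAt ℂ (smoothedLogDeriv R η) w ∧
      ‖smoothedLogDeriv R η w‖ ≤ 64 * R / T ^ 2 * (C * X ^ 20) := by
    intro w hw
    have hw' : ‖(1 + η - w) - s‖ ≤ r / X ^ 20 := by
      rw [hs, show (1 + η - w - (1 + η - c) : ℂ) = -(w - c) by ring, norm_neg]; exact hw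
    have hre : |w.re| ≤ 1 / 2 := by
      have := (Complex.abs_re_le_norm (w - c)).trans hw
      rw [sub_re, hcre, sub_zero] at this
      linarith
    have him : T / 2 ≤ 1 + |w.im| := by
      have h1 := (Complex.abs_im_le_norm (w - c)).trans hw
      rw [sub_im] at h1
      have h2 := abs_sub_abs_le_abs_sub c.im w.im
      rw [abs_sub_comm] at h2
      have := abs_nonneg c.im
      rw [hT]; linarith
    obtain ⟨d, hb⟩ := h s (by rw [hsre]; linarith) (by rw [hsre]; linarith) _ hw'
    constructor
    · exact (differentiableAt_expKernelHat hR hre).mul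
        (d.comp w ((differentiableAt_const _).sub differentiableAt_id))
    · rw [smoothedLogDeriv, norm_mul]
      refine mul_le_mul ((norm_expKernelHat_le hR hre).trans ?_) hb (norm_nonneg _) (by positivity)
      calc 16 * R / (1 + |w.im|) ^ 2 ≤ 16 * R / (T / 2) ^ 2 := by gcongr
        _ = _ := by field_simp; norm_num
  have hdiff : DifferentiableOn ℂ (smoothedLogDeriv R η) (Metric.closedBall c ρ) := fun w hw =>
    (hloc w (by simpa [dist_eq_norm] using hw)).1.differentiableWithinAt
  refine ⟨hdiff.analyticAt (Metric.closedBall_mem_nhds c hρ0), fun n hn => ?_⟩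
  have hdc : DiffContOnCl ℂ (smoothedLogDeriv R η) (Metric.ball c ρ) := by
    refine DifferentiableOn.diffContOnCl ?_
    rwa [closure_ball c hρ0.ne']
  refine (Complex.norm_iteratedDeriv_le_of_forall_mem_sphere_norm_le n hρ0 hdc
    (fun w hw => (hloc w (by simpa [dist_eq_norm] using (Metric.mem_sphere.1 hw).le)).2)).trans ?_
  have hfac : (n.factorial : ℝ) ≤ 2 := by
    interval_cases n <;> simp
  have hpow : 1 / ρ ^ n ≤ X ^ 40 / r ^ 2 := by
    have h1 : 1 / ρ = X ^ 20 / r := by rw [hρ]; field_simp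
    have h2 : 1 ≤ 1 / ρ := by rw [le_div_iff₀ hρ0]; linarith
    calc 1 / ρ ^ n = (1 / ρ) ^ n := by rw [one_div_pow]
      _ ≤ (1 / ρ) ^ 2 := pow_le_pow_right₀ h2 hn
      _ = _ := by rw [h1, div_pow]; ring
  have hT32 : X ^ 60 / T ^ 2 = T ^ (-(3 / 2 : ℝ)) := by
    rw [hX60, ← Real.rpow_natCast, ← Real.rpow_sub hT0]; norm_num
  have hTξ : T ^ (-(3 / 2 : ℝ)) ≤ (1 + |ξ|) ^ (-(3 / 2 : ℝ)) := by
    refine Real.rpow_le_rpow_of_nonpos (by positivity) ?_ (by norm_num)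
    rw [hT, hcim]
    nlinarith [abs_nonneg ξ, Real.pi_gt_three]
  calc n.factorial * (64 * R / T ^ 2 * (C * X ^ 20)) / ρ ^ n
      = n.factorial * (64 * R / T ^ 2 * (C * X ^ 20)) * (1 / ρ ^ n) := by ring
    _ ≤ 2 * (64 * R / T ^ 2 * (C * X ^ 20)) * (X ^ 40 / r ^ 2) := by gcongr
    _ = 128 * C / r ^ 2 * R * (X ^ 60 / T ^ 2) := by field_simp; norm_num
    _ ≤ 128 * C / r ^ 2 * R * (1 + |ξ|) ^ (-(3 / 2 : ℝ)) := by
        rw [hT32]; gcongr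

lemma hasDerivAt_comp_two_pi_I {G : ℂ → ℂ} {ξ : ℝ} (h : DifferentiableAt ℂ G (2 * π * ξ * I)) :
    HasDerivAt (fun ξ : ℝ => G (2 * π * ξ * I)) (2 * π * I * deriv G (2 * π * ξ * I)) ξ := by
  have h1 : HasDerivAt (fun z : ℂ => 2 * π * z * I) (2 * π * I) (ξ : ℂ) := by
    simpa using (((hasDerivAt_id (ξ : ℂ)).const_mul (2 * π : ℂ)).mul_const I)
  have := (HasDerivAt.comp (ξ : ℂ) h.hasDerivAt h1).comp_ofReal
  rw [mul_comm (2 * π * I : ℂ)]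
  exact this

lemma exists_norm_fourier_smoothedLogDeriv_le : ∃ C : ℝ, 0 < C ∧
    ∀ R η x : ℝ, 3 ≤ R → 0 ≤ η → η ≤ 1 → 0 < x →
      Integrable (fun ξ : ℝ => smoothedLogDeriv R η (2 * π * ξ * I)) ∧
      ‖𝓕 (fun ξ : ℝ => smoothedLogDeriv R η (2 * π * ξ * I)) x‖ ≤ C * R / x ^ 2 := by
  obtain ⟨C, hC, h⟩ := exists_norm_iteratedDeriv_smoothedLogDeriv_le
  set J := ∫ ξ : ℝ, (1 + |ξ|) ^ (-(3 / 2 : ℝ)) with hJ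
  have hJ0 : 0 ≤ J := integral_nonneg fun ξ => by positivity
  have hInt := integrable_height (3 / 2) (by norm_num)
  refine ⟨C * J + 1, by positivity, fun R η x hR hη0 hη1 hx => ?_⟩
  set G := smoothedLogDeriv R η with hG
  have han : ∀ ξ : ℝ, AnalyticAt ℂ G (2 * π * ξ * I) := fun ξ => (h R η ξ hR hη0 hη1).1
  have hb : ∀ n ≤ 2, ∀ ξ : ℝ, ‖iteratedDeriv n G (2 * π * ξ * I)‖ ≤
    C * R * (1 + |ξ|) ^ (-(3 / 2 : ℝ)) := fun n hn ξ => (h R η ξ hR hη0 hη1).2 n hn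
  have hI : ∀ n ≤ 2, Integrable fun ξ : ℝ => iteratedDeriv n G (2 * π * ξ * I) := by
    intro n hn
    refine (hInt.const_mul (C * R)).mono' ?_ (Filter.Eventually.of_forall (hb n hn))
    refine Continuous.aestronglyMeasurable ?_
    rw [continuous_iff_continuousAt]
    intro ξ
    refine ((han ξ).iterated_deriv n).continuousAt.comp_of_eq (f := fun ξ : ℝ => (2 * π * ξ * I : ℂ))
      ?_ rfl |>.congr ?_
    · fun_prop
    · refine Filter.Eventually.of_forall fun ξ => ?_
      simp [iteratedDeriv_eq_iterate]
  have h0 := hI 0 (by norm_num)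
  have h1 := hI 1 (by norm_num)
  have h2 := hI 2 (by norm_num)
  simp only [iteratedDeriv_zero, iteratedDeriv_succ] at h0 h1 h2
  refine ⟨h0, ?_⟩
  set Φ : ℝ → ℂ := fun ξ => G (2 * π * ξ * I) with hΦ
  have d1 : deriv Φ = fun ξ : ℝ => 2 * π * I * deriv G (2 * π * ξ * I) :=
    funext fun ξ => (hasDerivAt_comp_two_pi_I (han ξ).differentiableAt).deriv
  have hd1 : ∀ ξ : ℝ, HasDerivAt (fun ξ : ℝ => 2 * π * I * deriv G (2 * π * ξ * I))
      (2 * π * I * (2 * π * I * deriv (deriv G) (2 * π * ξ * I))) ξ := fun ξ =>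
    (hasDerivAt_comp_two_pi_I (han ξ).deriv.differentiableAt).const_mul _
  have d2 : deriv (deriv Φ) =
      fun ξ : ℝ => 2 * π * I * (2 * π * I * deriv (deriv G) (2 * π * ξ * I)) := by
    rw [d1]; exact funext fun ξ => (hd1 ξ).deriv
  have f1 := Real.fourier_deriv h0
    (fun ξ => (hasDerivAt_comp_two_pi_I (han ξ).differentiableAt).differentiableAt)
    (by rw [d1]; exact h1.const_mul _)
  have f2 := Real.fourier_deriv (f := deriv Φ) (by rw [d1]; exact h1.const_mul _)
    (by rw [d1]; exact fun ξ => (hd1 ξ).differentiableAt)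
    (by rw [d2]; exact (h2.const_mul _).const_mul _)
  have e1 : 𝓕 (deriv (deriv Φ)) x = (2 * π * I * x) * ((2 * π * I * x) * 𝓕 Φ x) := by
    rw [f2, f1]; simp [smul_eq_mul]
  have nb : ‖𝓕 (deriv (deriv Φ)) x‖ ≤ (2 * π) ^ 2 * (C * R * J) := by
    rw [Real.fourier_real_eq_integral_exp_smul, d2]
    calc _ ≤ ∫ ξ : ℝ, (2 * π) ^ 2 * (C * R * (1 + |ξ|) ^ (-(3 / 2 : ℝ))) := by
          refine norm_integral_le_of_norm_le ((hInt.const_mul _).const_mul _)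
            (Filter.Eventually.of_forall fun ξ => ?_)
          rw [norm_smul, Complex.norm_exp_ofReal_mul_I, one_mul]
          have := hb 2 le_rfl ξ
          simp only [iteratedDeriv_succ, iteratedDeriv_zero] at this
          have e : ‖(2 * π * I : ℂ)‖ = 2 * π := by
            simp [abs_of_pos Real.pi_pos]
          rw [norm_mul (2 * π * I : ℂ), norm_mul (2 * π * I : ℂ), e, ← mul_assoc, ← sq]
          gcongr
      _ = _ := by rw [integral_const_mul, integral_const_mul]
  have e : ‖(2 * π * I * x : ℂ)‖ = 2 * π * x := by
    simp [abs_of_pos Real.pi_pos, abs_of_pos hx]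
  rw [e1, norm_mul (2 * π * I * x : ℂ), norm_mul (2 * π * I * x : ℂ), e] at nb
  have hpi : 0 < (2 * π) ^ 2 := by positivity
  have nb' : (2 * π) ^ 2 * (‖𝓕 Φ x‖ * x ^ 2) ≤ (2 * π) ^ 2 * (C * R * J) := by
    calc _ = 2 * π * x * (2 * π * x * ‖𝓕 Φ x‖) := by ring
      _ ≤ _ := nb
  have nb2 := le_of_mul_le_mul_left nb' hpi
  rw [le_div_iff₀ (by positivity)]
  nlinarith

lemma continuous_expKernelHat {R : ℝ} (hR : 3 ≤ R) :
    Continuous fun ξ : ℝ => expKernelHat R (2 * π * ξ * I) := by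
  rw [continuous_iff_continuousAt]
  intro ξ
  refine (differentiableAt_expKernelHat hR (z := 2 * π * ξ * I) (by simp)).continuousAt.comp
    (f := fun ξ : ℝ => (2 * π * ξ * I : ℂ)) ?_
  fun_prop

lemma norm_exp_neg_two_pi_mul (ξ x : ℝ) : ‖cexp (-(2 * π * ξ * x * I))‖ = 1 := by
  rw [show -(2 * π * ξ * x * I : ℂ) = ((-(2 * π * ξ * x) : ℝ) : ℂ) * I by push_cast; ring]
  exact Complex.norm_exp_ofReal_mul_I _

lemma integrable_exp_mul_expKernelHat {R : ℝ} (hR : 3 ≤ R) (x : ℝ) :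
    Integrable fun ξ : ℝ => cexp (-(2 * π * ξ * x * I)) * expKernelHat R (2 * π * ξ * I) := by
  refine (integrable_expKernelHat hR).bdd_mul (c := 1) ?_ ?_
  · exact Continuous.aestronglyMeasurable (by fun_prop)
  · exact Filter.Eventually.of_forall fun ξ => (norm_exp_neg_two_pi_mul ξ x).le

lemma norm_term_vonMangoldt (σ t : ℝ) (n : ℕ) :
    ‖LSeries.term (fun n => (Λ n : ℂ)) (σ - t * I) n‖ = Λ n * (n : ℝ) ^ (-σ) := by
  rcases Nat.eq_zero_or_pos n with rfl | hn
  · simp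
  · rw [LSeries.term_of_ne_zero hn.ne', norm_div, Complex.norm_natCast_cpow_of_pos hn,
      Complex.norm_real, Real.norm_of_nonneg ArithmeticFunction.vonMangoldt_nonneg,
      Real.rpow_neg (by positivity)]
    simp [div_eq_mul_inv]

lemma term_vonMangoldt_eq (σ t : ℝ) (n : ℕ) :
    LSeries.term (fun n => (Λ n : ℂ)) (σ - t * I) n =
      ((Λ n * (n : ℝ) ^ (-σ) : ℝ) : ℂ) * cexp (t * Real.log n * I) := by
  rcases Nat.eq_zero_or_pos n with rfl | hn
  · simp
  · have hn0 : (n : ℂ) ≠ 0 := by exact_mod_cast hn.ne'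
    rw [LSeries.term_of_ne_zero hn.ne', div_eq_mul_inv, ← Complex.cpow_neg]
    push_cast
    rw [Complex.ofReal_cpow (by positivity), mul_assoc]
    congr 1
    rw [show (-(σ - t * I) : ℂ) = (-σ : ℝ) + t * I by push_cast; ring, Complex.cpow_add _ _ hn0]
    congr 1
    rw [Complex.cpow_def_of_ne_zero hn0, ← Complex.natCast_log]
    congr 1; ring

/-- The smoothed explicit formula before moving the line of integration. -/
lemma hasSum_vonMangoldt_expKernel {R η : ℝ} (hR : 3 ≤ R) (hη : 0 < η) (x : ℝ) :
    HasSum (fun n : ℕ => ((Λ n * (n : ℝ) ^ (-(1 + η)) * expKernel R (Real.log n - x) : ℝ) : ℂ))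
      (∫ ξ : ℝ, cexp (-(2 * π * ξ * x * I)) * expKernelHat R (2 * π * ξ * I) *
        LSeries (fun n => (Λ n : ℂ)) (1 + η - 2 * π * ξ * I)) := by
  have hs : ∀ ξ : ℝ, (1 + η - 2 * π * ξ * I : ℂ) = ((1 + η : ℝ) : ℂ) - ((2 * π * ξ : ℝ) : ℂ) * I := by
    intro ξ; push_cast; ring
  set F : ℕ → ℝ → ℂ := fun n ξ => cexp (-(2 * π * ξ * x * I)) * expKernelHat R (2 * π * ξ * I) *
        LSeries.term (fun n => (Λ n : ℂ)) (1 + η - 2 * π * ξ * I) n with hF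
  have hFeq : ∀ n ξ, F n ξ = ((Λ n * (n : ℝ) ^ (-(1 + η)) : ℝ) : ℂ) *
      (cexp (2 * π * ξ * ((Real.log n - x : ℝ) : ℂ) * I) * expKernelHat R (2 * π * ξ * I)) := by
    intro n ξ
    simp only [hF]
    rw [hs, term_vonMangoldt_eq,
      show (2 * π * ξ * ((Real.log n - x : ℝ) : ℂ) * I) =
        -(2 * π * ξ * x * I) + ((2 * π * ξ : ℝ) : ℂ) * Real.log n * I by push_cast; ring,
      Complex.exp_add]
    ring
  have hInt : ∀ n, Integrable (F n) := by
    intro n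
    rw [show F n = _ from funext (hFeq n)]
    refine Integrable.const_mul ?_ _
    have := integrable_exp_mul_expKernelHat hR (-(Real.log n - x))
    refine this.congr (Filter.Eventually.of_forall fun ξ => ?_)
    simp only
    congr 2
    push_cast; ring
  have hnorm : ∀ n ξ, ‖F n ξ‖ = Λ n * (n : ℝ) ^ (-(1 + η)) * ‖expKernelHat R (2 * π * ξ * I)‖ := by
    intro n ξ
    simp only [hF]
    rw [norm_mul, norm_mul, norm_exp_neg_two_pi_mul, hs, norm_term_vonMangoldt]
    ring
  have hsum : Summable fun n => ∫ ξ, ‖F n ξ‖ := by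
    simp_rw [hnorm, integral_const_mul]
    refine Summable.mul_right _ ?_
    have h := (ArithmeticFunction.LSeriesSummable_vonMangoldt (s := ((1 + η : ℝ) : ℂ))
      (by simp [hη])).norm
    refine h.congr fun n => ?_
    have := norm_term_vonMangoldt (1 + η) 0 n
    simpa using this
  have := hasSum_integral_of_summable_integral_norm hInt hsum
  have e1 : ∀ n, ∫ ξ, F n ξ =
      ((Λ n * (n : ℝ) ^ (-(1 + η)) * expKernel R (Real.log n - x) : ℝ) : ℂ) := by
    intro n
    simp_rw [hFeq]
    rw [integral_const_mul, ← expKernel_eq_integral hR]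
    push_cast; ring
  have e2 : ∀ ξ, ∑' n, F n ξ = cexp (-(2 * π * ξ * x * I)) * expKernelHat R (2 * π * ξ * I) *
        LSeries (fun n => (Λ n : ℂ)) (1 + η - 2 * π * ξ * I) := by
    intro ξ
    simp only [hF]
    rw [tsum_mul_left, LSeries]
  simp_rw [e1, e2] at this
  exact this

lemma LSeries_vonMangoldt_eq_zetaLogDeriv {s : ℂ} (hs : 1 < s.re) :
    LSeries (fun n => (Λ n : ℂ)) s = 1 / (s - 1) + zetaLogDeriv s := by
  have hs1 : s - 1 ≠ 0 := by
    intro h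
    have := congrArg Complex.re h
    simp at this; linarith
  have hζ := riemannZeta_ne_zero_of_one_lt_re hs
  rw [ArithmeticFunction.LSeries_vonMangoldt_eq_deriv_riemannZeta_div hs]
  have hev : zetaReg =ᶠ[nhds s] fun s => (s - 1) * riemannZeta s := by
    filter_upwards [(Complex.isOpen_re_gt 1).mem_nhds hs] with w hw
    exact zetaReg_eq_of_one_lt hw
  have hd : deriv zetaReg s = riemannZeta s + (s - 1) * deriv riemannZeta s := by
    rw [hev.deriv_eq]
    have h1 : HasDerivAt (fun s : ℂ => s - 1) 1 s := (hasDerivAt_id s).sub_const 1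
    have h2 := (differentiableAt_riemannZeta (by rintro rfl; simp at hs)).hasDerivAt (x := s)
    refine (h1.mul h2).deriv.trans ?_
    ring
  rw [zetaLogDeriv, hd, zetaReg_eq_of_one_lt hs]
  field_simp
  ring

lemma norm_integral_expKernelHat_div_le {R η : ℝ} (hR : 3 ≤ R) (hη : 0 < η) (x : ℝ) :
    ‖∫ ξ : ℝ, cexp (-(2 * π * ξ * x * I)) * expKernelHat R (2 * π * ξ * I) *
      (1 / (η - 2 * π * ξ * I))‖ ≤ 1 + 1 / (R - 1) := by
  set k : ℝ → ℂ := fun ξ => expKernelHat R (2 * π * ξ * I) with hk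
  set f : ℝ → ℝ → ℂ := fun ξ w => cexp (-(2 * π * ξ * x * I)) * k ξ *
    cexp ((η - 2 * π * ξ * I) * w) with hf
  have hre : ∀ ξ : ℝ, (η - 2 * π * ξ * I : ℂ).re = η := by intro ξ; simp
  have e1 : ∀ ξ : ℝ, cexp (-(2 * π * ξ * x * I)) * expKernelHat R (2 * π * ξ * I) *
      (1 / (η - 2 * π * ξ * I)) = ∫ w in Set.Iic (0 : ℝ), f ξ w := by
    intro ξ
    simp only [hf, hk]
    rw [integral_const_mul, integral_exp_mul_complex_Iic (by rw [hre]; exact hη)]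
    simp
  have hfeq : ∀ ξ w : ℝ, f ξ w = (Real.exp (η * w) : ℂ) *
      (cexp (2 * π * ξ * ((-x - w : ℝ) : ℂ) * I) * k ξ) := by
    intro ξ w
    simp only [hf]
    rw [show ((η - 2 * π * ξ * I) * w : ℂ) = ((η * w : ℝ) : ℂ) + (-(2 * π * ξ * w * I)) by
        push_cast; ring, Complex.exp_add,
      show (2 * π * ξ * ((-x - w : ℝ) : ℂ) * I) = -(2 * π * ξ * x * I) + (-(2 * π * ξ * w * I)) by
        push_cast; ring, Complex.exp_add, Complex.ofReal_exp]
    ring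
  have hnorm : ∀ ξ w : ℝ, ‖f ξ w‖ = ‖k ξ‖ * Real.exp (η * w) := by
    intro ξ w
    simp only [hf]
    rw [norm_mul, norm_mul, norm_exp_neg_two_pi_mul, Complex.norm_exp, one_mul]
    simp
  have hInt : Integrable (Function.uncurry f)
      (volume.prod (volume.restrict (Set.Iic (0 : ℝ)))) := by
    have h := (integrable_expKernelHat hR).norm.mul_prod
      (integrableOn_exp_mul_Iic hη 0)
    refine h.mono' ?_ ?_
    · refine Continuous.aestronglyMeasurable ?_
      have := (continuous_expKernelHat hR).comp (continuous_fst (X := ℝ) (Y := ℝ))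
      simp only [hf, Function.uncurry_def]
      refine Continuous.mul (Continuous.mul (by fun_prop) this) (by fun_prop)
    · exact Filter.Eventually.of_forall fun p => (hnorm p.1 p.2).le
  simp_rw [e1]
  rw [integral_integral_swap hInt]
  have e2 : ∀ w : ℝ, ∫ ξ, f ξ w = ((Real.exp (η * w) * expKernel R (-x - w) : ℝ) : ℂ) := by
    intro w
    simp_rw [hfeq]
    rw [integral_const_mul, ← expKernel_eq_integral hR]
    push_cast; ring
  simp_rw [e2]
  have hg : Integrable fun w => expKernel R (-x - w) := (integrable_expKernel hR).comp_sub_left (-x)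
  calc _ ≤ ∫ w in Set.Iic (0 : ℝ), expKernel R (-x - w) := by
        refine norm_integral_le_of_norm_le hg.integrableOn ?_
        rw [ae_restrict_iff' measurableSet_Iic]
        refine Filter.Eventually.of_forall fun w hw => ?_
        have hpos := expKernel_pos R (-x - w)
        rw [Complex.norm_real, Real.norm_of_nonneg (by positivity)]
        have : Real.exp (η * w) ≤ 1 := Real.exp_le_one_iff.2 (mul_nonpos_of_nonneg_of_nonpos hη.le hw)
        nlinarith
    _ ≤ ∫ w, expKernel R (-x - w) :=
        setIntegral_le_integral hg (Filter.Eventually.of_forall fun w => (expKernel_pos _ _).le)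
    _ = 1 + 1 / (R - 1) := by
        rw [integral_sub_left_eq_self (expKernel R) volume (-x), integral_expKernel hR]

lemma exists_sum_vonMangoldt_expKernel_le : ∃ C : ℝ, 0 < C ∧ ∀ (x η : ℝ) (S : Finset ℕ), 3 ≤ x →
    0 < η → η ≤ 1 →
    ∑ n ∈ S, Λ n * (n : ℝ) ^ (-(1 + η)) * expKernel x (Real.log n - x) ≤ 1 + C / x := by
  obtain ⟨C, hC, h⟩ := exists_norm_fourier_smoothedLogDeriv_le
  refine ⟨C + 2, by positivity, fun x η S hx hη0 hη1 => ?_⟩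
  obtain ⟨hInt, hb⟩ := h x η x hx hη0.le hη1 (by linarith)
  have hs := hasSum_vonMangoldt_expKernel hx hη0 x
  have hre := Complex.reCLM.hasSum hs
  simp only [Complex.reCLM_apply, Complex.ofReal_re] at hre
  refine (sum_le_hasSum S (fun n _ => ?_) hre).trans ?_
  · have := expKernel_pos x (Real.log n - x)
    have := ArithmeticFunction.vonMangoldt_nonneg (n := n)
    positivity
  refine (Complex.re_le_norm _).trans ?_
  have e1 : ∀ ξ : ℝ, cexp (-(2 * π * ξ * x * I)) * expKernelHat x (2 * π * ξ * I) *
        LSeries (fun n => (Λ n : ℂ)) (1 + η - 2 * π * ξ * I) =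
      cexp (-(2 * π * ξ * x * I)) * expKernelHat x (2 * π * ξ * I) * (1 / (η - 2 * π * ξ * I)) +
      cexp (-(2 * π * ξ * x * I)) * smoothedLogDeriv x η (2 * π * ξ * I) := by
    intro ξ
    rw [LSeries_vonMangoldt_eq_zetaLogDeriv (by simp [hη0]), smoothedLogDeriv,
      show (1 + η - 2 * π * ξ * I - 1 : ℂ) = η - 2 * π * ξ * I by ring]
    ring
  have hi2 : Integrable fun ξ : ℝ =>
      cexp (-(2 * π * ξ * x * I)) * smoothedLogDeriv x η (2 * π * ξ * I) := by
    refine hInt.bdd_mul (c := 1) (Continuous.aestronglyMeasurable (by fun_prop)) ?_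
    exact Filter.Eventually.of_forall fun ξ => (norm_exp_neg_two_pi_mul ξ x).le
  have hne : ∀ ξ : ℝ, (η - 2 * π * ξ * I : ℂ) ≠ 0 := by
    intro ξ h
    have := congrArg Complex.re h
    simp at this; linarith
  have hi1 : Integrable fun ξ : ℝ => cexp (-(2 * π * ξ * x * I)) *
      expKernelHat x (2 * π * ξ * I) * (1 / (η - 2 * π * ξ * I)) := by
    refine (integrable_exp_mul_expKernelHat hx x).mul_bdd (c := 1 / η) ?_ ?_
    · refine Continuous.aestronglyMeasurable ?_
      exact continuous_const.div (by fun_prop) hne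
    · refine Filter.Eventually.of_forall fun ξ => ?_
      rw [norm_div, norm_one]
      have : η ≤ ‖(η - 2 * π * ξ * I : ℂ)‖ := by
        have := Complex.abs_re_le_norm (η - 2 * π * ξ * I : ℂ)
        simpa [abs_of_pos hη0] using this
      gcongr
  simp_rw [e1]
  rw [integral_add hi1 hi2]
  have e2 : ∫ ξ : ℝ, cexp (-(2 * π * ξ * x * I)) * smoothedLogDeriv x η (2 * π * ξ * I) =
      𝓕 (fun ξ : ℝ => smoothedLogDeriv x η (2 * π * ξ * I)) x := by
    rw [Real.fourier_real_eq_integral_exp_smul]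
    refine integral_congr_ae (Filter.Eventually.of_forall fun ξ => ?_)
    simp only [smul_eq_mul]
    congr 2
    push_cast; ring
  rw [e2]
  refine (norm_add_le _ _).trans ((add_le_add (norm_integral_expKernelHat_div_le hx hη0 x)
    hb).trans ?_)
  have h1 : 1 / (x - 1) ≤ 2 / x := by
    rw [div_le_div_iff₀ (by linarith) (by linarith)]; linarith
  have h2 : C * x / x ^ 2 = C / x := by field_simp
  rw [h2, add_div]
  linarith

lemma exists_sum_vonMangoldt_div_sq_le : ∃ C : ℝ, 0 < C ∧ ∀ (y : ℝ) (S : Finset ℕ),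
    3 ≤ Real.log y → 0 < y → (∀ n ∈ S, y < n) →
    ∑ n ∈ S, Λ n / (n : ℝ) ^ 2 ≤ (1 + C / Real.log y) / y := by
  obtain ⟨C, hC, h⟩ := exists_sum_vonMangoldt_expKernel_le
  refine ⟨C, hC, fun y S hy hy0 hS => ?_⟩
  rw [le_div_iff₀ hy0]
  have hlim : Filter.Tendsto (fun η : ℝ => ∑ n ∈ S, Λ n * (n : ℝ) ^ (-(1 + η)) *
      expKernel (Real.log y) (Real.log n - Real.log y)) (nhdsWithin 0 (Set.Ioi 0))
      (nhds (∑ n ∈ S, Λ n * (n : ℝ) ^ (-(1 + (0 : ℝ))) *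
      expKernel (Real.log y) (Real.log n - Real.log y))) := by
    refine Filter.Tendsto.mono_left ?_ nhdsWithin_le_nhds
    refine tendsto_finsetSum _ fun n hn => ?_
    have hn0 : (0 : ℝ) < n := hy0.trans (hS n hn)
    have : Continuous fun η : ℝ => Λ n * (n : ℝ) ^ (-(1 + η)) *
      expKernel (Real.log y) (Real.log n - Real.log y) := by
      refine (continuous_const.mul ?_).mul continuous_const
      exact Continuous.rpow continuous_const (by fun_prop) fun _ => Or.inl hn0.ne'
    exact this.tendsto 0
  have hle := le_of_tendsto hlim (b := 1 + C / Real.log y) (by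
    filter_upwards [Ioo_mem_nhdsGT (show (0 : ℝ) < 1 by norm_num)] with η hη
    exact h _ η S hy hη.1 hη.2.le)
  refine le_trans (le_of_eq ?_) hle
  rw [Finset.sum_mul]
  refine Finset.sum_congr rfl fun n hn => ?_
  have hn0 : (0 : ℝ) < n := hy0.trans (hS n hn)
  have hlog : Real.log y ≤ Real.log n := Real.log_le_log hy0 (hS n hn).le
  rw [expKernel_of_nonneg (by linarith) (by linarith), neg_sub, Real.exp_sub, Real.exp_log hy0,
    Real.exp_log hn0, add_zero, Real.rpow_neg_one]
  field_simp

/-- Sums of inverse squares of primes beyond `y`. -/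
lemma exists_sum_prime_inv_sq_le : ∃ C : ℝ, 0 < C ∧ ∀ (y : ℝ) (S : Finset ℕ),
    3 ≤ Real.log y → 0 < y → (∀ p ∈ S, p.Prime ∧ y < p) →
    ∑ p ∈ S, 1 / (p : ℝ) ^ 2 ≤ (1 + C / Real.log y) / (y * Real.log y) := by
  obtain ⟨C, hC, h⟩ := exists_sum_vonMangoldt_div_sq_le
  refine ⟨C, hC, fun y S hy hy0 hS => ?_⟩
  have hL : 0 < Real.log y := by linarith
  rw [← div_div, le_div_iff₀ hL, Finset.sum_mul]
  refine le_trans (Finset.sum_le_sum fun p hp => ?_) (h y S hy hy0 fun p hp => (hS p hp).2)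
  rw [ArithmeticFunction.vonMangoldt_apply_prime (hS p hp).1, div_mul_eq_mul_div, one_mul]
  have := Real.log_le_log hy0 (hS p hp).2.le
  gcongr

end PrimeNumberTheorem

/-- The weight `-log (1 - 1/p)` supported on primes. -/
noncomputable def primeWeight (p : ℕ) : ℝ := if p.Prime then -Real.log (1 - 1 / p) else 0

lemma neg_log_one_sub_bounds {u : ℝ} (h1 : u ≤ 1 / 2) :
    u ≤ -Real.log (1 - u) ∧ -Real.log (1 - u) ≤ u + 2 * u ^ 2 := by
  have hpos : 0 < 1 - u := by linarith
  constructor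
  · have := Real.log_le_sub_one_of_pos hpos
    linarith
  · have h := Real.one_sub_inv_le_log_of_pos hpos
    have : (1 - u)⁻¹ ≤ 1 + u + 2 * u ^ 2 := by
      rw [inv_le_iff_one_le_mul₀ hpos]
      nlinarith [mul_nonneg (sq_nonneg u) (by linarith : 0 ≤ 1 - 2 * u)]
    linarith

lemma one_div_prime_le_half {p : ℕ} (hp : p.Prime) : 1 / (p : ℝ) ≤ 1 / 2 := by
  have : (2 : ℝ) ≤ p := by exact_mod_cast hp.two_le
  exact one_div_le_one_div_of_le (by norm_num) this

lemma primeWeight_bounds {p : ℕ} (hp : p.Prime) :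
    1 / (p : ℝ) ≤ primeWeight p ∧ primeWeight p ≤ 1 / p + 2 / (p : ℝ) ^ 2 := by
  have := neg_log_one_sub_bounds (u := 1 / (p : ℝ)) (one_div_prime_le_half hp)
  rw [primeWeight, if_pos hp]
  refine ⟨this.1, this.2.trans (le_of_eq ?_)⟩
  ring

lemma primeWeight_nonneg (p : ℕ) : 0 ≤ primeWeight p := by
  by_cases hp : p.Prime
  · exact (by positivity : (0 : ℝ) ≤ 1 / p).trans (primeWeight_bounds hp).1
  · rw [primeWeight, if_neg hp]

lemma exists_sum_log_div_sq_le : ∃ K : ℝ, 0 < K ∧ ∀ S : Finset ℕ,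
    ∑ n ∈ S, Real.log n / (n : ℝ) ^ 2 ≤ K := by
  have hs : Summable fun n : ℕ => 2 * (1 / (n : ℝ) ^ (3 / 2 : ℝ)) :=
    (Real.summable_one_div_nat_rpow.2 (by norm_num)).mul_left 2
  have hle : ∀ n : ℕ, Real.log n / (n : ℝ) ^ 2 ≤ 2 * (1 / (n : ℝ) ^ (3 / 2 : ℝ)) := by
    intro n
    rcases Nat.eq_zero_or_pos n with rfl | hn
    · simp
    have hn' : (0 : ℝ) < n := by exact_mod_cast hn
    have h := Real.log_le_rpow_div hn'.le (show (0 : ℝ) < 1 / 2 by norm_num)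
    have e : (n : ℝ) ^ 2 = (n : ℝ) ^ (1 / 2 : ℝ) * (n : ℝ) ^ (3 / 2 : ℝ) := by
      rw [← Real.rpow_add hn']; norm_num
    calc Real.log n / (n : ℝ) ^ 2 ≤ ((n : ℝ) ^ (1 / 2 : ℝ) / (1 / 2)) / (n : ℝ) ^ 2 := by gcongr
      _ = _ := by rw [e]; field_simp
  refine ⟨∑' n : ℕ, 2 * (1 / (n : ℝ) ^ (3 / 2 : ℝ)) + 1, ?_, fun S => ?_⟩
  · have : 0 ≤ ∑' n : ℕ, 2 * (1 / (n : ℝ) ^ (3 / 2 : ℝ)) := tsum_nonneg fun n => by positivity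
    linarith
  · have := (Finset.sum_le_sum fun n (_ : n ∈ S) => hle n).trans
      (hs.sum_le_tsum S fun n _ => by positivity)
    linarith

lemma log_factorial_eq_sum (n : ℕ) : Real.log (n.factorial : ℝ) =
    ∑ p ∈ (Finset.Icc 1 n).filter Nat.Prime, (padicValNat p n.factorial : ℝ) * Real.log p := by
  rw [Real.log_nat_eq_sum_factorization, Finsupp.sum]
  have hsub : n.factorial.factorization.support ⊆ (Finset.Icc 1 n).filter Nat.Prime := by
    intro p hp
    rw [Nat.support_factorization, Nat.mem_primeFactors] at hp
    simp only [Finset.mem_filter, Finset.mem_Icc]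
    exact ⟨⟨hp.1.one_le, (hp.1.dvd_factorial).1 hp.2.1⟩, hp.1⟩
  rw [← Finset.sum_subset hsub]
  · refine Finset.sum_congr rfl fun p hp => ?_
    rw [Nat.factorization_def _ (Finset.mem_filter.1 (hsub hp)).2]
  · intro p hp hnot
    rw [← Nat.factorization_def _ (Finset.mem_filter.1 hp).2, Finsupp.notMem_support_iff.1 hnot]
    simp

lemma padicValNat_factorial_bounds {p n : ℕ} (hp : p.Prime) :
    (n : ℝ) / p - 1 ≤ padicValNat p n.factorial ∧
    (padicValNat p n.factorial : ℝ) ≤ n / p + n * (2 / (p : ℝ) ^ 2) := by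
  have := Fact.mk hp
  have hp2 : (2 : ℝ) ≤ p := by exact_mod_cast hp.two_le
  constructor
  · have h1 : n / p ≤ padicValNat p n.factorial := by
      rw [padicValNat_factorial (b := Nat.log p n + 2) (by omega)]
      refine le_trans (le_of_eq (by simp)) (Finset.single_le_sum
        (f := fun i => n / p ^ i) (fun i _ => Nat.zero_le _) (a := 1) (by simp))
    have h2 : (n : ℝ) / p < (n / p : ℕ) + 1 := by
      rw [← Nat.floor_div_eq_div (K := ℝ)]; exact Nat.lt_floor_add_one _
    have h3 : ((n / p : ℕ) : ℝ) ≤ padicValNat p n.factorial := by exact_mod_cast h1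
    linarith
  · have h1 := sub_one_mul_padicValNat_factorial (p := p) n
    have h2 : (p - 1) * padicValNat p n.factorial ≤ n := by rw [h1]; omega
    have h3 : ((p : ℝ) - 1) * padicValNat p n.factorial ≤ n := by
      have : (((p - 1 : ℕ) : ℝ)) * padicValNat p n.factorial ≤ n := by exact_mod_cast h2
      rwa [Nat.cast_sub hp.one_le, Nat.cast_one] at this
    have h4 : (padicValNat p n.factorial : ℝ) ≤ n / (p - 1) := by
      rw [le_div_iff₀ (by linarith)]; linarith
    refine h4.trans ?_
    rw [show (n : ℝ) / p + n * (2 / (p : ℝ) ^ 2) = n * (1 / p + 2 / (p : ℝ) ^ 2) by ring,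
      div_eq_mul_one_div]
    refine mul_le_mul_of_nonneg_left ?_ (by positivity)
    rw [show 1 / (p : ℝ) + 2 / (p : ℝ) ^ 2 = (p + 2) / (p : ℝ) ^ 2 by field_simp,
      div_le_div_iff₀ (by linarith) (by positivity)]
    nlinarith

/-- Mertens' first theorem for the weight `-log (1 - 1/p)`. -/
lemma exists_abs_sum_primeWeight_mul_log_le : ∃ K : ℝ, 0 < K ∧ ∀ n : ℕ, 1 ≤ n →
    |∑ p ∈ Finset.Icc 1 n, primeWeight p * Real.log p - Real.log n| ≤ K := by
  obtain ⟨K, hK, hsum⟩ := exists_sum_log_div_sq_le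
  have hlog4 : 0 ≤ Real.log 4 := Real.log_nonneg (by norm_num)
  refine ⟨2 * K + 1 + Real.log 4, by positivity, fun n hn => ?_⟩
  have hn' : (0 : ℝ) < n := by exact_mod_cast hn
  set S := (Finset.Icc 1 n).filter Nat.Prime with hS
  have hprime : ∀ p ∈ S, p.Prime := fun p hp => (Finset.mem_filter.1 hp).2
  have hlogp : ∀ p ∈ S, 0 ≤ Real.log p := fun p hp => Real.log_natCast_nonneg p
  have e : ∑ p ∈ Finset.Icc 1 n, primeWeight p * Real.log p = ∑ p ∈ S, primeWeight p * Real.log p := by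
    rw [hS, Finset.sum_filter]
    refine Finset.sum_congr rfl fun p _ => ?_
    by_cases hp : p.Prime <;> simp [primeWeight, hp]
  rw [e]
  set P := ∑ p ∈ S, Real.log p / p with hP
  have hQ := hsum S
  set Q := ∑ p ∈ S, Real.log p / (p : ℝ) ^ 2 with hQdef
  have hb1 : P ≤ ∑ p ∈ S, primeWeight p * Real.log p := by
    refine Finset.sum_le_sum fun p hp => ?_
    have := mul_le_mul_of_nonneg_right (primeWeight_bounds (hprime p hp)).1 (hlogp p hp)
    calc _ = 1 / (p : ℝ) * Real.log p := by ring
      _ ≤ _ := this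
  have hb2 : ∑ p ∈ S, primeWeight p * Real.log p ≤ P + 2 * Q := by
    rw [hP, hQdef, Finset.mul_sum, ← Finset.sum_add_distrib]
    refine Finset.sum_le_sum fun p hp => ?_
    have := mul_le_mul_of_nonneg_right (primeWeight_bounds (hprime p hp)).2 (hlogp p hp)
    refine this.trans (le_of_eq ?_)
    ring
  have hfac := log_factorial_eq_sum n
  have hf1 : (n : ℝ) * P - Real.log 4 * n ≤ Real.log n.factorial := by
    have hth : ∑ p ∈ S, Real.log p ≤ Real.log 4 * n := by
      have := Chebyshev.theta_le_log4_mul_x (x := n) hn'.le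
      refine le_trans (le_of_eq ?_) this
      rw [Chebyshev.theta_eq_sum_Icc, Nat.floor_natCast, hS]
      refine Finset.sum_subset ?_ ?_
      · intro p hp
        simp only [Finset.mem_filter, Finset.mem_Icc] at hp ⊢
        exact ⟨⟨by omega, hp.1.2⟩, hp.2⟩
      · intro p hp hnot
        simp only [Finset.mem_filter, Finset.mem_Icc] at hp hnot
        exact absurd ⟨⟨hp.2.one_le, hp.1.2⟩, hp.2⟩ hnot
    have : (n : ℝ) * P - ∑ p ∈ S, Real.log p ≤ Real.log n.factorial := by
      rw [hfac, hP, Finset.mul_sum, ← Finset.sum_sub_distrib]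
      refine Finset.sum_le_sum fun p hp => ?_
      have := mul_le_mul_of_nonneg_right (padicValNat_factorial_bounds (n := n) (hprime p hp)).1
        (hlogp p hp)
      refine le_trans (le_of_eq ?_) this
      ring
    linarith
  have hf2 : Real.log n.factorial ≤ n * (P + 2 * Q) := by
    rw [hfac, hP, hQdef, Finset.mul_sum, ← Finset.sum_add_distrib, Finset.mul_sum]
    refine Finset.sum_le_sum fun p hp => ?_
    have := mul_le_mul_of_nonneg_right (padicValNat_factorial_bounds (n := n) (hprime p hp)).2
      (hlogp p hp)
    refine this.trans (le_of_eq ?_)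
    ring
  have hf3 : Real.log n.factorial ≤ n * Real.log n := by
    rw [← Real.log_pow]
    refine Real.log_le_log (by exact_mod_cast n.factorial_pos) ?_
    exact_mod_cast n.factorial_le_pow
  have hf4 : n * Real.log n - n ≤ Real.log n.factorial := by
    have := Stirling.le_log_factorial_stirling (n := n) (by omega)
    have h1 : 0 ≤ Real.log n := Real.log_natCast_nonneg n
    have h2 : 0 ≤ Real.log (2 * π) := Real.log_nonneg (by nlinarith [Real.pi_gt_three])
    linarith
  have g1 : P ≤ Real.log n + Real.log 4 := by
    have : n * P ≤ n * (Real.log n + Real.log 4) := by linarith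
    exact le_of_mul_le_mul_left this hn'
  have g2 : Real.log n - 1 ≤ P + 2 * Q := by
    have : n * (Real.log n - 1) ≤ n * (P + 2 * Q) := by linarith
    exact le_of_mul_le_mul_left this hn'
  rw [abs_le]
  constructor <;> linarith

/-- `∑_{p ≤ n} -log (1 - 1/p)`. -/
noncomputable def primeWeightSum (n : ℕ) : ℝ := ∑ p ∈ Finset.Icc 1 n, primeWeight p

lemma log_log_sub_bounds {a b : ℝ} (ha : 0 < a) (hb : 0 < b) :
    (b - a) / b ≤ Real.log b - Real.log a ∧ Real.log b - Real.log a ≤ (b - a) / a := by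
  constructor
  · have := Real.one_sub_inv_le_log_of_pos (show 0 < b / a by positivity)
    rw [Real.log_div hb.ne' ha.ne', inv_div] at this
    calc (b - a) / b = 1 - a / b := by field_simp
      _ ≤ _ := this
  · have := Real.log_le_sub_one_of_pos (show 0 < b / a by positivity)
    rw [Real.log_div hb.ne' ha.ne'] at this
    calc _ ≤ b / a - 1 := this
      _ = _ := by field_simp

lemma exists_primeWeightSum_sub_log_log : ∃ c K : ℝ, 0 < K ∧ ∀ n : ℕ, 2 ≤ n →
    |primeWeightSum n - Real.log (Real.log n) - c| ≤ K / Real.log n := by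
  obtain ⟨K, hK, hA⟩ := exists_abs_sum_primeWeight_mul_log_le
  set E : ℕ → ℝ := fun n => ∑ p ∈ Finset.Icc 1 n, primeWeight p * Real.log p - Real.log n with hE
  set D : ℕ → ℝ := fun n => primeWeightSum n - Real.log (Real.log n) - E n / Real.log n with hD
  have hlogpos : ∀ n : ℕ, 2 ≤ n → 0 < Real.log n := fun n hn =>
    Real.log_pos (by exact_mod_cast (by omega : 1 < n))
  have hstep : ∀ n : ℕ, 2 ≤ n → |D (n + 1) - D n| ≤
      (K + 1) * (1 / Real.log n - 1 / Real.log ((n + 1 : ℕ) : ℝ)) := by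
    intro n hn
    have ha := hlogpos n hn
    have hb := hlogpos (n + 1) (by omega)
    set a := Real.log n with hadef
    set b := Real.log ((n + 1 : ℕ) : ℝ) with hbdef
    have hab : a ≤ b := Real.log_le_log (by exact_mod_cast (by omega : 0 < n))
      (by exact_mod_cast Nat.le_succ n)
    have hba : b - a ≤ 1 := by
      have hn0 : (0 : ℝ) < n := by exact_mod_cast (by omega : 0 < n)
      have h1 := (log_log_sub_bounds hn0 (show (0 : ℝ) < ((n + 1 : ℕ) : ℝ) by positivity)).2
      refine h1.trans ?_
      rw [div_le_one hn0]
      push_cast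
      have : (2 : ℝ) ≤ n := by exact_mod_cast hn
      linarith
    have hB : primeWeightSum (n + 1) = primeWeightSum n + primeWeight (n + 1) := by
      rw [primeWeightSum, Finset.sum_Icc_succ_top (by omega), primeWeightSum]
    have hEs : E (n + 1) = E n + primeWeight (n + 1) * b - (b - a) := by
      simp only [hE]
      rw [Finset.sum_Icc_succ_top (by omega)]
      ring
    have hll := log_log_sub_bounds ha hb
    have hD' : D (n + 1) - D n =
        ((b - a) / b - (Real.log b - Real.log a)) + E n * (1 / a - 1 / b) := by
      simp only [hD]
      rw [hB, hEs, ← hadef, ← hbdef]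
      field_simp
      ring
    have hEn := hA n (by omega)
    have hdiff : 0 ≤ 1 / a - 1 / b := by
      have := one_div_le_one_div_of_le ha hab
      linarith
    rw [hD']
    refine (abs_add_le _ _).trans ?_
    have h1 : |(b - a) / b - (Real.log b - Real.log a)| ≤ 1 * (1 / a - 1 / b) := by
      rw [abs_sub_comm, abs_of_nonneg (by linarith [hll.1])]
      calc Real.log b - Real.log a - (b - a) / b ≤ (b - a) / a - (b - a) / b := by linarith [hll.2]
        _ = (b - a) * (1 / a - 1 / b) := by ring
        _ ≤ _ := by gcongr
    have h2 : |E n * (1 / a - 1 / b)| ≤ K * (1 / a - 1 / b) := by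
      rw [abs_mul, abs_of_nonneg hdiff]
      gcongr
    linarith
  set u : ℕ → ℝ := fun k => D (k + 2) - (K + 1) / Real.log ((k + 2 : ℕ) : ℝ) with hu
  set v : ℕ → ℝ := fun k => D (k + 2) + (K + 1) / Real.log ((k + 2 : ℕ) : ℝ) with hv
  have hu_mono : Monotone u := by
    refine monotone_nat_of_le_succ fun k => ?_
    have := (abs_le.1 (hstep (k + 2) (by omega))).1
    simp only [hu, show k + 1 + 2 = k + 2 + 1 by omega]
    rw [mul_sub, mul_one_div, mul_one_div] at this
    linarith
  have hv_anti : Antitone v := by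
    refine antitone_nat_of_succ_le fun k => ?_
    have := (abs_le.1 (hstep (k + 2) (by omega))).2
    simp only [hv, show k + 1 + 2 = k + 2 + 1 by omega]
    rw [mul_sub, mul_one_div, mul_one_div] at this
    linarith
  have huv : ∀ i j, u i ≤ v j := by
    intro i j
    refine (hu_mono (le_max_left i j)).trans (le_trans ?_ (hv_anti (le_max_right i j)))
    simp only [hu, hv]
    have := hlogpos (max i j + 2) (by omega)
    have : 0 ≤ (K + 1) / Real.log ((max i j + 2 : ℕ) : ℝ) := by positivity
    linarith
  refine ⟨⨆ k, u k, 2 * K + 1, by positivity, fun n hn => ?_⟩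
  obtain ⟨k, rfl⟩ : ∃ k, n = k + 2 := ⟨n - 2, by omega⟩
  have h1 : u k ≤ ⨆ k, u k := le_ciSup ⟨v 0, by rintro _ ⟨i, rfl⟩; exact huv i 0⟩ k
  have h2 : ⨆ k, u k ≤ v k := ciSup_le fun i => huv i k
  have hEn := abs_le.1 (hA (k + 2) (by omega))
  have hlog := hlogpos (k + 2) (by omega)
  set L := Real.log ((k + 2 : ℕ) : ℝ) with hL
  have hE1 : E (k + 2) / L ≤ K / L := by gcongr; exact hEn.2
  have hE2 : -(K / L) ≤ E (k + 2) / L := by rw [← neg_div]; gcongr; exact hEn.1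
  simp only [hu, hv, hD] at h1 h2
  rw [← hL] at h1 h2
  have e : (2 * K + 1) / L = K / L + (K + 1) / L := by ring
  rw [abs_le, e]
  constructor <;> linarith

lemma exists_primeWeightSum_floor_exp {c K : ℝ} (hK : 0 < K) (h : ∀ n : ℕ, 2 ≤ n →
    |primeWeightSum n - Real.log (Real.log n) - c| ≤ K / Real.log n) :
    ∃ C : ℝ, 0 < C ∧ ∀ v : ℝ, 0 < v →
      |primeWeightSum ⌊Real.exp v⌋₊ - Real.log v - c| ≤ C * v ^ (-(1 / 2 : ℝ)) := by
  refine ⟨8 * (K + 1) + 4 + |c|, by positivity, fun v hv => ?_⟩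
  set n := ⌊Real.exp v⌋₊ with hn
  have hv12 : 0 < v ^ (-(1 / 2 : ℝ)) := by positivity
  by_cases hv2 : Real.log 2 ≤ v
  · have h2 : 2 ≤ Real.exp v := by
      calc (2 : ℝ) = Real.exp (Real.log 2) := (Real.exp_log (by norm_num)).symm
        _ ≤ _ := Real.exp_le_exp.2 hv2
    have hn2 : 2 ≤ n := Nat.le_floor (by exact_mod_cast h2)
    have hn2' : (2 : ℝ) ≤ n := by exact_mod_cast hn2
    have hn0 : (0 : ℝ) < n := by linarith
    have hle : (n : ℝ) ≤ Real.exp v := Nat.floor_le (Real.exp_pos v).le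
    have hlt : Real.exp v < n + 1 := Nat.lt_floor_add_one _
    have ha : Real.log n ≤ v := by
      rw [← Real.log_exp v]; exact Real.log_le_log hn0 hle
    have hpos : 0 < Real.log n := Real.log_pos (by linarith)
    have hlog2 : 0.69 < Real.log 2 := by linarith [Real.log_two_gt_d9]
    have hln : Real.log 2 ≤ Real.log n := Real.log_le_log (by norm_num) hn2'
    have hva : v ≤ Real.log n + Real.log 2 := by
      rw [← Real.log_mul hn0.ne' (by norm_num), ← Real.log_exp v]
      refine Real.log_le_log (Real.exp_pos v) ?_
      linarith
    have hva' : v ≤ Real.log n + 1 := by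
      have := Real.log_two_lt_d9
      linarith
    have hll := log_log_sub_bounds hpos hv
    have h3 : |Real.log v - Real.log (Real.log n)| ≤ 1 / Real.log n := by
      rw [abs_of_nonneg (by have : 0 ≤ (v - Real.log n) / v := div_nonneg (by linarith) hv.le
                            linarith [hll.1])]
      refine hll.2.trans ?_
      gcongr
      linarith
    have h4 := h n hn2
    have h5 : |primeWeightSum n - Real.log v - c| ≤ (K + 1) / Real.log n := by
      calc |primeWeightSum n - Real.log v - c|
          = |(primeWeightSum n - Real.log (Real.log n) - c) -
              (Real.log v - Real.log (Real.log n))| := by congr 1; ring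
        _ ≤ _ := abs_sub _ _
        _ ≤ K / Real.log n + 1 / Real.log n := add_le_add h4 h3
        _ = _ := by ring
    have h6 : (K + 1) / Real.log n ≤ 8 * (K + 1) * v ^ (-(1 / 2 : ℝ)) := by
      have hs : v ^ (1 / 2 : ℝ) ≤ 8 * Real.log n := by
        rw [← Real.sqrt_eq_rpow]
        have : √v ≤ 1 + v := by
          rw [Real.sqrt_le_left (by linarith)]; nlinarith
        linarith
      rw [Real.rpow_neg hv.le, div_le_iff₀ hpos]
      have hvp : 0 < v ^ (1 / 2 : ℝ) := by positivity
      rw [mul_assoc, mul_assoc, mul_left_comm]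
      refine le_mul_of_one_le_right (by positivity) ?_
      rw [mul_left_comm, inv_mul_eq_div, one_le_div hvp]
      exact hs
    have h7 : 0 ≤ (4 + |c|) * v ^ (-(1 / 2 : ℝ)) := by positivity
    linarith
  · rw [not_le] at hv2
    have hlog2 := Real.log_two_lt_d9
    have hn1 : n ≤ 1 := by
      have : Real.exp v < 2 := by
        rw [← Real.exp_log (show (0 : ℝ) < 2 by norm_num)]; exact Real.exp_lt_exp.2 hv2
      have : n < 2 := (Nat.floor_lt (Real.exp_pos v).le).2 (by exact_mod_cast this)
      omega
    have h0 : primeWeightSum n = 0 := by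
      refine Finset.sum_eq_zero fun p hp => ?_
      rw [Finset.mem_Icc] at hp
      have : p = 1 := by omega
      rw [this, primeWeight, if_neg Nat.not_prime_one]
    have hv1 : v ≤ 1 := by linarith
    have hone : 1 ≤ v ^ (-(1 / 2 : ℝ)) := Real.one_le_rpow_of_pos_of_le_one_of_nonpos hv hv1
      (by norm_num)
    have hl : |Real.log v| ≤ 2 * v ^ (-(1 / 2 : ℝ)) := by
      rw [abs_of_nonpos (Real.log_nonpos hv.le hv1), ← Real.log_inv]
      have := Real.log_le_rpow_div (inv_nonneg.2 hv.le) (show (0 : ℝ) < 1 / 2 by norm_num)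
      rw [Real.inv_rpow hv.le, ← Real.rpow_neg hv.le] at this
      linarith
    rw [h0]
    calc |0 - Real.log v - c| ≤ |0 - Real.log v| + |c| := abs_sub _ _
      _ ≤ 2 * v ^ (-(1 / 2 : ℝ)) + |c| * v ^ (-(1 / 2 : ℝ)) := by
          rw [zero_sub, abs_neg]
          gcongr
          exact le_mul_of_one_le_right (abs_nonneg c) hone
      _ ≤ _ := by
          have : 0 ≤ (8 * (K + 1) + 2) * v ^ (-(1 / 2 : ℝ)) := by positivity
          linarith

lemma abs_log_le_rpow {v : ℝ} (hv : 0 < v) :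
    |Real.log v| ≤ 2 * v ^ (1 / 2 : ℝ) + 2 * v ^ (-(1 / 2) : ℝ) := by
  have h1 := Real.log_le_rpow_div hv.le (show (0 : ℝ) < 1 / 2 by norm_num)
  have h2 := Real.log_le_rpow_div (inv_nonneg.2 hv.le) (show (0 : ℝ) < 1 / 2 by norm_num)
  rw [Real.inv_rpow hv.le, ← Real.rpow_neg hv.le, Real.log_inv] at h2
  have p1 : 0 < v ^ (1 / 2 : ℝ) := by positivity
  have p2 : 0 < v ^ (-(1 / 2) : ℝ) := by positivity
  rw [abs_le]
  constructor <;> linarith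

lemma integrableOn_exp_neg_mul_rpow {a : ℝ} (ha : -1 < a) :
    IntegrableOn (fun w : ℝ => Real.exp (-w) * w ^ a) (Set.Ioi 0) := by
  have := Real.GammaIntegral_convergent (show 0 < a + 1 by linarith)
  simpa using this

lemma integrableOn_exp_neg_mul_log :
    IntegrableOn (fun w : ℝ => Real.exp (-w) * Real.log w) (Set.Ioi 0) := by
  have hb := ((integrableOn_exp_neg_mul_rpow (a := 1 / 2) (by norm_num)).const_mul 2).add
    ((integrableOn_exp_neg_mul_rpow (a := -(1 / 2)) (by norm_num)).const_mul 2)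
  refine Integrable.mono' hb (by fun_prop) ?_
  refine (ae_restrict_iff' measurableSet_Ioi).2 (Filter.Eventually.of_forall fun w hw => ?_)
  rw [norm_mul, Real.norm_of_nonneg (Real.exp_pos _).le, Real.norm_eq_abs]
  have := mul_le_mul_of_nonneg_left (abs_log_le_rpow hw) (Real.exp_pos (-w)).le
  refine this.trans (le_of_eq ?_)
  simp only [Pi.add_apply]
  ring

lemma integral_exp_neg_mul_log :
    ∫ w in Set.Ioi (0 : ℝ), Real.exp (-w) * Real.log w = -eulerMascheroniConstant := by
  have h1 := Complex.hasDerivAt_GammaIntegral (s := 1) (by simp)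
  have h2 : HasDerivAt Complex.GammaIntegral (-eulerMascheroniConstant : ℂ) 1 := by
    refine Complex.hasDerivAt_Gamma_one.congr_of_eventuallyEq ?_
    have : {s : ℂ | 0 < s.re} ∈ nhds (1 : ℂ) :=
      (isOpen_lt continuous_const Complex.continuous_re).mem_nhds (by simp)
    filter_upwards [this] with s hs
    exact (Complex.Gamma_eq_integral hs).symm
  have h3 := h1.unique h2
  have h4 : (∫ t : ℝ in Set.Ioi 0, (t : ℂ) ^ ((1 : ℂ) - 1) * (Real.log t * Real.exp (-t)) : ℂ) =
      ((∫ w in Set.Ioi (0 : ℝ), Real.exp (-w) * Real.log w : ℝ) : ℂ) := by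
    rw [← integral_complex_ofReal]
    refine setIntegral_congr_fun measurableSet_Ioi fun t _ => ?_
    simp [mul_comm]
  rw [h4] at h3
  exact_mod_cast h3

lemma primeWeight_mul_rpow_le (s : ℝ) (n : ℕ) :
    primeWeight n * (n : ℝ) ^ (-s) ≤ 3 * (1 / (n : ℝ) ^ (1 + s)) := by
  by_cases hp : n.Prime
  · have hn : (1 : ℝ) ≤ n := by exact_mod_cast hp.one_le
    have hn0 : (0 : ℝ) < n := by linarith
    have h1 : primeWeight n ≤ 3 / n := by
      refine (primeWeight_bounds hp).2.trans ?_
      have : 2 / (n : ℝ) ^ 2 ≤ 2 / n := by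
        refine div_le_div_of_nonneg_left (by norm_num) hn0 ?_
        nlinarith
      calc _ ≤ 1 / (n : ℝ) + 2 / n := by linarith
        _ = _ := by ring
    calc _ ≤ 3 / n * (n : ℝ) ^ (-s) := by gcongr
      _ = _ := by
        rw [Real.rpow_add hn0, Real.rpow_neg hn0.le, Real.rpow_one]; field_simp
  · rw [primeWeight, if_neg hp, zero_mul]; positivity

lemma summable_primeWeight_mul_rpow {s : ℝ} (hs : 0 < s) :
    Summable fun n : ℕ => primeWeight n * (n : ℝ) ^ (-s) :=
  Summable.of_nonneg_of_le (fun n => mul_nonneg (primeWeight_nonneg n) (by positivity))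
    (fun n => primeWeight_mul_rpow_le s n)
    ((Real.summable_one_div_nat_rpow.2 (by linarith)).mul_left 3)

lemma integral_indicator_exp_neg {c : ℝ} (hc : 0 < c) :
    ∫ w in Set.Ioi (0 : ℝ), (Set.Ici c).indicator (fun w => Real.exp (-w)) w = Real.exp (-c) := by
  rw [setIntegral_indicator measurableSet_Ici,
    show Set.Ioi (0 : ℝ) ∩ Set.Ici c = Set.Ici c from
      Set.inter_eq_right.2 fun x hx => lt_of_lt_of_le hc hx,
    integral_Ici_eq_integral_Ioi, integral_exp_neg_Ioi]

lemma tsum_primeWeight_mul_rpow {s : ℝ} (hs : 0 < s) :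
    ∑' n : ℕ, primeWeight n * (n : ℝ) ^ (-s) =
      ∫ w in Set.Ioi (0 : ℝ), Real.exp (-w) * primeWeightSum ⌊Real.exp (w / s)⌋₊ := by
  set F : ℕ → ℝ → ℝ := fun n w =>
    primeWeight n * (Set.Ici (s * Real.log n)).indicator (fun w => Real.exp (-w)) w with hF
  have hexp : IntegrableOn (fun w : ℝ => Real.exp (-w)) (Set.Ioi 0) := by
    simpa using integrableOn_exp_neg_mul_rpow (a := 0) (by norm_num)
  have hInt : ∀ n, IntegrableOn (F n) (Set.Ioi 0) := fun n =>
    Integrable.const_mul (Integrable.indicator hexp measurableSet_Ici) _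
  have hval : ∀ n, ∫ w in Set.Ioi (0 : ℝ), F n w = primeWeight n * (n : ℝ) ^ (-s) := by
    intro n
    by_cases hp : n.Prime
    · have hn : (1 : ℝ) < n := by exact_mod_cast hp.one_lt
      simp only [hF]
      rw [integral_const_mul, integral_indicator_exp_neg (mul_pos hs (Real.log_pos hn)),
        Real.rpow_def_of_pos (by linarith)]
      congr 2
      ring
    · simp [hF, primeWeight, hp]
  have hFn : ∀ n w, 0 ≤ F n w := fun n w =>
    mul_nonneg (primeWeight_nonneg n) (Set.indicator_nonneg (fun _ _ => (Real.exp_pos _).le) _)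
  have hsum := hasSum_integral_of_summable_integral_norm hInt (by
    simp_rw [Real.norm_of_nonneg (hFn _ _), hval]
    exact summable_primeWeight_mul_rpow hs)
  simp_rw [hval] at hsum
  rw [hsum.tsum_eq]
  refine setIntegral_congr_fun measurableSet_Ioi fun w _ => ?_
  rw [tsum_eq_sum (s := Finset.Icc 1 ⌊Real.exp (w / s)⌋₊), primeWeightSum, Finset.mul_sum]
  · refine Finset.sum_congr rfl fun n hn => ?_
    rw [Finset.mem_Icc] at hn
    have hn0 : (0 : ℝ) < n := by exact_mod_cast hn.1
    have h1 := (Nat.le_floor_iff (Real.exp_pos _).le).1 hn.2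
    have h2 := (Real.log_le_iff_le_exp hn0).2 h1
    rw [le_div_iff₀ hs, mul_comm] at h2
    simp only [hF]
    rw [Set.indicator_of_mem (show w ∈ Set.Ici (s * Real.log n) from h2), mul_comm]
  · intro n hn
    by_cases hp : n.Prime
    · have hn0 : (0 : ℝ) < n := by exact_mod_cast hp.pos
      rw [Finset.mem_Icc, not_and, not_le] at hn
      have h1 := (Nat.floor_lt (Real.exp_pos _).le).1 (hn hp.one_le)
      have h2 := (Real.lt_log_iff_exp_lt hn0).2 h1
      rw [div_lt_iff₀ hs, mul_comm] at h2
      simp only [hF]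
      rw [Set.indicator_of_notMem (show w ∉ Set.Ici (s * Real.log n) from not_le.2 h2), mul_zero]
    · simp [hF, primeWeight, hp]

lemma abs_tsum_primeWeight_add_log_le {c C : ℝ}
    (h : ∀ v : ℝ, 0 < v → |primeWeightSum ⌊Real.exp v⌋₊ - Real.log v - c| ≤
      C * v ^ (-(1 / 2 : ℝ))) {s : ℝ} (hs : 0 < s) :
    |∑' n : ℕ, primeWeight n * (n : ℝ) ^ (-s) + Real.log s + eulerMascheroniConstant - c| ≤
      C * Real.Gamma (1 / 2) * s ^ (1 / 2 : ℝ) := by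
  rw [tsum_primeWeight_mul_rpow hs]
  have hexp : IntegrableOn (fun w : ℝ => Real.exp (-w)) (Set.Ioi 0) := by
    simpa using integrableOn_exp_neg_mul_rpow (a := 0) (by norm_num)
  have hexp1 : ∫ w in Set.Ioi (0 : ℝ), Real.exp (-w) = 1 := by
    rw [integral_exp_neg_Ioi]; simp
  have hmain : IntegrableOn (fun w => Real.exp (-w) * Real.log w +
      (c - Real.log s) * Real.exp (-w)) (Set.Ioi 0) :=
    integrableOn_exp_neg_mul_log.add (hexp.const_mul _)
  have hmainval : ∫ w in Set.Ioi (0 : ℝ), (Real.exp (-w) * Real.log w +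
      (c - Real.log s) * Real.exp (-w)) = -eulerMascheroniConstant + (c - Real.log s) := by
    rw [integral_add integrableOn_exp_neg_mul_log (hexp.const_mul _), integral_exp_neg_mul_log,
      integral_const_mul, hexp1, mul_one]
  have hbd : IntegrableOn (fun w => C * s ^ (1 / 2 : ℝ) * (Real.exp (-w) * w ^ (-(1 / 2) : ℝ)))
      (Set.Ioi 0) := (integrableOn_exp_neg_mul_rpow (by norm_num)).const_mul _
  have hle : ∀ w ∈ Set.Ioi (0 : ℝ), ‖Real.exp (-w) * primeWeightSum ⌊Real.exp (w / s)⌋₊ -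
      (Real.exp (-w) * Real.log w + (c - Real.log s) * Real.exp (-w))‖ ≤
      C * s ^ (1 / 2 : ℝ) * (Real.exp (-w) * w ^ (-(1 / 2) : ℝ)) := by
    intro w hw
    have hw' : 0 < w := hw
    have := h (w / s) (div_pos hw' hs)
    rw [Real.log_div hw'.ne' hs.ne', Real.div_rpow hw'.le hs.le, Real.rpow_neg hs.le, div_inv_eq_mul]
      at this
    rw [show Real.exp (-w) * primeWeightSum ⌊Real.exp (w / s)⌋₊ -
      (Real.exp (-w) * Real.log w + (c - Real.log s) * Real.exp (-w)) = Real.exp (-w) *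
        (primeWeightSum ⌊Real.exp (w / s)⌋₊ - (Real.log w - Real.log s) - c) by ring, norm_mul,
      Real.norm_of_nonneg (Real.exp_pos _).le, Real.norm_eq_abs]
    refine (mul_le_mul_of_nonneg_left this (Real.exp_pos _).le).trans (le_of_eq ?_)
    ring
  have hmeas : Measurable fun w : ℝ => primeWeightSum ⌊Real.exp (w / s)⌋₊ :=
    (measurable_from_nat (f := primeWeightSum)).comp (Nat.measurable_floor.comp (by fun_prop))
  have hdiff : IntegrableOn (fun w => Real.exp (-w) * primeWeightSum ⌊Real.exp (w / s)⌋₊ -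
      (Real.exp (-w) * Real.log w + (c - Real.log s) * Real.exp (-w))) (Set.Ioi 0) := by
    refine Integrable.mono' hbd (Measurable.aestronglyMeasurable (by fun_prop)) ?_
    exact (ae_restrict_iff' measurableSet_Ioi).2 (Filter.Eventually.of_forall hle)
  have hB : IntegrableOn (fun w => Real.exp (-w) * primeWeightSum ⌊Real.exp (w / s)⌋₊)
      (Set.Ioi 0) := by
    refine (hdiff.add hmain).congr (Filter.Eventually.of_forall fun w => ?_)
    simp
  have hG : ∫ w in Set.Ioi (0 : ℝ), Real.exp (-w) * w ^ (-(1 / 2) : ℝ) = Real.Gamma (1 / 2) := by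
    rw [Real.Gamma_eq_integral (by norm_num)]
    norm_num
  have key := norm_integral_le_of_norm_le hbd
    ((ae_restrict_iff' measurableSet_Ioi).2 (Filter.Eventually.of_forall hle))
  rw [integral_const_mul, hG, integral_sub hB hmain, hmainval, Real.norm_eq_abs] at key
  refine le_trans (le_of_eq ?_) (key.trans (le_of_eq ?_))
  · congr 1; ring
  · ring

/-- The term `-log (1 - p^{-(1+s)})` of `log ζ(1+s)`, supported on primes. -/
noncomputable def primeLogTerm (s : ℝ) (n : ℕ) : ℝ :=
  if n.Prime then -Real.log (1 - (n : ℝ) ^ (-(1 + s))) else 0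

lemma prime_rpow_neg_le {p : ℕ} (hp : p.Prime) {s : ℝ} (hs : 0 < s) :
    (p : ℝ) ^ (-(1 + s)) ≤ 1 / p := by
  have hn : (1 : ℝ) ≤ p := by exact_mod_cast hp.one_le
  calc (p : ℝ) ^ (-(1 + s)) ≤ (p : ℝ) ^ (-1 : ℝ) :=
        Real.rpow_le_rpow_of_exponent_le hn (by linarith)
    _ = _ := by rw [Real.rpow_neg_one, one_div]

lemma abs_primeWeight_sub_primeLogTerm_le {s : ℝ} (hs : 0 < s) (n : ℕ) :
    |primeWeight n * (n : ℝ) ^ (-s) - primeLogTerm s n| ≤ 2 * (1 / (n : ℝ) ^ 2) := by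
  by_cases hp : n.Prime
  · have hn : (1 : ℝ) ≤ n := by exact_mod_cast hp.one_le
    have hn0 : (0 : ℝ) < n := by linarith
    have hu := prime_rpow_neg_le hp hs
    have hu0 : 0 < (n : ℝ) ^ (-(1 + s)) := by positivity
    have hhalf := one_div_prime_le_half hp
    have h2 := neg_log_one_sub_bounds (u := (n : ℝ) ^ (-(1 + s))) (by linarith)
    have h1 := primeWeight_bounds hp
    have hns : (n : ℝ) ^ (-s) ≤ 1 := Real.rpow_le_one_of_one_le_of_nonpos hn (by linarith)
    have hns0 : 0 < (n : ℝ) ^ (-s) := by positivity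
    have e : 1 / (n : ℝ) * (n : ℝ) ^ (-s) = (n : ℝ) ^ (-(1 + s)) := by
      rw [neg_add, Real.rpow_add hn0, Real.rpow_neg_one, one_div]
    have a1 := mul_le_mul_of_nonneg_right h1.1 hns0.le
    have a2 := mul_le_mul_of_nonneg_right h1.2 hns0.le
    rw [add_mul, e] at a2
    rw [e] at a1
    have a3 : 2 / (n : ℝ) ^ 2 * (n : ℝ) ^ (-s) ≤ 2 * (1 / (n : ℝ) ^ 2) := by
      rw [mul_one_div]
      exact mul_le_of_le_one_right (by positivity) hns
    have a4 : ((n : ℝ) ^ (-(1 + s))) ^ 2 ≤ 1 / (n : ℝ) ^ 2 := by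
      calc _ ≤ (1 / (n : ℝ)) ^ 2 := by gcongr
        _ = _ := by rw [div_pow, one_pow]
    rw [primeLogTerm, if_pos hp, abs_le]
    constructor <;> linarith
  · rw [primeWeight, primeLogTerm, if_neg hp, if_neg hp]
    simp

lemma summable_two_mul_one_div_sq : Summable fun n : ℕ => 2 * (1 / (n : ℝ) ^ 2) :=
  (Real.summable_one_div_nat_pow.2 (by norm_num)).mul_left 2

lemma summable_primeWeight_sub_primeLogTerm {s : ℝ} (hs : 0 < s) :
    Summable fun n : ℕ => primeWeight n * (n : ℝ) ^ (-s) - primeLogTerm s n :=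
  Summable.of_norm_bounded summable_two_mul_one_div_sq
    fun n => abs_primeWeight_sub_primeLogTerm_le hs n

lemma tendsto_tsum_primeWeight_sub :
    Filter.Tendsto (fun s : ℝ => ∑' n : ℕ, (primeWeight n * (n : ℝ) ^ (-s) - primeLogTerm s n))
      (nhdsWithin 0 (Set.Ioi 0)) (nhds 0) := by
  have := tendsto_tsum_of_dominated_convergence (𝓕 := nhdsWithin (0 : ℝ) (Set.Ioi 0))
    (f := fun s n => primeWeight n * (n : ℝ) ^ (-s) - primeLogTerm s n) (g := fun _ => 0)
    summable_two_mul_one_div_sq ?_ ?_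
  · simpa using this
  · intro n
    refine Filter.Tendsto.mono_left ?_ nhdsWithin_le_nhds
    by_cases hp : n.Prime
    · have hn : (1 : ℝ) < n := by exact_mod_cast hp.one_lt
      have hn0 : (0 : ℝ) < n := by linarith
      have hne : 1 - (n : ℝ) ^ (-(1 + (0 : ℝ))) ≠ 0 := by
        rw [add_zero, Real.rpow_neg_one]
        have := inv_lt_one_of_one_lt₀ hn
        linarith
      simp only [primeWeight, primeLogTerm, if_pos hp]
      have hc : ContinuousAt (fun s : ℝ => -Real.log (1 - 1 / (n : ℝ)) * (n : ℝ) ^ (-s) -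
          -Real.log (1 - (n : ℝ) ^ (-(1 + s)))) 0 := by
        refine ContinuousAt.sub ?_ (ContinuousAt.neg (ContinuousAt.log ?_ hne))
        · exact continuousAt_const.mul
            (ContinuousAt.rpow continuousAt_const (by fun_prop) (Or.inl hn0.ne'))
        · exact continuousAt_const.sub
            (ContinuousAt.rpow continuousAt_const (by fun_prop) (Or.inl hn0.ne'))
      have h0 := hc.tendsto
      simpa [Real.rpow_neg_one] using h0
    · simp [primeWeight, primeLogTerm, hp]
  · filter_upwards [self_mem_nhdsWithin] with s hs n
    exact abs_primeWeight_sub_primeLogTerm_le hs n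

lemma exp_tsum_primeLogTerm {s : ℝ} (hs : 0 < s) :
    (Real.exp (∑' n : ℕ, primeLogTerm s n) : ℂ) = riemannZeta (1 + s) := by
  rw [← riemannZeta_eulerProduct_exp_log (by simpa using hs), Complex.ofReal_exp]
  congr 1
  have h1 : ∑' n : ℕ, primeLogTerm s n = ∑' p : Nat.Primes, primeLogTerm s p := by
    refine Eq.trans ?_ (tsum_subtype {p : ℕ | p.Prime} (primeLogTerm s)).symm
    refine tsum_congr fun n => ?_
    by_cases hp : n.Prime
    · rw [Set.indicator_of_mem (show n ∈ {p : ℕ | p.Prime} from hp)]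
    · rw [Set.indicator_of_notMem (show n ∉ {p : ℕ | p.Prime} from hp), primeLogTerm, if_neg hp]
  rw [h1, Complex.ofReal_tsum]
  refine tsum_congr fun p => ?_
  have hp := p.2
  have hle := prime_rpow_neg_le hp hs
  have hhalf := one_div_prime_le_half hp
  rw [primeLogTerm, if_pos hp, Complex.ofReal_neg, Complex.ofReal_log (by linarith),
    Complex.ofReal_sub, Complex.ofReal_cpow (by positivity)]
  push_cast
  rfl

lemma tendsto_tsum_primeLogTerm :
    Filter.Tendsto (fun s : ℝ => ∑' n : ℕ, primeLogTerm s n + Real.log s)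
      (nhdsWithin 0 (Set.Ioi 0)) (nhds 0) := by
  have h1 : Filter.Tendsto (fun s : ℝ => (1 + s : ℂ)) (nhdsWithin 0 (Set.Ioi 0))
      (nhdsWithin 1 {1}ᶜ) := by
    refine tendsto_nhdsWithin_iff.2 ⟨?_, ?_⟩
    · refine Filter.Tendsto.mono_left ?_ nhdsWithin_le_nhds
      have : Continuous fun s : ℝ => (1 + s : ℂ) := by fun_prop
      simpa using this.tendsto 0
    · filter_upwards [self_mem_nhdsWithin] with s hs
      have : s ≠ 0 := ne_of_gt hs
      simpa using this
  have h2 := riemannZeta_residue_one.comp h1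
  have h3 : Filter.Tendsto (fun s : ℝ => s * Real.exp (∑' n : ℕ, primeLogTerm s n))
      (nhdsWithin 0 (Set.Ioi 0)) (nhds 1) := by
    have h4 := (Complex.continuous_re.tendsto _).comp h2
    rw [Complex.one_re] at h4
    refine h4.congr' ?_
    filter_upwards [self_mem_nhdsWithin] with s hs
    simp only [Function.comp_apply]
    rw [← exp_tsum_primeLogTerm hs, add_sub_cancel_left, ← Complex.ofReal_mul, Complex.ofReal_re]
  have h5 := ((Real.continuousAt_log one_ne_zero).tendsto).comp h3
  rw [Real.log_one] at h5
  refine h5.congr' ?_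
  filter_upwards [self_mem_nhdsWithin] with s hs
  have hs' : (0 : ℝ) < s := hs
  simp only [Function.comp_apply]
  rw [Real.log_mul hs'.ne' (Real.exp_pos _).ne', Real.log_exp, add_comm]

/-- Mertens' third theorem, in logarithmic form. -/
lemma exists_abs_primeWeightSum_le : ∃ K : ℝ, 0 < K ∧ ∀ n : ℕ, 2 ≤ n →
    |primeWeightSum n - Real.log (Real.log n) - eulerMascheroniConstant| ≤ K / Real.log n := by
  obtain ⟨c, K, hK, h⟩ := exists_primeWeightSum_sub_log_log
  obtain ⟨C, hC, hB⟩ := exists_primeWeightSum_floor_exp hK h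
  suffices hc : c = eulerMascheroniConstant from ⟨K, hK, hc ▸ h⟩
  have h1 : Filter.Tendsto (fun s : ℝ => ∑' n : ℕ, primeWeight n * (n : ℝ) ^ (-s) + Real.log s)
      (nhdsWithin 0 (Set.Ioi 0)) (nhds 0) := by
    have := tendsto_tsum_primeWeight_sub.add tendsto_tsum_primeLogTerm
    rw [add_zero] at this
    refine this.congr' ?_
    filter_upwards [self_mem_nhdsWithin] with s hs
    have ha := summable_primeWeight_mul_rpow hs
    have hb : Summable (primeLogTerm s) := by
      have := ha.sub (summable_primeWeight_sub_primeLogTerm hs)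
      refine this.congr fun n => ?_
      ring
    rw [ha.tsum_sub hb]
    ring
  have h2 : Filter.Tendsto (fun s : ℝ => C * Real.Gamma (1 / 2) * s ^ (1 / 2 : ℝ))
      (nhdsWithin 0 (Set.Ioi 0)) (nhds 0) := by
    refine Filter.Tendsto.mono_left ?_ nhdsWithin_le_nhds
    have hcont : ContinuousAt (fun s : ℝ => C * Real.Gamma (1 / 2) * s ^ (1 / 2 : ℝ)) 0 :=
      continuousAt_const.mul (ContinuousAt.rpow continuousAt_id continuousAt_const
        (Or.inr (by norm_num)))
    simpa using hcont.tendsto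
  have h3 := ((h1.add_const (eulerMascheroniConstant - c)).abs)
  have h4 := le_of_tendsto_of_tendsto h3 h2 (by
    filter_upwards [self_mem_nhdsWithin] with s hs
    refine le_trans (le_of_eq ?_) (abs_tsum_primeWeight_add_log_le hB hs)
    congr 1
    ring)
  rw [zero_add] at h4
  have := abs_nonpos_iff.1 h4
  linarith

lemma sum_one_div_smooth_le (b : ℕ) (S : Finset ℕ)
    (hS : ∀ m ∈ S, m ≠ 0 ∧ ∀ p : ℕ, p.Prime → p ∣ m → p ≤ b) :
    ∑ m ∈ S, 1 / (m : ℝ) ≤ Real.exp (primeWeightSum b) := by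
  set f : ℕ →* ℝ :=
    { toFun := fun m => (m : ℝ)⁻¹
      map_one' := by simp
      map_mul' := fun m n => by simp [mul_comm] } with hf
  have hfv : ∀ m, f m = (m : ℝ)⁻¹ := fun m => rfl
  have hs := EulerProduct.summable_and_hasSum_smoothNumbers_prod_primesBelow_geometric (f := f)
    (fun {p} hp => by
      rw [hfv, norm_inv, Real.norm_natCast]
      exact inv_lt_one_of_one_lt₀ (by exact_mod_cast hp.one_lt)) (b + 1)
  have hprod : ∏ p ∈ (b + 1).primesBelow, (1 - f p)⁻¹ = Real.exp (primeWeightSum b) := by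
    rw [primeWeightSum, Real.exp_sum]
    have : ∏ p ∈ Finset.Icc 1 b, Real.exp (primeWeight p) =
        ∏ p ∈ (Finset.Icc 1 b).filter Nat.Prime, Real.exp (primeWeight p) := by
      rw [Finset.prod_filter]
      refine Finset.prod_congr rfl fun p _ => ?_
      by_cases hp : p.Prime <;> simp [primeWeight, hp]
    rw [this]
    have hset : (b + 1).primesBelow = (Finset.Icc 1 b).filter Nat.Prime := by
      ext p
      simp only [Nat.mem_primesBelow, Finset.mem_filter, Finset.mem_Icc]
      constructor
      · rintro ⟨h1, h2⟩; exact ⟨⟨h2.one_le, by omega⟩, h2⟩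
      · rintro ⟨h1, h2⟩; exact ⟨by omega, h2⟩
    rw [hset]
    refine Finset.prod_congr rfl fun p hp => ?_
    have hp' := (Finset.mem_filter.1 hp).2
    have := one_div_prime_le_half hp'
    rw [primeWeight, if_pos hp', Real.exp_neg, Real.exp_log (by linarith), hfv, one_div]
  rw [← hprod]
  have hmem : ∀ m ∈ S, m ∈ (b + 1).smoothNumbers := by
    intro m hm
    rw [Nat.mem_smoothNumbers']
    intro p hp hpm
    have := (hS m hm).2 p hp hpm
    omega
  have h1 : ∑ m ∈ S.subtype (· ∈ (b + 1).smoothNumbers), f m = ∑ m ∈ S, f m := by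
    rw [Finset.sum_subtype_eq_sum_filter]
    rw [Finset.filter_true_of_mem hmem]
  calc ∑ m ∈ S, 1 / (m : ℝ) = ∑ m ∈ S, f m := by simp [hfv]
    _ = _ := h1.symm
    _ ≤ _ := sum_le_hasSum _ (fun m _ => by rw [hfv]; positivity) hs.2

lemma exists_sum_smooth_inv_le : ∃ K : ℝ, 0 < K ∧ ∀ b : ℕ, 2 ≤ b → ∀ S : Finset ℕ,
    (∀ m ∈ S, m ≠ 0 ∧ ∀ p : ℕ, p.Prime → p ∣ m → p ≤ b) →
    ∑ m ∈ S, 1 / (m : ℝ) ≤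
      Real.exp eulerMascheroniConstant * Real.log b * Real.exp (K / Real.log b) := by
  obtain ⟨K, hK, h⟩ := exists_abs_primeWeightSum_le
  refine ⟨K, hK, fun b hb S hS => (sum_one_div_smooth_le b S hS).trans ?_⟩
  have hlog : 0 < Real.log b := Real.log_pos (by exact_mod_cast (by omega : 1 < b))
  have := (abs_le.1 (h b hb)).2
  calc Real.exp (primeWeightSum b)
      ≤ Real.exp (eulerMascheroniConstant + Real.log (Real.log b) + K / Real.log b) :=
        Real.exp_le_exp.2 (by linarith)
    _ = _ := by rw [Real.exp_add, Real.exp_add, Real.exp_log hlog]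

lemma norm_sum_char_mul_conj_le {q : ℕ} [NeZero q] (a b : ZMod q) :
    ‖∑ χ : DirichletCharacter ℂ q, χ a * (starRingEnd ℂ) (χ b)‖ ≤
      if a = b then (q.totient : ℝ) else 0 := by
  by_cases hb : IsUnit b
  · have h := DirichletCharacter.sum_char_inv_mul_char_eq ℂ hb a
    have h2 : ∑ χ : DirichletCharacter ℂ q, χ a * (starRingEnd ℂ) (χ b) =
        ∑ χ : DirichletCharacter ℂ q, χ b⁻¹ * χ a := by
      refine Finset.sum_congr rfl fun χ _ => ?_
      have h1 : χ b⁻¹ * χ b = 1 := by rw [← map_mul, ZMod.inv_mul_of_unit b hb, map_one]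
      have h3 : ‖χ b‖ = 1 := χ.unit_norm_eq_one hb.unit
      have h4 : (starRingEnd ℂ) (χ b) * χ b = 1 := by
        rw [mul_comm, Complex.mul_conj, Complex.normSq_eq_norm_sq, h3]; norm_num
      have hne : χ b ≠ 0 := by intro h0; rw [h0, norm_zero] at h3; norm_num at h3
      rw [mul_right_cancel₀ hne (h4.trans h1.symm), mul_comm]
    rw [h2, h]
    by_cases hab : a = b
    · simp [hab]
    · simp [hab, Ne.symm hab]
  · have : ∀ χ : DirichletCharacter ℂ q, χ a * (starRingEnd ℂ) (χ b) = 0 := fun χ => by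
      rw [χ.map_nonunit hb, map_zero, mul_zero]
    simp only [this, Finset.sum_const_zero, norm_zero]
    split_ifs <;> positivity

lemma sum_norm_sq_char_sum_le {ι : Type*} {q : ℕ} [NeZero q] (F : Finset ι) (a : ι → ℂ)
    (N : ι → ZMod q) :
    ∑ χ : DirichletCharacter ℂ q, ‖∑ f ∈ F, a f * χ (N f)‖ ^ 2 ≤
      q.totient * ∑ f ∈ F, ∑ g ∈ F, if N f = N g then ‖a f‖ * ‖a g‖ else 0 := by
  have h1 : ((∑ χ : DirichletCharacter ℂ q, ‖∑ f ∈ F, a f * χ (N f)‖ ^ 2 : ℝ) : ℂ) =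
      ∑ f ∈ F, ∑ g ∈ F, a f * (starRingEnd ℂ) (a g) *
        ∑ χ : DirichletCharacter ℂ q, χ (N f) * (starRingEnd ℂ) (χ (N g)) := by
    have : ∀ χ : DirichletCharacter ℂ q, ((‖∑ f ∈ F, a f * χ (N f)‖ ^ 2 : ℝ) : ℂ) =
        ∑ f ∈ F, ∑ g ∈ F, a f * (starRingEnd ℂ) (a g) *
          (χ (N f) * (starRingEnd ℂ) (χ (N g))) := by
      intro χ
      rw [← Complex.normSq_eq_norm_sq, ← Complex.mul_conj, map_sum, Finset.sum_mul_sum]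
      refine Finset.sum_congr rfl fun f _ => Finset.sum_congr rfl fun g _ => ?_
      rw [map_mul]; ring
    rw [Complex.ofReal_sum]
    simp_rw [this, Finset.mul_sum]
    rw [Finset.sum_comm]
    refine Finset.sum_congr rfl fun f _ => ?_
    rw [Finset.sum_comm]
  have h2 : ∑ χ : DirichletCharacter ℂ q, ‖∑ f ∈ F, a f * χ (N f)‖ ^ 2 =
      ‖((∑ χ : DirichletCharacter ℂ q, ‖∑ f ∈ F, a f * χ (N f)‖ ^ 2 : ℝ) : ℂ)‖ := by
    rw [Complex.norm_real, Real.norm_of_nonneg]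
    positivity
  rw [h2, h1, Finset.mul_sum]
  refine (norm_sum_le _ _).trans (Finset.sum_le_sum fun f _ => ?_)
  rw [Finset.mul_sum]
  refine (norm_sum_le _ _).trans (Finset.sum_le_sum fun g _ => ?_)
  rw [norm_mul, norm_mul, RCLike.norm_conj]
  refine (mul_le_mul_of_nonneg_left (norm_sum_char_mul_conj_le (N f) (N g)) (by positivity)).trans
    (le_of_eq ?_)
  split_ifs <;> ring

/-- The `2k`-th moment over characters of a weighted character sum. -/
lemma sum_norm_pow_char_sum_le {q : ℕ} [NeZero q] (T : Finset ℕ) (c : ℕ → ℂ)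
    (hc : ∀ n ∈ T, ‖c n‖ ≤ 1 / n) (k : ℕ) :
    ∑ χ : DirichletCharacter ℂ q, ‖∑ n ∈ T, c n * χ (n : ZMod q)‖ ^ (2 * k) ≤
      q.totient * ∑ f ∈ Fintype.piFinset fun _ : Fin k => T,
        ∑ g ∈ Fintype.piFinset fun _ : Fin k => T,
          if ((∏ i, f i : ℕ) : ZMod q) = ((∏ i, g i : ℕ) : ZMod q) then
            1 / ((∏ i, f i : ℕ) : ℝ) * (1 / ((∏ i, g i : ℕ) : ℝ)) else 0 := by
  have h1 : ∀ χ : DirichletCharacter ℂ q, ‖∑ n ∈ T, c n * χ (n : ZMod q)‖ ^ (2 * k) =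
      ‖∑ f ∈ Fintype.piFinset fun _ : Fin k => T,
        (∏ i, c (f i)) * χ ((∏ i, f i : ℕ) : ZMod q)‖ ^ 2 := by
    intro χ
    rw [mul_comm 2 k, pow_mul, ← norm_pow]
    congr 2
    have := Finset.prod_univ_sum (fun _ : Fin k => T) fun _ n => c n * χ (n : ZMod q)
    rw [Finset.prod_const, Finset.card_univ, Fintype.card_fin] at this
    rw [this]
    refine Finset.sum_congr rfl fun f _ => ?_
    rw [Finset.prod_mul_distrib, Nat.cast_prod, map_prod]
  simp_rw [h1]
  refine (sum_norm_sq_char_sum_le _ _ _).trans ?_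
  gcongr with f hf g hg
  have hb : ∀ f ∈ Fintype.piFinset fun _ : Fin k => T,
      ‖∏ i, c (f i)‖ ≤ 1 / ((∏ i, f i : ℕ) : ℝ) := by
    intro f hf
    rw [norm_prod, Nat.cast_prod, one_div, ← Finset.prod_inv_distrib]
    refine Finset.prod_le_prod (fun i _ => norm_nonneg _) fun i _ => ?_
    rw [← one_div]
    exact hc _ (Fintype.mem_piFinset.1 hf i)
  split_ifs
  · exact mul_le_mul (hb f hf) (hb g hg) (norm_nonneg _) (by positivity)
  · exact le_rfl

lemma card_filter_prod_eq_le_factorial (T : Finset ℕ) (hT : ∀ p ∈ T, p.Prime) (k m : ℕ) :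
    ((Fintype.piFinset fun _ : Fin k => T).filter fun g => ∏ i, g i = m).card ≤ k.factorial := by
  set S := (Fintype.piFinset fun _ : Fin k => T).filter fun g => ∏ i, g i = m with hS
  have hperm : ∀ g ∈ S, (List.ofFn g).Perm m.primeFactorsList := by
    intro g hg
    rw [hS, Finset.mem_filter, Fintype.mem_piFinset] at hg
    refine Nat.primeFactorsList_unique ?_ ?_
    · rw [List.prod_ofFn]; exact hg.2
    · intro p hp
      obtain ⟨i, rfl⟩ := (List.mem_ofFn' g p).1 hp
      exact hT _ (hg.1 i)
  rcases S.eq_empty_or_nonempty with h0 | ⟨f, hf⟩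
  · rw [h0]; simp
  calc S.card ≤ ((List.ofFn f).permutations.toFinset).card := by
        refine Finset.card_le_card_of_injOn (fun g => List.ofFn g) (fun g hg => ?_)
          (fun g _ g' _ h => List.ofFn_injective h)
        simp only [Finset.mem_coe, List.mem_toFinset, List.mem_permutations]
        exact (hperm g hg).trans (hperm f hf).symm
    _ ≤ (List.ofFn f).permutations.length := List.toFinset_card_le _
    _ = k.factorial := by rw [List.length_permutations, List.length_ofFn]

lemma prod_lt_of_le {k b q : ℕ} (hbq : b ^ k < q) (f : Fin k → ℕ) (hf : ∀ i, f i ≤ b) :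
    ∏ i, f i < q := by
  refine lt_of_le_of_lt ?_ hbq
  calc ∏ i, f i ≤ ∏ _i : Fin k, b := Finset.prod_le_prod' fun i _ => hf i
    _ = b ^ k := by simp

lemma sum_norm_pow_prime_char_sum_le {q : ℕ} [NeZero q] {b k : ℕ} (hbq : b ^ k < q) (T : Finset ℕ)
    (hT : ∀ p ∈ T, p.Prime ∧ p ≤ b) (c : ℕ → ℂ) (hc : ∀ n ∈ T, ‖c n‖ ≤ 1 / n) :
    ∑ χ : DirichletCharacter ℂ q, ‖∑ n ∈ T, c n * χ (n : ZMod q)‖ ^ (2 * k) ≤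
      q.totient * (k.factorial * (∑ p ∈ T, 1 / (p : ℝ) ^ 2) ^ k) := by
  refine (sum_norm_pow_char_sum_le T c hc k).trans ?_
  refine mul_le_mul_of_nonneg_left ?_ (by positivity)
  rw [Finset.sum_pow', Finset.mul_sum]
  refine Finset.sum_le_sum fun f hf => ?_
  have hf' := Fintype.mem_piFinset.1 hf
  calc _ ≤ ∑ g ∈ (Fintype.piFinset fun _ : Fin k => T).filter (fun g => ∏ i, g i = ∏ i, f i),
        1 / ((∏ i, f i : ℕ) : ℝ) ^ 2 := by
        rw [Finset.sum_filter]
        refine Finset.sum_le_sum fun g hg => ?_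
        have hg' := Fintype.mem_piFinset.1 hg
        by_cases h : ((∏ i, f i : ℕ) : ZMod q) = ((∏ i, g i : ℕ) : ZMod q)
        · rw [if_pos h]
          rw [ZMod.natCast_eq_natCast_iff, Nat.ModEq,
            Nat.mod_eq_of_lt (prod_lt_of_le hbq f fun i => (hT _ (hf' i)).2),
            Nat.mod_eq_of_lt (prod_lt_of_le hbq g fun i => (hT _ (hg' i)).2)] at h
          rw [if_pos h.symm, ← h, sq, one_div_mul_one_div]
        · rw [if_neg h]
          split_ifs <;> positivity
    _ ≤ k.factorial * (1 / ((∏ i, f i : ℕ) : ℝ) ^ 2) := by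
        rw [Finset.sum_const, nsmul_eq_mul]
        refine mul_le_mul_of_nonneg_right ?_ (by positivity)
        exact_mod_cast card_filter_prod_eq_le_factorial T (fun p hp => (hT p hp).1) k _
    _ = _ := by
        rw [Nat.cast_prod, ← Finset.prod_pow, one_div, ← Finset.prod_inv_distrib]
        simp only [one_div]

/-- Markov's inequality for the counting measure on a finite type. -/
lemma card_filter_lt_mul_pow_le {X : Type*} [Fintype X] (F : X → ℝ) (hF : ∀ x, 0 ≤ F x) {t : ℝ}
    (ht : 0 < t) (k : ℕ) :
    ((Finset.univ.filter fun x => t < F x).card : ℝ) ≤ (∑ x, F x ^ k) / t ^ k := by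
  rw [le_div_iff₀ (by positivity)]
  calc _ = ∑ x ∈ Finset.univ.filter (fun x => t < F x), t ^ k := by
        rw [Finset.sum_const, nsmul_eq_mul]
    _ ≤ ∑ x ∈ Finset.univ.filter (fun x => t < F x), F x ^ k :=
        Finset.sum_le_sum fun x hx => by
          have := (Finset.mem_filter.1 hx).2
          gcongr
    _ ≤ _ := Finset.sum_le_sum_of_subset_of_nonneg (Finset.filter_subset _ _)
        fun x _ _ => pow_nonneg (hF x) k

lemma card_filter_exists_le {X I : Type*} [Fintype X] (J : Finset I) (P : I → X → Prop) {B : ℝ}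
    (hB : ∀ i ∈ J, ((Finset.univ.filter fun x => P i x).card : ℝ) ≤ B) :
    ((Finset.univ.filter fun x => ∃ i ∈ J, P i x).card : ℝ) ≤ J.card * B := by
  have : (Finset.univ.filter fun x => ∃ i ∈ J, P i x) ⊆
      J.biUnion fun i => Finset.univ.filter fun x => P i x := by
    intro x hx
    obtain ⟨i, hi, hP⟩ := (Finset.mem_filter.1 hx).2
    exact Finset.mem_biUnion.2 ⟨i, hi, by simpa using hP⟩
  calc _ ≤ ((J.biUnion fun i => Finset.univ.filter fun x => P i x).card : ℝ) := by
        exact_mod_cast Finset.card_le_card this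
    _ ≤ ((∑ i ∈ J, (Finset.univ.filter fun x => P i x).card : ℕ) : ℝ) := by
        exact_mod_cast Finset.card_biUnion_le
    _ ≤ ∑ _i ∈ J, B := by push_cast; exact Finset.sum_le_sum hB
    _ = _ := by rw [Finset.sum_const, nsmul_eq_mul]

lemma norm_e2pi (x : ℝ) : ‖e2pi x‖ = 1 := by
  rw [e2pi, show (2 * Real.pi * Complex.I * x : ℂ) = ((2 * Real.pi * x : ℝ) : ℂ) * Complex.I by
    push_cast; ring, Complex.norm_exp_ofReal_mul_I]

lemma norm_e2pi_sub_le (x y : ℝ) : ‖e2pi x - e2pi y‖ ≤ 2 * Real.pi * |x - y| := by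
  have h : e2pi x - e2pi y =
      e2pi y * (Complex.exp (Complex.I * ((2 * Real.pi * (x - y) : ℝ) : ℂ)) - 1) := by
    rw [mul_sub, mul_one, e2pi, e2pi, ← Complex.exp_add]
    congr 2
    push_cast; ring
  rw [h, norm_mul, norm_e2pi, one_mul]
  refine (Real.norm_exp_I_mul_ofReal_sub_one_le (x := 2 * Real.pi * (x - y))).trans (le_of_eq ?_)
  rw [Real.norm_eq_abs, abs_mul, abs_of_pos (by positivity)]

lemma e2pi_nat_mul_fract (n : ℕ) (x : ℝ) : e2pi (n * Int.fract x) = e2pi (n * x) := by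
  rw [e2pi, e2pi, Complex.exp_eq_exp_iff_exists_int]
  refine ⟨-(n * ⌊x⌋), ?_⟩
  rw [Int.fract]
  push_cast
  ring

lemma norm_char_sum_le_of_grid {q : ℕ} (χ : DirichletCharacter ℂ q) (T : Finset ℕ)
    (hT : ∀ n ∈ T, 0 < n) {N : ℕ} (hN : 0 < N) {t : ℝ}
    (hgrid : ∀ j ∈ Finset.range N,
      ‖∑ n ∈ T, χ (n : ZMod q) * e2pi (n * ((j : ℝ) / N)) / n‖ ≤ t) (θ : ℝ) :
    ‖∑ n ∈ T, χ (n : ZMod q) * e2pi (n * θ) / n‖ ≤ t + 2 * Real.pi * T.card / N := by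
  have hN' : (0 : ℝ) < N := by exact_mod_cast hN
  set j := ⌊Int.fract θ * N⌋₊ with hj
  have hf0 := Int.fract_nonneg θ
  have hf1 := Int.fract_lt_one θ
  have hjN : j < N := by
    refine (Nat.floor_lt (by positivity)).2 ?_
    exact mul_lt_of_lt_one_left hN' hf1
  have hj1 : (j : ℝ) ≤ Int.fract θ * N := Nat.floor_le (by positivity)
  have hj2 : Int.fract θ * N < j + 1 := Nat.lt_floor_add_one _
  have hclose : |Int.fract θ - (j : ℝ) / N| ≤ 1 / N := by
    rw [abs_of_nonneg (by rw [sub_nonneg, div_le_iff₀ hN']; exact hj1), sub_le_iff_le_add,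
      ← add_div, le_div_iff₀ hN']
    linarith
  have hdiff : ‖∑ n ∈ T, χ (n : ZMod q) * e2pi (n * θ) / n -
      ∑ n ∈ T, χ (n : ZMod q) * e2pi (n * ((j : ℝ) / N)) / n‖ ≤ 2 * Real.pi * T.card / N := by
    rw [← Finset.sum_sub_distrib]
    calc _ ≤ ∑ n ∈ T, ‖χ (n : ZMod q) * e2pi (n * θ) / n -
          χ (n : ZMod q) * e2pi (n * ((j : ℝ) / N)) / n‖ := norm_sum_le _ _
      _ ≤ ∑ _n ∈ T, 2 * Real.pi / N := by
          refine Finset.sum_le_sum fun n hn => ?_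
          have hn0 : (0 : ℝ) < n := by exact_mod_cast hT n hn
          rw [← sub_div, ← mul_sub, norm_div, norm_mul, Complex.norm_natCast, div_le_iff₀ hn0,
            ← e2pi_nat_mul_fract]
          calc _ ≤ 1 * (2 * Real.pi * |(n : ℝ) * Int.fract θ - n * ((j : ℝ) / N)|) :=
                mul_le_mul (DirichletCharacter.norm_le_one χ _) (norm_e2pi_sub_le _ _)
                  (norm_nonneg _) zero_le_one
            _ = 2 * Real.pi * n * |Int.fract θ - (j : ℝ) / N| := by
                rw [← mul_sub, abs_mul, abs_of_pos hn0]; ring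
            _ ≤ 2 * Real.pi * n * (1 / N) := by gcongr
            _ = _ := by ring
      _ = _ := by rw [Finset.sum_const, nsmul_eq_mul]; ring
  have := hgrid j (Finset.mem_range.2 hjN)
  calc _ ≤ ‖∑ n ∈ T, χ (n : ZMod q) * e2pi (n * ((j : ℝ) / N)) / n‖ +
        ‖∑ n ∈ T, χ (n : ZMod q) * e2pi (n * θ) / n -
          ∑ n ∈ T, χ (n : ZMod q) * e2pi (n * ((j : ℝ) / N)) / n‖ := norm_le_norm_add_norm_sub' _ _
    _ ≤ _ := add_le_add this hdiff

/-- Primes in `(a, b] ∩ [c, d]`. -/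
noncomputable def primesIn (a b c d : ℕ) : Finset ℕ :=
  (Finset.Ioc a b).filter fun p => p.Prime ∧ c ≤ p ∧ p ≤ d

/-- All exponentially twisted sums of `χ(p)/p` over intervals of primes inside `(a, b]` are
at most `t`. -/
def PrimeSumsLE {q : ℕ} (χ : DirichletCharacter ℂ q) (a b : ℕ) (t : ℝ) : Prop :=
  ∀ c ∈ Finset.range (b + 1), ∀ d ∈ Finset.range (b + 1), ∀ θ : ℝ,
    ‖∑ p ∈ primesIn a b c d, χ (p : ZMod q) * e2pi (p * θ) / p‖ ≤ t

lemma card_not_primeSumsLE_le {q : ℕ} [NeZero q] {a b k : ℕ} (hb : 2 ≤ b) (hbq : b ^ k < q)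
    {σ t : ℝ} (ht : 0 < t)
    (hσ : ∑ p ∈ (Finset.Ioc a b).filter Nat.Prime, 1 / (p : ℝ) ^ 2 ≤ σ) :
    ((Finset.univ.filter fun χ : DirichletCharacter ℂ q =>
      ¬ PrimeSumsLE χ a b (t + 2 * Real.pi / b)).card : ℝ) ≤
      q.totient * ((b : ℝ) ^ 6 * (k.factorial * (σ / t ^ 2) ^ k)) := by
  set J : Finset ((ℕ × ℕ) × ℕ) :=
    ((Finset.range (b + 1)) ×ˢ (Finset.range (b + 1))) ×ˢ (Finset.range (b ^ 2)) with hJ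
  have hb0 : (0 : ℝ) < b := by exact_mod_cast (by omega : 0 < b)
  have hsub : (Finset.univ.filter fun χ : DirichletCharacter ℂ q =>
      ¬ PrimeSumsLE χ a b (t + 2 * Real.pi / b)) ⊆
      Finset.univ.filter fun χ : DirichletCharacter ℂ q => ∃ i ∈ J,
        t < ‖∑ p ∈ primesIn a b i.1.1 i.1.2,
          χ (p : ZMod q) * e2pi (p * ((i.2 : ℝ) / (b ^ 2 : ℕ))) / p‖ := by
    intro χ hχ
    have hχ' := (Finset.mem_filter.1 hχ).2
    rw [Finset.mem_filter]
    refine ⟨Finset.mem_univ _, ?_⟩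
    by_contra hcon
    push Not at hcon
    refine hχ' fun c hc d hd θ => ?_
    have := norm_char_sum_le_of_grid χ (primesIn a b c d)
      (fun n hn => (Finset.mem_filter.1 hn).2.1.pos) (N := b ^ 2) (by positivity) (t := t)
      (fun j hj => hcon ((c, d), j) (by simp only [hJ, Finset.mem_product]; exact ⟨⟨hc, hd⟩, hj⟩)) θ
    refine this.trans ((add_le_add_iff_left t).2 ?_)
    have hcard : ((primesIn a b c d).card : ℝ) ≤ b := by
      have : (primesIn a b c d).card ≤ (Finset.Ioc a b).card :=
        Finset.card_le_card (Finset.filter_subset _ _)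
      rw [Nat.card_Ioc] at this
      exact_mod_cast this.trans (Nat.sub_le _ _)
    calc 2 * Real.pi * ((primesIn a b c d).card : ℝ) / ((b ^ 2 : ℕ) : ℝ)
        ≤ 2 * Real.pi * b / ((b ^ 2 : ℕ) : ℝ) := by gcongr
      _ = _ := by push_cast; field_simp
  have hσ0 : 0 ≤ σ := le_trans (Finset.sum_nonneg fun p _ => by positivity) hσ
  have hmom : ∀ i ∈ J, ((Finset.univ.filter fun χ : DirichletCharacter ℂ q =>
      t < ‖∑ p ∈ primesIn a b i.1.1 i.1.2,
        χ (p : ZMod q) * e2pi (p * ((i.2 : ℝ) / (b ^ 2 : ℕ))) / p‖).card : ℝ) ≤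
      q.totient * (k.factorial * (σ / t ^ 2) ^ k) := by
    intro i _
    refine (card_filter_lt_mul_pow_le _ (fun χ => norm_nonneg _) ht (2 * k)).trans ?_
    have h1 := sum_norm_pow_prime_char_sum_le (q := q) hbq (primesIn a b i.1.1 i.1.2)
      (fun p hp => by
        have := Finset.mem_filter.1 hp
        exact ⟨this.2.1, (Finset.mem_Ioc.1 this.1).2⟩)
      (fun p => e2pi (p * ((i.2 : ℝ) / (b ^ 2 : ℕ))) / p)
      (fun n _ => by rw [norm_div, norm_e2pi, Complex.norm_natCast])
    have h2 : ∑ p ∈ primesIn a b i.1.1 i.1.2, 1 / (p : ℝ) ^ 2 ≤ σ := by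
      refine le_trans (Finset.sum_le_sum_of_subset_of_nonneg ?_ fun p _ _ => by positivity) hσ
      intro p hp
      have := Finset.mem_filter.1 hp
      exact Finset.mem_filter.2 ⟨this.1, this.2.1⟩
    rw [div_le_iff₀ (by positivity)]
    calc _ = ∑ χ : DirichletCharacter ℂ q, ‖∑ p ∈ primesIn a b i.1.1 i.1.2,
          (e2pi (p * ((i.2 : ℝ) / (b ^ 2 : ℕ))) / p) * χ (p : ZMod q)‖ ^ (2 * k) := by
          refine Finset.sum_congr rfl fun χ _ => ?_
          congr 2
          refine Finset.sum_congr rfl fun p _ => ?_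
          ring
      _ ≤ _ := h1
      _ ≤ q.totient * (k.factorial * σ ^ k) := by gcongr
      _ = _ := by
          rw [div_pow, ← pow_mul]
          field_simp
  calc _ ≤ ((Finset.univ.filter fun χ : DirichletCharacter ℂ q => ∃ i ∈ J,
        t < ‖∑ p ∈ primesIn a b i.1.1 i.1.2,
          χ (p : ZMod q) * e2pi (p * ((i.2 : ℝ) / (b ^ 2 : ℕ))) / p‖).card : ℝ) := by
        exact_mod_cast Finset.card_le_card hsub
    _ ≤ J.card * (q.totient * (k.factorial * (σ / t ^ 2) ^ k)) := card_filter_exists_le J _ hmom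
    _ ≤ (b : ℝ) ^ 6 * (q.totient * (k.factorial * (σ / t ^ 2) ^ k)) := by
        have hJc : (J.card : ℝ) ≤ (b : ℝ) ^ 6 := by
          have : J.card ≤ b ^ 6 := by
            rw [hJ, Finset.card_product, Finset.card_product, Finset.card_range, Finset.card_range]
            have h3 : b + 1 ≤ b ^ 2 := by nlinarith
            calc (b + 1) * (b + 1) * b ^ 2 ≤ b ^ 2 * b ^ 2 * b ^ 2 := by gcongr
              _ = b ^ 6 := by ring
          exact_mod_cast this
        gcongr
    _ = _ := by ring

lemma exists_card_divisors_le {ε : ℝ} (h0 : 0 < ε) (h1 : ε ≤ 1) :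
    ∃ C : ℝ, 1 ≤ C ∧ ∀ n : ℕ, n ≠ 0 → (n.divisors.card : ℝ) ≤ C * (n : ℝ) ^ ε := by
  set M := ⌈(2 : ℝ) ^ (1 / ε)⌉₊ with hM
  set K : ℝ := 2 / ε with hK
  have hK1 : 1 ≤ K := by rw [hK, le_div_iff₀ h0]; linarith
  refine ⟨K ^ M, one_le_pow₀ hK1, fun n hn => ?_⟩
  have hfac : ∀ p ∈ n.primeFactors, ((n.factorization p : ℝ) + 1) ≤
      (if p < M then K else 1) * ((p : ℝ) ^ n.factorization p) ^ ε := by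
    intro p hp
    have hp' := Nat.prime_of_mem_primeFactors hp
    have hp2 : (2 : ℝ) ≤ p := by exact_mod_cast hp'.two_le
    set a := n.factorization p
    have e : ((p : ℝ) ^ a) ^ ε = ((p : ℝ) ^ ε) ^ a := by
      rw [← Real.rpow_natCast, ← Real.rpow_mul (by linarith), mul_comm, Real.rpow_mul (by linarith),
        Real.rpow_natCast]
    rw [e]
    split_ifs with h
    · have hpe : 1 + ε / 2 ≤ (p : ℝ) ^ ε := by
        calc 1 + ε / 2 ≤ Real.log 2 * ε + 1 := by nlinarith [Real.log_two_gt_d9]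
          _ ≤ Real.exp (Real.log 2 * ε) := Real.add_one_le_exp _
          _ = (2 : ℝ) ^ ε := by rw [Real.rpow_def_of_pos (by norm_num)]
          _ ≤ _ := Real.rpow_le_rpow (by norm_num) hp2 h0.le
      have hB := one_add_mul_le_pow (show (-2 : ℝ) ≤ ε / 2 by linarith) a
      calc (a : ℝ) + 1 ≤ K * (1 + a * (ε / 2)) := by
            rw [hK]
            have : 2 / ε * (1 + a * (ε / 2)) = 2 / ε + a := by field_simp
            rw [this]
            linarith
        _ ≤ K * (1 + ε / 2) ^ a := by gcongr
        _ ≤ _ := by gcongr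
    · rw [one_mul]
      have hpe : 2 ≤ (p : ℝ) ^ ε := by
        have h2 : (2 : ℝ) ^ (1 / ε) ≤ p := (Nat.le_ceil _).trans (by exact_mod_cast not_lt.1 h)
        calc (2 : ℝ) = ((2 : ℝ) ^ (1 / ε)) ^ ε := by
              rw [← Real.rpow_mul (by norm_num), one_div, inv_mul_cancel₀ h0.ne', Real.rpow_one]
          _ ≤ _ := Real.rpow_le_rpow (by positivity) h2 h0.le
      calc (a : ℝ) + 1 ≤ 2 ^ a := by exact_mod_cast Nat.lt_two_pow_self
        _ ≤ _ := by gcongr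
  rw [Nat.card_divisors hn]
  push_cast
  calc ∏ p ∈ n.primeFactors, ((n.factorization p : ℝ) + 1)
      ≤ ∏ p ∈ n.primeFactors, (if p < M then K else 1) * ((p : ℝ) ^ n.factorization p) ^ ε :=
        Finset.prod_le_prod (fun p _ => by positivity) hfac
    _ = (∏ p ∈ n.primeFactors, if p < M then K else 1) * (n : ℝ) ^ ε := by
        rw [Finset.prod_mul_distrib, Real.finsetProd_rpow _ _ (fun p _ => by positivity)]
        congr 2
        conv_rhs => rw [← Nat.prod_factorization_pow_eq_self hn]
        rw [Finsupp.prod, Nat.support_factorization]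
        push_cast
        rfl
    _ ≤ _ := by
        gcongr
        rw [← Finset.prod_filter, Finset.prod_const]
        refine pow_le_pow_right₀ hK1 ?_
        calc _ ≤ (Finset.range M).card := Finset.card_le_card fun p hp => by
              simpa using (Finset.mem_filter.1 hp).2
          _ = M := Finset.card_range M

lemma card_filter_prod_eq_le_divisors (T : Finset ℕ) (k : ℕ) {m : ℕ} (hm : m ≠ 0) :
    ((Fintype.piFinset fun _ : Fin k => T).filter fun g => ∏ i, g i = m).card ≤
      m.divisors.card ^ k := by
  calc _ ≤ (Fintype.piFinset fun _ : Fin k => m.divisors).card := by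
        refine Finset.card_le_card fun g hg => ?_
        have := (Finset.mem_filter.1 hg).2
        refine Fintype.mem_piFinset.2 fun i => Nat.mem_divisors.2 ⟨?_, hm⟩
        rw [← this]
        exact Finset.dvd_prod_of_mem _ (Finset.mem_univ i)
    _ = _ := by simp

lemma sum_Icc_one_div_le (X : ℕ) : ∑ j ∈ Finset.Icc 1 X, 1 / (j : ℝ) ≤ 1 + Real.log X := by
  have := harmonic_le_one_add_log X
  rw [harmonic_eq_sum_Icc] at this
  push_cast at this
  simpa using this

lemma sum_residue_class_one_div_le {q : ℕ} [NeZero q] (X : ℕ) (r : ZMod q) :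
    ∑ m ∈ (Finset.Icc q X).filter (fun m : ℕ => (m : ZMod q) = r), 1 / (m : ℝ) ≤
      (1 + Real.log X) / q := by
  have hq : 0 < q := Nat.pos_of_neZero q
  have hq' : (0 : ℝ) < q := by exact_mod_cast hq
  have hinj : Set.InjOn (fun m : ℕ => m / q)
      ((Finset.Icc q X).filter (fun m : ℕ => (m : ZMod q) = r) : Finset ℕ) := by
    intro m hm m' hm' h
    have h1 := (Finset.mem_filter.1 hm).2
    have h2 := (Finset.mem_filter.1 hm').2
    have h3 : m % q = m' % q := (ZMod.natCast_eq_natCast_iff' _ _ _).1 (h1.trans h2.symm)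
    have h4 : m / q = m' / q := h
    rw [← Nat.div_add_mod m q, ← Nat.div_add_mod m' q, h3, h4]
  calc _ ≤ ∑ m ∈ (Finset.Icc q X).filter (fun m : ℕ => (m : ZMod q) = r),
        1 / (q : ℝ) * (1 / ((m / q : ℕ) : ℝ)) := by
        refine Finset.sum_le_sum fun m hm => ?_
        have hm1 := Finset.mem_Icc.1 (Finset.mem_filter.1 hm).1
        rw [one_div_mul_one_div]
        have hd : 0 < m / q := Nat.div_pos hm1.1 hq
        have hd' : (0 : ℝ) < ((m / q : ℕ) : ℝ) := by exact_mod_cast hd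
        refine one_div_le_one_div_of_le (by positivity) ?_
        exact_mod_cast Nat.mul_div_le m q
    _ = 1 / (q : ℝ) * ∑ j ∈ ((Finset.Icc q X).filter
          (fun m : ℕ => (m : ZMod q) = r)).image (fun m : ℕ => m / q), 1 / (j : ℝ) := by
        rw [Finset.sum_image hinj, Finset.mul_sum]
    _ ≤ 1 / (q : ℝ) * ∑ j ∈ Finset.Icc 1 X, 1 / (j : ℝ) := by
        gcongr
        · intro j hj
          obtain ⟨m, hm, rfl⟩ := Finset.mem_image.1 hj
          have hm1 := Finset.mem_Icc.1 (Finset.mem_filter.1 hm).1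
          exact Finset.mem_Icc.2 ⟨Nat.div_pos hm1.1 hq, (Nat.div_le_self _ _).trans hm1.2⟩
    _ ≤ 1 / (q : ℝ) * (1 + Real.log X) := by gcongr; exact sum_Icc_one_div_le X
    _ = _ := by ring

lemma sum_norm_pow_large_char_sum_le {q : ℕ} [NeZero q] {w Z k : ℕ} (hwq : q ≤ w ^ k)
    (hZ : 1 ≤ Z) (T : Finset ℕ) (hT : ∀ n ∈ T, w ≤ n ∧ n ∈ Finset.Icc 1 Z) {D : ℝ}
    (hD : ∀ m : ℕ, m ≠ 0 → m ≤ Z ^ k → (m.divisors.card : ℝ) ^ k ≤ D)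
    (c : ℕ → ℂ) (hc : ∀ n ∈ T, ‖c n‖ ≤ 1 / n) :
    ∑ χ : DirichletCharacter ℂ q, ‖∑ n ∈ T, c n * χ (n : ZMod q)‖ ^ (2 * k) ≤
      q.totient * ((1 + Real.log Z) ^ k * (D * ((1 + k * Real.log Z) / q))) := by
  refine (sum_norm_pow_char_sum_le T c hc k).trans ?_
  refine mul_le_mul_of_nonneg_left ?_ (by positivity)
  have hq : 0 < q := Nat.pos_of_neZero q
  have hZ' : (1 : ℝ) ≤ Z := by exact_mod_cast hZ
  have hlogZ := Real.log_nonneg hZ'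
  have hD0 : 0 ≤ D := le_trans (by positivity) (hD 1 one_ne_zero (Nat.one_le_pow _ _ hZ))
  have hmaps : ∀ g ∈ Fintype.piFinset fun _ : Fin k => T, ∏ i, g i ∈ Finset.Icc q (Z ^ k) := by
    intro g hg
    have hg' := Fintype.mem_piFinset.1 hg
    rw [Finset.mem_Icc]
    constructor
    · refine hwq.trans ?_
      calc w ^ k = ∏ _i : Fin k, w := by simp
        _ ≤ ∏ i, g i := Finset.prod_le_prod' fun i _ => (hT _ (hg' i)).1
    · calc ∏ i, g i ≤ ∏ _i : Fin k, Z :=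
            Finset.prod_le_prod' fun i _ => (Finset.mem_Icc.1 (hT _ (hg' i)).2).2
        _ = Z ^ k := by simp
  have hinner : ∀ f ∈ Fintype.piFinset fun _ : Fin k => T,
      (∑ g ∈ Fintype.piFinset fun _ : Fin k => T,
          if ((∏ i, f i : ℕ) : ZMod q) = ((∏ i, g i : ℕ) : ZMod q) then
            1 / ((∏ i, f i : ℕ) : ℝ) * (1 / ((∏ i, g i : ℕ) : ℝ)) else 0) ≤
      (∏ i, 1 / (f i : ℝ)) * (D * ((1 + k * Real.log Z) / q)) := by
    intro f _
    have e1 : (∏ i, 1 / (f i : ℝ)) = 1 / ((∏ i, f i : ℕ) : ℝ) := by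
      rw [Nat.cast_prod, one_div, ← Finset.prod_inv_distrib]
      simp
    rw [e1]
    set r := ((∏ i, f i : ℕ) : ZMod q)
    rw [← Finset.sum_fiberwise_of_maps_to hmaps]
    calc _ ≤ ∑ m ∈ Finset.Icc q (Z ^ k), if (m : ZMod q) = r then
            1 / ((∏ i, f i : ℕ) : ℝ) * (D * (1 / (m : ℝ))) else 0 := by
          refine Finset.sum_le_sum fun m hm => ?_
          have hm' := Finset.mem_Icc.1 hm
          have hm0 : m ≠ 0 := by omega
          by_cases hr : (m : ZMod q) = r
          · rw [if_pos hr]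
            calc _ = ∑ g ∈ (Fintype.piFinset fun _ : Fin k => T).filter (fun g => ∏ i, g i = m),
                  1 / ((∏ i, f i : ℕ) : ℝ) * (1 / (m : ℝ)) := by
                  refine Finset.sum_congr rfl fun g hg => ?_
                  rw [(Finset.mem_filter.1 hg).2, if_pos hr.symm]
              _ ≤ D * (1 / ((∏ i, f i : ℕ) : ℝ) * (1 / (m : ℝ))) := by
                  rw [Finset.sum_const, nsmul_eq_mul]
                  refine mul_le_mul_of_nonneg_right ?_ (by positivity)
                  refine le_trans ?_ (hD m hm0 hm'.2)
                  exact_mod_cast card_filter_prod_eq_le_divisors T k hm0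
              _ = _ := by ring
          · rw [if_neg hr]
            refine Finset.sum_nonpos fun g hg => ?_
            rw [(Finset.mem_filter.1 hg).2, if_neg fun h => hr h.symm]
      _ = 1 / ((∏ i, f i : ℕ) : ℝ) * (D *
          ∑ m ∈ (Finset.Icc q (Z ^ k)).filter (fun m : ℕ => (m : ZMod q) = r), 1 / (m : ℝ)) := by
          rw [← Finset.sum_filter, ← Finset.mul_sum, ← Finset.mul_sum]
      _ ≤ _ := by
          gcongr
          refine (sum_residue_class_one_div_le _ r).trans ?_
          rw [Nat.cast_pow, Real.log_pow]
  refine (Finset.sum_le_sum hinner).trans ?_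
  rw [← Finset.sum_mul, ← Finset.sum_pow' T fun n : ℕ => 1 / (n : ℝ)]
  refine mul_le_mul_of_nonneg_right ?_ (by positivity)
  refine pow_le_pow_left₀ (Finset.sum_nonneg fun n _ => by positivity) ?_ k
  refine le_trans (Finset.sum_le_sum_of_subset_of_nonneg (fun n hn => (hT n hn).2)
    fun n _ _ => by positivity) (sum_Icc_one_div_le Z)

lemma exists_card_large_le : ∃ C : ℝ, 1 ≤ C ∧ ∀ (q : ℕ) [NeZero q] (Z : ℕ) (T : Finset ℕ),
    1 ≤ Z → (Z : ℝ) ≤ (q : ℝ) ^ ((11 : ℝ) / 21) →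
    (∀ n ∈ T, (q : ℝ) ^ ((1 : ℝ) / 100) ≤ n ∧ n ∈ Finset.Icc 1 Z) →
    ((Finset.univ.filter fun χ : DirichletCharacter ℂ q => ¬ ∀ θ : ℝ,
      ‖∑ n ∈ T, χ (n : ZMod q) * e2pi (n * θ) / n‖ ≤ 8 * (q : ℝ) ^ (-(1 : ℝ) / 800)).card : ℝ) ≤
      q.totient * (C * (q : ℝ) ^ (-(1 : ℝ) / 8)) := by
  obtain ⟨B, hB1, hB⟩ := exists_card_divisors_le (ε := 1 / 100000) (by norm_num) (by norm_num)
  refine ⟨2 * (10101 : ℝ) ^ 100 * (B ^ 100 * (100 * 10101)), ?_, ?_⟩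
  · have : 1 ≤ B ^ 100 := one_le_pow₀ hB1
    have : (1 : ℝ) ≤ 10101 ^ 100 := one_le_pow₀ (by norm_num)
    nlinarith
  intro q _ Z T hZ hZq hT
  have hq1 : 1 ≤ q := Nat.pos_of_neZero q
  set Q : ℝ := (q : ℝ) with hQ
  have hQ1 : 1 ≤ Q := by rw [hQ]; exact_mod_cast hq1
  have hQ0 : 0 < Q := by linarith
  have hZ0 : (0 : ℝ) < Z := by exact_mod_cast hZ
  have hlogZ : 0 ≤ Real.log Z := Real.log_nonneg (by exact_mod_cast hZ)
  set w := ⌈Q ^ ((1 : ℝ) / 100)⌉₊ with hw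
  have hwq : q ≤ w ^ 100 := by
    have : Q ≤ (w : ℝ) ^ 100 := by
      calc Q = (Q ^ ((1 : ℝ) / 100)) ^ 100 := by
            rw [← Real.rpow_natCast, ← Real.rpow_mul hQ0.le]; norm_num
        _ ≤ _ := by gcongr; exact Nat.le_ceil _
    rw [hQ] at this
    exact_mod_cast this
  set H := ⌈Q ^ ((1 : ℝ) / 800)⌉₊ with hH
  have hQ800 : 1 ≤ Q ^ ((1 : ℝ) / 800) := Real.one_le_rpow hQ1 (by norm_num)
  have hH1 : Q ^ ((1 : ℝ) / 800) ≤ H := Nat.le_ceil _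
  have hH0 : 0 < H := by
    have : (0 : ℝ) < H := by linarith
    exact_mod_cast this
  have hH2 : (H : ℝ) ≤ 2 * Q ^ ((1 : ℝ) / 800) := by
    have := Nat.ceil_lt_add_one (show 0 ≤ Q ^ ((1 : ℝ) / 800) by linarith)
    linarith
  set t := Q ^ (-(1 : ℝ) / 800) with ht
  have ht0 : 0 < t := by positivity
  have hsub : (Finset.univ.filter fun χ : DirichletCharacter ℂ q => ¬ ∀ θ : ℝ,
      ‖∑ n ∈ T, χ (n : ZMod q) * e2pi (n * θ) / n‖ ≤ 8 * t) ⊆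
      Finset.univ.filter fun χ : DirichletCharacter ℂ q => ∃ j ∈ Finset.range (Z * H),
        t < ‖∑ n ∈ T, χ (n : ZMod q) * e2pi (n * ((j : ℝ) / (Z * H : ℕ))) / n‖ := by
    intro χ hχ
    have hχ' := (Finset.mem_filter.1 hχ).2
    rw [Finset.mem_filter]
    refine ⟨Finset.mem_univ _, ?_⟩
    by_contra hcon
    push Not at hcon
    refine hχ' fun θ => ?_
    refine (norm_char_sum_le_of_grid χ T (fun n hn => (Finset.mem_Icc.1 (hT n hn).2).1)
      (N := Z * H) (by positivity) hcon θ).trans ?_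
    have hcard : (T.card : ℝ) ≤ Z := by
      have : T.card ≤ (Finset.Icc 1 Z).card := Finset.card_le_card fun n hn => (hT n hn).2
      simp at this
      exact_mod_cast this
    have hHinv : 1 / (H : ℝ) ≤ t := by
      rw [ht, show (-(1 : ℝ) / 800) = -(1 / 800) by norm_num, Real.rpow_neg hQ0.le, ← one_div]
      exact one_div_le_one_div_of_le (by linarith) hH1
    have : 2 * Real.pi * (T.card : ℝ) / ((Z * H : ℕ) : ℝ) ≤ 7 * t := by
      have hH0' : (0 : ℝ) < H := by exact_mod_cast hH0
      calc 2 * Real.pi * (T.card : ℝ) / ((Z * H : ℕ) : ℝ)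
          ≤ 2 * Real.pi * Z / ((Z * H : ℕ) : ℝ) := by gcongr
        _ = 2 * Real.pi * (1 / H) := by push_cast; field_simp
        _ ≤ 7 * t := by
            have := Real.pi_lt_d2
            exact mul_le_mul (by linarith) hHinv (by positivity) (by norm_num)
    linarith
  set D : ℝ := B ^ 100 * Q ^ ((11 : ℝ) / 210) with hD
  have hDbd : ∀ m : ℕ, m ≠ 0 → m ≤ Z ^ 100 → (m.divisors.card : ℝ) ^ 100 ≤ D := by
    intro m hm hmZ
    have hmQ : (m : ℝ) ≤ Q ^ ((1100 : ℝ) / 21) := by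
      calc (m : ℝ) ≤ (Z : ℝ) ^ 100 := by exact_mod_cast hmZ
        _ ≤ (Q ^ ((11 : ℝ) / 21)) ^ 100 := by gcongr
        _ = _ := by rw [← Real.rpow_natCast, ← Real.rpow_mul hQ0.le]; norm_num
    calc (m.divisors.card : ℝ) ^ 100 ≤ (B * (m : ℝ) ^ ((1 : ℝ) / 100000)) ^ 100 := by
          gcongr; exact hB m hm
      _ ≤ (B * (Q ^ ((1100 : ℝ) / 21)) ^ ((1 : ℝ) / 100000)) ^ 100 := by gcongr
      _ = D := by
          rw [mul_pow, ← Real.rpow_natCast (_ ^ ((1 : ℝ) / 100000)), ← Real.rpow_mul (by positivity),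
            ← Real.rpow_mul hQ0.le, hD]
          norm_num
  have hlog : 1 + Real.log Z ≤ 10101 * Q ^ ((1 : ℝ) / 10100) := by
    have h1 : Real.log Z ≤ Real.log Q := by
      refine Real.log_le_log hZ0 (hZq.trans ?_)
      calc Q ^ ((11 : ℝ) / 21) ≤ Q ^ (1 : ℝ) := Real.rpow_le_rpow_of_exponent_le hQ1 (by norm_num)
        _ = Q := Real.rpow_one Q
    have h2 := Real.log_le_rpow_div hQ0.le (show (0 : ℝ) < 1 / 10100 by norm_num)
    have h3 : 1 ≤ Q ^ ((1 : ℝ) / 10100) := Real.one_le_rpow hQ1 (by norm_num)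
    rw [div_eq_mul_inv] at h2
    norm_num at h2 h3 ⊢
    linarith
  have hmom : ∀ j ∈ Finset.range (Z * H), ((Finset.univ.filter fun χ : DirichletCharacter ℂ q =>
      t < ‖∑ n ∈ T, χ (n : ZMod q) * e2pi (n * ((j : ℝ) / (Z * H : ℕ))) / n‖).card : ℝ) ≤
      q.totient * ((10101 * Q ^ ((1 : ℝ) / 10100)) ^ 100 *
        (D * ((100 * (10101 * Q ^ ((1 : ℝ) / 10100))) / Q))) / t ^ 200 := by
    intro j _
    refine (card_filter_lt_mul_pow_le _ (fun χ => norm_nonneg _) ht0 (2 * 100)).trans ?_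
    have h1 := sum_norm_pow_large_char_sum_le (q := q) hwq hZ T
      (fun n hn => ⟨Nat.ceil_le.2 (hT n hn).1, (hT n hn).2⟩) hDbd
      (fun n => e2pi (n * ((j : ℝ) / (Z * H : ℕ))) / n)
      (fun n _ => by rw [norm_div, norm_e2pi, Complex.norm_natCast])
    have hD0 : 0 ≤ D := by positivity
    refine div_le_div_of_nonneg_right ?_ (by positivity)
    calc _ = ∑ χ : DirichletCharacter ℂ q, ‖∑ n ∈ T,
          (e2pi (n * ((j : ℝ) / (Z * H : ℕ))) / n) * χ (n : ZMod q)‖ ^ (2 * 100) := by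
          refine Finset.sum_congr rfl fun χ _ => ?_
          congr 2
          refine Finset.sum_congr rfl fun p _ => ?_
          ring
      _ ≤ _ := h1
      _ ≤ _ := by
          gcongr
          push_cast
          linarith
  have hN : ((Z * H : ℕ) : ℝ) ≤ Q ^ ((11 : ℝ) / 21) * (2 * Q ^ ((1 : ℝ) / 800)) := by
    push_cast
    gcongr
  calc _ ≤ ((Finset.univ.filter fun χ : DirichletCharacter ℂ q => ∃ j ∈ Finset.range (Z * H),
        t < ‖∑ n ∈ T, χ (n : ZMod q) * e2pi (n * ((j : ℝ) / (Z * H : ℕ))) / n‖).card : ℝ) := by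
        exact_mod_cast Finset.card_le_card hsub
    _ ≤ _ := card_filter_exists_le _ _ hmom
    _ ≤ Q ^ ((11 : ℝ) / 21) * (2 * Q ^ ((1 : ℝ) / 800)) *
        (q.totient * ((10101 * Q ^ ((1 : ℝ) / 10100)) ^ 100 *
        (D * ((100 * (10101 * Q ^ ((1 : ℝ) / 10100))) / Q))) / t ^ 200) := by
        rw [Finset.card_range]
        gcongr
    _ = q.totient * (2 * (10101 : ℝ) ^ 100 * (B ^ 100 * (100 * 10101)) *
        (Q ^ ((11 : ℝ) / 21) * Q ^ ((1 : ℝ) / 800) * (Q ^ ((1 : ℝ) / 10100)) ^ 100 *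
          Q ^ ((11 : ℝ) / 210) * Q ^ ((1 : ℝ) / 10100) * Q⁻¹ * (t ^ 200)⁻¹)) := by
        rw [hD]
        generalize Q ^ ((11 : ℝ) / 21) = x1
        generalize Q ^ ((1 : ℝ) / 800) = x2
        generalize Q ^ ((1 : ℝ) / 10100) = x3
        generalize Q ^ ((11 : ℝ) / 210) = x4
        rw [mul_pow, div_eq_mul_inv, div_eq_mul_inv]
        generalize (10101 : ℝ) ^ 100 = x5
        generalize x3 ^ 100 = x6
        ring
    _ ≤ _ := by
        have e1 : (Q ^ ((1 : ℝ) / 10100)) ^ 100 = Q ^ ((1 : ℝ) / 101) := by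
          rw [← Real.rpow_natCast, ← Real.rpow_mul hQ0.le]; norm_num
        have e2 : (t ^ 200)⁻¹ = Q ^ ((1 : ℝ) / 4) := by
          rw [ht, ← Real.rpow_natCast, ← Real.rpow_mul hQ0.le, ← Real.rpow_neg hQ0.le]; norm_num
        have e3 : Q⁻¹ = Q ^ (-1 : ℝ) := (Real.rpow_neg_one Q).symm
        rw [e1, e2, e3, ← Real.rpow_add hQ0, ← Real.rpow_add hQ0, ← Real.rpow_add hQ0,
          ← Real.rpow_add hQ0, ← Real.rpow_add hQ0, ← Real.rpow_add hQ0]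
        gcongr
        norm_num

/-- The largest prime factor of `n`, with value `0` at `n ≤ 1`. -/
def maxPrimeFac (n : ℕ) : ℕ := n.primeFactors.sup id

lemma maxPrimeFac_le_iff {n c : ℕ} (hn : n ≠ 0) :
    maxPrimeFac n ≤ c ↔ ∀ p : ℕ, p.Prime → p ∣ n → p ≤ c := by
  rw [maxPrimeFac, Finset.sup_le_iff]
  constructor
  · intro h p hp hd
    exact h p (Nat.mem_primeFactors.2 ⟨hp, hd, hn⟩)
  · intro h p hp
    exact h p (Nat.prime_of_mem_primeFactors hp) (Nat.dvd_of_mem_primeFactors hp)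

lemma le_maxPrimeFac {n p : ℕ} (hn : n ≠ 0) (hp : p.Prime) (hd : p ∣ n) : p ≤ maxPrimeFac n :=
  (maxPrimeFac_le_iff hn).1 le_rfl p hp hd

lemma maxPrimeFac_mem {n : ℕ} (h : 0 < maxPrimeFac n) : maxPrimeFac n ∈ n.primeFactors := by
  have hne : n.primeFactors.Nonempty := by
    by_contra h0
    rw [Finset.not_nonempty_iff_eq_empty] at h0
    simp [maxPrimeFac, h0] at h
  obtain ⟨p, hp, he⟩ := Finset.exists_mem_eq_sup _ hne id
  rw [maxPrimeFac, he]
  exact hp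

lemma maxPrimeFac_mul {m p : ℕ} (hm : m ≠ 0) (hp : p.Prime) (h : maxPrimeFac m ≤ p) :
    maxPrimeFac (m * p) = p := by
  have hmp : m * p ≠ 0 := mul_ne_zero hm hp.ne_zero
  refine le_antisymm ((maxPrimeFac_le_iff hmp).2 fun r hr hd => ?_)
    (le_maxPrimeFac hmp hp (dvd_mul_left p m))
  rcases hr.dvd_mul.1 hd with h1 | h1
  · exact (le_maxPrimeFac hm hr h1).trans h
  · exact Nat.le_of_dvd hp.pos h1

/-- Integers in `[1, Z]` whose largest prime factor lies in `(a, b]`. -/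
noncomputable def maxPrimeRange (Z a b : ℕ) : Finset ℕ :=
  (Finset.Icc 1 Z).filter fun n => a < maxPrimeFac n ∧ maxPrimeFac n ≤ b

lemma sum_maxPrimeRange (Z a b : ℕ) (F : ℕ → ℂ) :
    ∑ n ∈ maxPrimeRange Z a b, F n =
      ∑ m ∈ (Finset.Icc 1 Z).filter (fun m => maxPrimeFac m ≤ b),
        ∑ p ∈ primesIn a b (maxPrimeFac m) (min (Z / m) b), F (m * p) := by
  rw [Finset.sum_sigma']
  refine Finset.sum_bij' (fun n _ => ⟨n / maxPrimeFac n, maxPrimeFac n⟩)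
    (fun x _ => x.1 * x.2) ?_ ?_ ?_ ?_ ?_
  · intro n hn
    rw [maxPrimeRange, Finset.mem_filter, Finset.mem_Icc] at hn
    obtain ⟨⟨h1, h2⟩, h3, h4⟩ := hn
    have hmem := maxPrimeFac_mem (lt_of_le_of_lt (Nat.zero_le a) h3)
    have hp := Nat.prime_of_mem_primeFactors hmem
    have hd := Nat.dvd_of_mem_primeFactors hmem
    have hn0 : n ≠ 0 := by omega
    set p := maxPrimeFac n with hpdef
    have hm0 : 0 < n / p := Nat.div_pos (Nat.le_of_dvd (by omega) hd) hp.pos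
    have hmp : maxPrimeFac (n / p) ≤ p :=
      (maxPrimeFac_le_iff hm0.ne').2 fun r hr hrd =>
        le_maxPrimeFac hn0 hr (hrd.trans (Nat.div_dvd_of_dvd hd))
    simp only [Finset.mem_sigma, Finset.mem_filter, Finset.mem_Icc, primesIn, Finset.mem_Ioc]
    refine ⟨⟨⟨hm0, (Nat.div_le_self _ _).trans h2⟩, hmp.trans h4⟩, ⟨h3, h4⟩, hp, hmp, ?_⟩
    refine le_min ?_ h4
    rw [Nat.le_div_iff_mul_le hm0, mul_comm, Nat.div_mul_cancel hd]
    exact h2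
  · rintro ⟨m, p⟩ hx
    simp only [Finset.mem_sigma, Finset.mem_filter, Finset.mem_Icc, primesIn, Finset.mem_Ioc] at hx
    obtain ⟨⟨⟨hm1, _⟩, _⟩, ⟨ha, hb⟩, hp, hc, hd⟩ := hx
    have hd' := (Nat.le_div_iff_mul_le (by omega)).1 (hd.trans (min_le_left _ _))
    rw [maxPrimeRange, Finset.mem_filter, Finset.mem_Icc]
    dsimp only
    rw [maxPrimeFac_mul (by omega) hp hc]
    refine ⟨⟨Nat.mul_pos hm1 hp.pos, by rwa [mul_comm]⟩, ha, hb⟩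
  · intro n hn
    rw [maxPrimeRange, Finset.mem_filter, Finset.mem_Icc] at hn
    exact Nat.div_mul_cancel (Nat.dvd_of_mem_primeFactors
      (maxPrimeFac_mem (lt_of_le_of_lt (Nat.zero_le a) hn.2.1)))
  · rintro ⟨m, p⟩ hx
    simp only [Finset.mem_sigma, Finset.mem_filter, Finset.mem_Icc, primesIn, Finset.mem_Ioc] at hx
    obtain ⟨⟨⟨hm1, _⟩, _⟩, ⟨ha, hb⟩, hp, hc, hd⟩ := hx
    have := maxPrimeFac_mul (by omega) hp hc
    simp only [this, Nat.mul_div_cancel _ hp.pos]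
  · intro n hn
    rw [maxPrimeRange, Finset.mem_filter, Finset.mem_Icc] at hn
    dsimp only
    rw [Nat.div_mul_cancel (Nat.dvd_of_mem_primeFactors
      (maxPrimeFac_mem (lt_of_le_of_lt (Nat.zero_le a) hn.2.1)))]

lemma norm_sum_maxPrimeRange_le {q : ℕ} (χ : DirichletCharacter ℂ q) {Z a b : ℕ} {t V : ℝ}
    (ht : 0 ≤ t) (hχ : PrimeSumsLE χ a b t)
    (hV : ∀ S : Finset ℕ, (∀ m ∈ S, m ≠ 0 ∧ ∀ p : ℕ, p.Prime → p ∣ m → p ≤ b) →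
      ∑ m ∈ S, 1 / (m : ℝ) ≤ V) (θ : ℝ) :
    ‖∑ n ∈ maxPrimeRange Z a b, χ (n : ZMod q) * e2pi (n * θ) / n‖ ≤ V * t := by
  rw [sum_maxPrimeRange]
  refine (norm_sum_le _ _).trans ?_
  have hterm : ∀ m ∈ (Finset.Icc 1 Z).filter (fun m => maxPrimeFac m ≤ b),
      ‖∑ p ∈ primesIn a b (maxPrimeFac m) (min (Z / m) b),
        χ ((m * p : ℕ) : ZMod q) * e2pi ((m * p : ℕ) * θ) / (m * p : ℕ)‖ ≤ 1 / (m : ℝ) * t := by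
    intro m hm
    rw [Finset.mem_filter] at hm
    have h1 : ∑ p ∈ primesIn a b (maxPrimeFac m) (min (Z / m) b),
        χ ((m * p : ℕ) : ZMod q) * e2pi ((m * p : ℕ) * θ) / (m * p : ℕ) =
        χ (m : ZMod q) / m * ∑ p ∈ primesIn a b (maxPrimeFac m) (min (Z / m) b),
          χ (p : ZMod q) * e2pi (p * (m * θ)) / p := by
      rw [Finset.mul_sum]
      refine Finset.sum_congr rfl fun p _ => ?_
      rw [show ((m * p : ℕ) : ℝ) * θ = p * (m * θ) by push_cast; ring]
      push_cast
      rw [map_mul]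
      ring
    rw [h1, norm_mul, norm_div, Complex.norm_natCast]
    refine mul_le_mul ?_ (hχ _ ?_ _ ?_ _) (norm_nonneg _) (by positivity)
    · gcongr
      exact DirichletCharacter.norm_le_one χ _
    · exact Finset.mem_range.2 (by omega)
    · exact Finset.mem_range.2 (lt_of_le_of_lt (min_le_right _ _) (Nat.lt_succ_self b))
  refine (Finset.sum_le_sum hterm).trans ?_
  rw [← Finset.sum_mul]
  refine mul_le_mul_of_nonneg_right (hV _ fun m hm => ?_) ht
  rw [Finset.mem_filter, Finset.mem_Icc] at hm
  have hm0 : m ≠ 0 := by omega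
  exact ⟨hm0, (maxPrimeFac_le_iff hm0).1 hm.2⟩

lemma filter_exists_prime_eq {Z : ℕ} {y : ℝ} (hy : 0 ≤ y) :
    ((Finset.Icc 1 Z).filter fun n => ∃ p : ℕ, p.Prime ∧ p ∣ n ∧ y < (p : ℝ)) =
      (Finset.Icc 1 Z).filter fun n => ⌊y⌋₊ < maxPrimeFac n := by
  refine Finset.filter_congr fun n hn => ?_
  have hn0 : n ≠ 0 := by have := (Finset.mem_Icc.1 hn).1; omega
  rw [← not_le, maxPrimeFac_le_iff hn0]
  push Not
  refine exists_congr fun p => ?_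
  rw [Nat.floor_lt hy]

lemma factorial_le_pow_mul_exp {k : ℕ} (hk : 1 ≤ k) :
    (k.factorial : ℝ) ≤ (k : ℝ) ^ (k + 1) * Real.exp (1 - k) := by
  induction k, hk using Nat.le_induction with
  | base => simp
  | succ k hk ih =>
    have hk0 : (0 : ℝ) < k := by exact_mod_cast hk
    have h1 : (k : ℝ) ^ (k + 1) * Real.exp 1 ≤ ((k : ℝ) + 1) ^ (k + 1) := by
      have h2 : 1 / ((k : ℝ) + 1) ≤ Real.log (((k : ℝ) + 1) / k) := by
        refine le_trans (le_of_eq ?_) (Real.one_sub_inv_le_log_of_pos (by positivity))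
        field_simp
        ring
      have h3 : Real.exp 1 ≤ (((k : ℝ) + 1) / k) ^ (k + 1) := by
        rw [← Real.exp_log (show 0 < (((k : ℝ) + 1) / k) ^ (k + 1) by positivity), Real.log_pow]
        refine Real.exp_le_exp.2 ?_
        push_cast
        rw [div_le_iff₀ (by positivity)] at h2
        linarith
      calc (k : ℝ) ^ (k + 1) * Real.exp 1 ≤ (k : ℝ) ^ (k + 1) * (((k : ℝ) + 1) / k) ^ (k + 1) := by
            gcongr
        _ = _ := by rw [← mul_pow]; congr 1; field_simp
    rw [Nat.factorial_succ]
    push_cast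
    calc ((k : ℝ) + 1) * k.factorial ≤ (k + 1) * ((k : ℝ) ^ (k + 1) * Real.exp (1 - k)) := by gcongr
      _ = (k + 1) * ((k : ℝ) ^ (k + 1) * Real.exp 1) * Real.exp (1 - (k + 1)) := by
        rw [show (1 - k : ℝ) = 1 + (1 - (k + 1)) by ring, Real.exp_add]; ring
      _ ≤ (k + 1) * ((k : ℝ) + 1) ^ (k + 1) * Real.exp (1 - (k + 1)) := by gcongr
      _ = _ := by ring

lemma exists_pow_le_mul_exp_div_log (n : ℕ) {c : ℝ} (hc : 0 < c) :
    ∃ C : ℝ, 1 ≤ C ∧ ∀ L : ℝ, 0 < L → 1 ≤ Real.log L → L ^ n ≤ C * Real.exp (c * L / Real.log L) := by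
  have h1 : ∀ᶠ L : ℝ in Filter.atTop, (n : ℝ) * Real.log L ^ 2 ≤ c * L := by
    have h := (isLittleO_pow_log_id_atTop (n := 2)).bound
      (show (0 : ℝ) < c / (n + 1) by positivity)
    filter_upwards [h, Filter.eventually_ge_atTop (0 : ℝ)] with L hL h0
    rw [Real.norm_of_nonneg (by positivity), id, Real.norm_of_nonneg h0, div_mul_eq_mul_div,
      le_div_iff₀ (by positivity)] at hL
    nlinarith [sq_nonneg (Real.log L)]
  obtain ⟨L₀, hL₀⟩ := Filter.eventually_atTop.1 h1
  refine ⟨max L₀ 1 ^ n, one_le_pow₀ (le_max_right _ _), fun L h0 hL => ?_⟩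
  rcases le_total L₀ L with h | h
  · refine le_trans ?_ (le_mul_of_one_le_left (Real.exp_pos _).le
      (one_le_pow₀ (le_max_right _ _)))
    rw [← Real.exp_log (show 0 < L ^ n by positivity), Real.log_pow]
    refine Real.exp_le_exp.2 ?_
    rw [le_div_iff₀ (by linarith)]
    nlinarith [hL₀ L h]
  · have : 1 ≤ Real.exp (c * L / Real.log L) := by
      apply Real.one_le_exp
      positivity
    refine le_trans ?_ (le_mul_of_one_le_right (by positivity) this)
    exact pow_le_pow_left₀ h0.le (h.trans (le_max_left _ _)) n

lemma one_le_log_log {q : ℕ} (hq : 16 ≤ q) : 1 ≤ Real.log (Real.log q) := by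
  have h : (2.7725 : ℝ) ≤ Real.log q := by
    have h1 : Real.log 16 ≤ Real.log q := Real.log_le_log (by norm_num) (by exact_mod_cast hq)
    have h2 : Real.log 16 = 4 * Real.log 2 := by
      rw [show (16 : ℝ) = 2 ^ 4 by norm_num, Real.log_pow]; norm_num
    have := Real.log_two_gt_d9
    linarith
  rw [Real.le_log_iff_exp_le (by linarith)]
  have := Real.exp_one_lt_d9
  linarith

lemma rpow_neg_le_rpow_neg_log_log {q : ℕ} (hq : 16 ≤ q) {a c : ℝ} (hc : 0 < c)
    (hac : 1 / c ≤ a) : (q : ℝ) ^ (-a) ≤ (q : ℝ) ^ (-(1 / (c * Real.log (Real.log q)))) := by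
  have h := one_le_log_log hq
  refine Real.rpow_le_rpow_of_exponent_le (by exact_mod_cast (by omega : 1 ≤ q)) ?_
  have : 1 / (c * Real.log (Real.log q)) ≤ 1 / c := by
    apply one_div_le_one_div_of_le hc
    nlinarith
  linarith

lemma exists_pow_mul_factorial_le : ∃ C : ℝ, 1 ≤ C ∧ ∀ (q b : ℕ) (κ : ℝ), 16 ≤ q → 3 ≤ b →
    (b : ℝ) ≤ (q : ℝ) ^ ((1 : ℝ) / 50) → (b : ℝ) ^ ((2 : ℝ) / 5) ≤ κ →
    ∃ k : ℕ, b ^ k < q ∧ (b : ℝ) ^ 6 * (k.factorial * (1 / κ) ^ k) ≤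
      C * ((b : ℝ) ^ 6 * κ * Real.exp (-κ) +
        (q : ℝ) ^ (-(1 / (100 * Real.log (Real.log q))))) := by
  obtain ⟨C, hC1, hC⟩ := exists_pow_le_mul_exp_div_log 61 (show (0 : ℝ) < 9 / 100 by norm_num)
  refine ⟨Real.exp 3 * C, ?_, fun q b κ hq hb hbq hκ => ?_⟩
  · have := Real.one_le_exp (show (0 : ℝ) ≤ 3 by norm_num)
    nlinarith
  have hll := one_le_log_log hq
  have hq0 : (0 : ℝ) < q := by exact_mod_cast (by omega : 0 < q)
  have hb3 : (3 : ℝ) ≤ b := by exact_mod_cast hb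
  have hb0 : (0 : ℝ) < b := by linarith
  have hb1 : (1 : ℝ) ≤ b := by linarith
  set L := Real.log q with hL
  set l := Real.log b with hl
  have hL0 : 0 < L := Real.log_pos (by exact_mod_cast (by omega : 1 < q))
  have hl1 : 1 ≤ l := by
    rw [hl, Real.le_log_iff_exp_le hb0]
    have := Real.exp_one_lt_d9
    linarith
  have hlL : 50 * l ≤ L := by
    have := Real.log_le_log hb0 hbq
    rw [Real.log_rpow hq0] at this
    linarith
  have hκ1 : 1 ≤ κ := (Real.one_le_rpow hb1 (by norm_num)).trans hκ
  have hE : 1 ≤ Real.exp 3 * C := by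
    have := Real.one_le_exp (show (0 : ℝ) ≤ 3 by norm_num)
    nlinarith
  have hfl : 50 ≤ ⌊L / l⌋₊ := Nat.le_floor (by rw [le_div_iff₀ (by linarith)]; exact_mod_cast hlL)
  obtain ⟨N, hN⟩ : ∃ N, ⌊L / l⌋₊ = N + 1 := ⟨⌊L / l⌋₊ - 1, by omega⟩
  have hN1 : ((N : ℝ) + 1) * l ≤ L := by
    have := Nat.floor_le (show 0 ≤ L / l by positivity)
    rw [hN, le_div_iff₀ (by linarith)] at this
    exact_mod_cast this
  have hN2 : L < (N + 2) * l := by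
    have := Nat.lt_floor_add_one (L / l)
    rw [hN, div_lt_iff₀ (by linarith)] at this
    push_cast at this
    linarith
  have hN49 : 49 ≤ N := by omega
  have hN0 : (0 : ℝ) < N := by exact_mod_cast (by omega : 0 < N)
  have hpow : b ^ N < q := by
    have : (b : ℝ) ^ N < q := by
      rw [← Real.log_lt_log_iff (by positivity) hq0, Real.log_pow]
      nlinarith
    exact_mod_cast this
  by_cases hcase : κ < N + 1
  · refine ⟨⌊κ⌋₊, lt_of_le_of_lt (Nat.pow_le_pow_right (by omega) ?_) hpow, ?_⟩
    · have : ⌊κ⌋₊ < N + 1 := (Nat.floor_lt (by linarith)).2 (by exact_mod_cast hcase)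
      omega
    have hk1 : 1 ≤ ⌊κ⌋₊ := Nat.le_floor (by exact_mod_cast hκ1)
    have hkκ : (⌊κ⌋₊ : ℝ) ≤ κ := Nat.floor_le (by linarith)
    have hkκ' : κ < ⌊κ⌋₊ + 1 := Nat.lt_floor_add_one κ
    set k := ⌊κ⌋₊
    have h1 : (k.factorial : ℝ) * (1 / κ) ^ k ≤ Real.exp 3 * (κ * Real.exp (-κ)) := by
      calc (k.factorial : ℝ) * (1 / κ) ^ k ≤ (k : ℝ) ^ (k + 1) * Real.exp (1 - k) * (1 / κ) ^ k := by
            gcongr; exact factorial_le_pow_mul_exp hk1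
        _ ≤ κ ^ (k + 1) * Real.exp (3 + -κ) * (1 / κ) ^ k := by
            gcongr; linarith
        _ = _ := by
            rw [Real.exp_add, one_div, inv_pow, pow_succ]
            field_simp
    have h2 : (0 : ℝ) < (q : ℝ) ^ (-(1 / (100 * Real.log L))) := by positivity
    calc (b : ℝ) ^ 6 * (k.factorial * (1 / κ) ^ k)
        ≤ (b : ℝ) ^ 6 * (Real.exp 3 * (κ * Real.exp (-κ))) := by gcongr
      _ = Real.exp 3 * 1 * ((b : ℝ) ^ 6 * κ * Real.exp (-κ) + 0) := by ring
      _ ≤ _ := by gcongr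
  push Not at hcase
  refine ⟨N, hpow, ?_⟩
  suffices h : (b : ℝ) ^ 6 * (N.factorial * (1 / κ) ^ N) ≤
      Real.exp 3 * C * (q : ℝ) ^ (-(1 / (100 * Real.log L))) by
    refine h.trans ?_
    gcongr
    have : 0 ≤ (b : ℝ) ^ 6 * κ * Real.exp (-κ) := by positivity
    linarith
  have hNL : (N : ℝ) ≤ L := by nlinarith
  by_cases hbL : l ≤ 10 * Real.log L
  · have hq' : (q : ℝ) ^ (-(1 / (100 * Real.log L))) = Real.exp (-(L / (100 * Real.log L))) := by
      rw [Real.rpow_def_of_pos hq0]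
      congr 1
      ring
    have hb6 : (b : ℝ) ^ 6 ≤ L ^ 60 := by
      rw [← Real.log_le_log_iff (by positivity) (by positivity), Real.log_pow, Real.log_pow]
      push_cast
      linarith
    have hNlow : L / (10 * Real.log L) - 2 ≤ N := by
      rw [sub_le_iff_le_add, div_le_iff₀ (by positivity)]
      nlinarith
    calc (b : ℝ) ^ 6 * (N.factorial * (1 / κ) ^ N)
        ≤ L ^ 60 * ((N : ℝ) ^ (N + 1) * Real.exp (1 - N) * (1 / N) ^ N) := by
          gcongr
          · exact factorial_le_pow_mul_exp (by omega)
          · linarith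
      _ = L ^ 60 * (N * Real.exp (1 - N)) := by
          rw [one_div, inv_pow, pow_succ]
          field_simp
          ring
      _ ≤ L ^ 60 * (L * Real.exp (3 + -(L / (10 * Real.log L)))) := by
          gcongr
          linarith
      _ = L ^ 61 * (Real.exp 3 * Real.exp (-(L / (10 * Real.log L)))) := by
          rw [Real.exp_add]; ring
      _ ≤ (C * Real.exp (9 / 100 * L / Real.log L)) *
            (Real.exp 3 * Real.exp (-(L / (10 * Real.log L)))) := by
          gcongr
          exact hC L hL0 hll
      _ = Real.exp 3 * C * (Real.exp (9 / 100 * L / Real.log L) *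
            Real.exp (-(L / (10 * Real.log L)))) := by ring
      _ = _ := by
          rw [← Real.exp_add, hq']
          congr 2
          field_simp
          ring
  · push Not at hbL
    have hNb : (N : ℝ) ≤ (b : ℝ) ^ ((1 : ℝ) / 10) := by
      refine hNL.trans ?_
      rw [← Real.log_le_log_iff hL0 (by positivity), Real.log_rpow hb0]
      linarith
    have hNκ : (N : ℝ) * (1 / κ) ≤ (b : ℝ) ^ (-(3 : ℝ) / 10) := by
      calc (N : ℝ) * (1 / κ) ≤ (b : ℝ) ^ ((1 : ℝ) / 10) * (1 / (b : ℝ) ^ ((2 : ℝ) / 5)) := by gcongr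
        _ = _ := by
          rw [one_div ((b : ℝ) ^ _), ← Real.rpow_neg hb0.le, ← Real.rpow_add hb0]
          norm_num
    have h1 : (b : ℝ) ^ 6 * (N.factorial * (1 / κ) ^ N) ≤ (q : ℝ) ^ (-(1 : ℝ) / 100) := by
      calc (b : ℝ) ^ 6 * (N.factorial * (1 / κ) ^ N)
          ≤ (b : ℝ) ^ 6 * ((N : ℝ) ^ N * (1 / κ) ^ N) := by
            gcongr
            exact_mod_cast Nat.factorial_le_pow N
        _ ≤ (b : ℝ) ^ 6 * ((b : ℝ) ^ (-(3 : ℝ) / 10)) ^ N := by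
            rw [← mul_pow]; gcongr
        _ ≤ _ := by
            rw [← Real.log_le_log_iff (by positivity) (by positivity),
              Real.log_mul (by positivity) (by positivity), Real.log_pow, Real.log_pow,
              Real.log_rpow hb0, Real.log_rpow hq0]
            push_cast
            linarith
    refine h1.trans (le_trans ?_ (le_mul_of_one_le_left (by positivity) hE))
    rw [neg_div]
    exact rpow_neg_le_rpow_neg_log_log hq (by norm_num) (by norm_num)

lemma exists_card_not_primeSumsLE_le : ∃ C : ℝ, 1 ≤ C ∧ ∀ (q : ℕ) [NeZero q] (a b : ℕ) (κ t : ℝ),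
    16 ≤ q → 3 ≤ b → (b : ℝ) ≤ (q : ℝ) ^ ((1 : ℝ) / 50) → (b : ℝ) ^ ((2 : ℝ) / 5) ≤ κ → 0 < t →
    ∑ p ∈ (Finset.Ioc a b).filter Nat.Prime, 1 / (p : ℝ) ^ 2 ≤ t ^ 2 / κ →
    ((Finset.univ.filter fun χ : DirichletCharacter ℂ q =>
      ¬ PrimeSumsLE χ a b (t + 2 * Real.pi / b)).card : ℝ) ≤
      q.totient * (C * ((b : ℝ) ^ 6 * κ * Real.exp (-κ) +
        (q : ℝ) ^ (-(1 / (100 * Real.log (Real.log q)))))) := by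
  obtain ⟨C, hC1, hC⟩ := exists_pow_mul_factorial_le
  refine ⟨C, hC1, fun q _ a b κ t hq hb hbq hκ ht hσ => ?_⟩
  obtain ⟨k, hk, hle⟩ := hC q b κ hq hb hbq hκ
  refine (card_not_primeSumsLE_le (by omega) hk ht hσ).trans ?_
  refine mul_le_mul_of_nonneg_left ?_ (Nat.cast_nonneg _)
  rwa [show t ^ 2 / κ / t ^ 2 = 1 / κ by field_simp]

lemma eventually_mul_log_pow_le (n : ℕ) (c : ℝ) {s : ℝ} (hs : 0 < s) :
    ∀ᶠ x : ℝ in Filter.atTop, c * Real.log x ^ n ≤ x ^ s := by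
  have h := (isLittleO_log_rpow_rpow_atTop (n : ℝ) hs).bound
    (show (0 : ℝ) < 1 / (|c| + 1) by positivity)
  filter_upwards [h, Filter.eventually_ge_atTop (1 : ℝ)] with x hx h1
  have hl : 0 ≤ Real.log x := Real.log_nonneg h1
  rw [Real.rpow_natCast, Real.norm_of_nonneg (by positivity), Real.norm_of_nonneg (by positivity),
    div_mul_eq_mul_div, le_div_iff₀ (by positivity), one_mul] at hx
  have : c * Real.log x ^ n ≤ |c| * Real.log x ^ n := by gcongr; exact le_abs_self c
  nlinarith [pow_nonneg hl n]

lemma exists_card_square_range_le : ∃ C a₀ : ℝ, 1 ≤ C ∧ 3 ≤ a₀ ∧ ∀ (q : ℕ) [NeZero q] (a : ℕ),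
    16 ≤ q → a₀ ≤ a → (a : ℝ) ^ 2 ≤ (q : ℝ) ^ ((1 : ℝ) / 50) →
    ((Finset.univ.filter fun χ : DirichletCharacter ℂ q =>
      ¬ PrimeSumsLE χ a (a ^ 2) (2 / Real.log a ^ 4)).card : ℝ) ≤
      q.totient * (C * (1 / a * Real.exp (-(a / Real.log a ^ 8)) +
        (q : ℝ) ^ (-(1 / (100 * Real.log (Real.log q)))))) := by
  obtain ⟨C, hC1, hC⟩ := exists_card_not_primeSumsLE_le
  obtain ⟨D, hD0, hD⟩ := exists_sum_prime_inv_sq_le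
  have hev : ∀ᶠ x : ℝ in Filter.atTop, max D 4 ≤ Real.log x ∧
      2 * Real.pi * Real.log x ^ 4 ≤ x ^ (2 : ℝ) ∧ 2 * Real.log x ^ 7 ≤ x ^ ((1 : ℝ) / 5) ∧
      56 * Real.log x ^ 8 ≤ x ^ (1 : ℝ) :=
    (Real.tendsto_log_atTop.eventually_ge_atTop _).and
      ((eventually_mul_log_pow_le 4 _ (by norm_num)).and
        ((eventually_mul_log_pow_le 7 _ (by norm_num)).and
          (eventually_mul_log_pow_le 8 _ (by norm_num))))
  obtain ⟨a₀, ha₀⟩ := Filter.eventually_atTop.1 hev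
  refine ⟨C, max a₀ 3, hC1, le_max_right _ _, fun q _ a hq ha haq => ?_⟩
  obtain ⟨h1, h2, h3, h4⟩ := ha₀ a ((le_max_left _ _).trans ha)
  have ha3 : (3 : ℝ) ≤ a := (le_max_right _ _).trans ha
  have ha0 : (0 : ℝ) < a := by linarith
  set l := Real.log a with hl
  have hl4 : 4 ≤ l := (le_max_right _ _).trans h1
  have hlD : D ≤ l := (le_max_left _ _).trans h1
  have hl0 : 0 < l := by linarith
  rw [Real.rpow_one] at h4
  rw [Real.rpow_two] at h2
  set κ : ℝ := a / (2 * l ^ 7) with hκ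
  have hκ0 : 0 < κ := by positivity
  have hb : (a ^ 2 : ℕ) = ((a : ℝ) ^ 2) := by push_cast; rfl
  have hmain := hC q a (a ^ 2) κ (1 / l ^ 4) hq ?_ (by rwa [hb]) ?_ (by positivity) ?_
  · refine le_trans ?_ (hmain.trans ?_)
    · refine Nat.cast_le.2 (Finset.card_le_card fun χ hχ => ?_)
      rw [Finset.mem_filter] at hχ ⊢
      refine ⟨hχ.1, fun h => hχ.2 fun c hc d hd θ => (h c hc d hd θ).trans ?_⟩
      rw [hb]
      have : 2 * Real.pi / (a : ℝ) ^ 2 ≤ 1 / l ^ 4 := by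
        rw [div_le_div_iff₀ (by positivity) (by positivity)]
        linarith
      calc 1 / l ^ 4 + 2 * Real.pi / (a : ℝ) ^ 2 ≤ 1 / l ^ 4 + 1 / l ^ 4 := by gcongr
        _ = 2 / l ^ 4 := by ring
    · refine mul_le_mul_of_nonneg_left ?_ (Nat.cast_nonneg _)
      refine mul_le_mul_of_nonneg_left (add_le_add_left ?_ _) (by linarith)
      rw [hb]
      have hκa : κ ≤ a := by
        rw [hκ, div_le_iff₀ (by positivity)]
        have : 1 ≤ 2 * l ^ 7 := by nlinarith [one_le_pow₀ (show 1 ≤ l by linarith) (n := 7)]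
        nlinarith
      have hexp : 14 * l + a / l ^ 8 ≤ κ := by
        have e1 : a / l ^ 8 ≤ κ / 2 := by
          rw [hκ, div_div, div_le_div_iff₀ (by positivity) (by positivity)]
          have : l ^ 7 * 4 ≤ l ^ 8 := by
            rw [pow_succ l 7]; gcongr
          nlinarith
        have e2 : 14 * l ≤ κ / 2 := by
          rw [hκ, div_div, le_div_iff₀ (by positivity)]
          calc 14 * l * (2 * l ^ 7 * 2) = 56 * l ^ 8 := by ring
            _ ≤ (a : ℝ) := h4
        linarith
      have ha14 : (a : ℝ) ^ 14 * Real.exp (-(14 * l)) = 1 := by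
        rw [show -(14 * l) = -(((14 : ℕ) : ℝ) * l) by norm_num, Real.exp_neg, ← Real.log_pow,
          Real.exp_log (by positivity)]
        field_simp
      calc ((a : ℝ) ^ 2) ^ 6 * κ * Real.exp (-κ)
          ≤ ((a : ℝ) ^ 2) ^ 6 * a * Real.exp (-(14 * l) + -(a / l ^ 8)) := by
            gcongr
            linarith
        _ = 1 / a * ((a : ℝ) ^ 14 * Real.exp (-(14 * l))) * Real.exp (-(a / l ^ 8)) := by
            rw [Real.exp_add]
            field_simp
        _ = _ := by rw [ha14, mul_one]
  · have : 3 ≤ a := by exact_mod_cast ha3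
    nlinarith
  · rw [hb, ← Real.rpow_two, ← Real.rpow_mul ha0.le, hκ, le_div_iff₀ (by positivity)]
    calc (a : ℝ) ^ ((2 : ℝ) * (2 / 5)) * (2 * l ^ 7)
        ≤ (a : ℝ) ^ ((2 : ℝ) * (2 / 5)) * (a : ℝ) ^ ((1 : ℝ) / 5) := by gcongr
      _ = a := by rw [← Real.rpow_add ha0]; norm_num
  · refine (hD a _ (by linarith) ha0 fun p hp => ?_).trans ?_
    · rw [Finset.mem_filter, Finset.mem_Ioc] at hp
      exact ⟨hp.2, by exact_mod_cast hp.1.1⟩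
    · rw [← hl, hκ]
      have : D / l ≤ 1 := by rw [div_le_one hl0]; exact hlD
      calc (1 + D / l) / (a * l) ≤ (1 + 1) / (a * l) := by gcongr
        _ = _ := by field_simp; ring

lemma exists_norm_sum_square_range_le : ∃ a₀ : ℝ, 3 ≤ a₀ ∧ ∀ (q : ℕ)
    (χ : DirichletCharacter ℂ q) (Z a : ℕ), a₀ ≤ a →
    PrimeSumsLE χ a (a ^ 2) (2 / Real.log a ^ 4) → ∀ θ : ℝ,
    ‖∑ n ∈ maxPrimeRange Z a (a ^ 2), χ (n : ZMod q) * e2pi (n * θ) / n‖ ≤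
      Real.exp eulerMascheroniConstant * (8 / Real.log a ^ 3) := by
  obtain ⟨K, hK0, hK⟩ := exists_sum_smooth_inv_le
  obtain ⟨a₀, ha₀⟩ := Filter.eventually_atTop.1
    (Real.tendsto_log_atTop.eventually_ge_atTop (max K 1))
  refine ⟨max a₀ 3, le_max_right _ _, fun q χ Z a ha hχ θ => ?_⟩
  have h1 := ha₀ a ((le_max_left _ _).trans ha)
  have ha3 : (3 : ℝ) ≤ a := (le_max_right _ _).trans ha
  have ha3' : 3 ≤ a := by exact_mod_cast ha3
  have hlK : K ≤ Real.log a := (le_max_left _ _).trans h1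
  have hl1 : 1 ≤ Real.log a := (le_max_right _ _).trans h1
  refine (norm_sum_maxPrimeRange_le χ (by positivity) hχ (hK (a ^ 2) (by nlinarith)) θ).trans ?_
  have hlog : Real.log ((a ^ 2 : ℕ) : ℝ) = 2 * Real.log a := by
    push_cast; rw [Real.log_pow]; norm_num
  rw [hlog]
  set l := Real.log a
  have he : Real.exp (K / (2 * l)) ≤ 2 := by
    have : K / (2 * l) ≤ 1 / 2 := by
      rw [div_le_div_iff₀ (by positivity) (by norm_num)]; linarith
    refine (Real.exp_le_exp.2 this).trans ?_
    have h2 := Real.exp_one_lt_d9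
    have h3 : Real.exp (1 / 2) ^ 2 = Real.exp 1 := by rw [← Real.exp_nat_mul]; norm_num
    nlinarith [Real.exp_pos (1 / 2)]
  calc Real.exp eulerMascheroniConstant * (2 * l) * Real.exp (K / (2 * l)) * (2 / l ^ 4)
      ≤ Real.exp eulerMascheroniConstant * (2 * l) * 2 * (2 / l ^ 4) := by gcongr
    _ = _ := by field_simp; norm_num

lemma sum_maxPrimeRange_add {Z a b c : ℕ} (hab : a ≤ b) (hbc : b ≤ c) (F : ℕ → ℂ) :
    ∑ n ∈ maxPrimeRange Z a c, F n =
      ∑ n ∈ maxPrimeRange Z a b, F n + ∑ n ∈ maxPrimeRange Z b c, F n := by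
  rw [← Finset.sum_union]
  · refine Finset.sum_congr ?_ fun _ _ => rfl
    ext n
    simp only [maxPrimeRange, Finset.mem_filter, Finset.mem_union]
    constructor
    · rintro ⟨h, h1, h2⟩
      rcases le_or_gt (maxPrimeFac n) b with h3 | h3
      · exact Or.inl ⟨h, h1, h3⟩
      · exact Or.inr ⟨h, h3, h2⟩
    · rintro (⟨h, h1, h2⟩ | ⟨h, h1, h2⟩)
      · exact ⟨h, h1, by omega⟩
      · exact ⟨h, by omega, h2⟩
  · rw [Finset.disjoint_left]
    intro n h1 h2
    simp only [maxPrimeRange, Finset.mem_filter] at h1 h2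
    omega

lemma sum_maxPrimeRange_pow_two_pow (Z : ℕ) {A : ℕ} (hA : 1 ≤ A) (J : ℕ) (F : ℕ → ℂ) :
    ∑ n ∈ maxPrimeRange Z A (A ^ 2 ^ J), F n =
      ∑ j ∈ Finset.range J, ∑ n ∈ maxPrimeRange Z (A ^ 2 ^ j) ((A ^ 2 ^ j) ^ 2), F n := by
  induction J with
  | zero =>
    rw [Finset.sum_range_zero]
    refine Finset.sum_eq_zero fun n hn => ?_
    simp only [maxPrimeRange, Finset.mem_filter, pow_zero, pow_one] at hn
    omega
  | succ J ih =>
    rw [Finset.sum_range_succ, ← ih, ← pow_mul, ← pow_succ]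
    exact sum_maxPrimeRange_add (Nat.le_self_pow (by positivity) A)
      (Nat.pow_le_pow_right hA (Nat.pow_le_pow_right (by norm_num) (Nat.le_succ J))) F

lemma div_log_pow_le_pow_two_pow {A : ℕ} (hA : 256 ≤ A) (j : ℕ) :
    (A : ℝ) / Real.log A ^ 8 ≤ (A ^ 2 ^ j : ℕ) / Real.log (A ^ 2 ^ j : ℕ) ^ 8 := by
  have hA' : (256 : ℝ) ≤ A := by exact_mod_cast hA
  have hl : 0 < Real.log A := Real.log_pos (by linarith)
  push_cast
  rw [Real.log_pow, mul_pow]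
  push_cast
  rw [div_le_div_iff₀ (by positivity) (by positivity)]
  have h1 : (A : ℝ) * (2 ^ j) ^ 8 ≤ (A : ℝ) ^ 2 ^ j := by
    obtain ⟨m, hm⟩ : ∃ m, 2 ^ j = j + m + 1 :=
      ⟨2 ^ j - j - 1, by have := Nat.lt_two_pow_self (n := j); omega⟩
    calc (A : ℝ) * (2 ^ j) ^ 8 = A * 256 ^ j := by
          rw [← pow_mul, mul_comm j, pow_mul]; norm_num
      _ ≤ A * (A : ℝ) ^ j := by gcongr
      _ ≤ A * (A : ℝ) ^ (j + m) := by
          gcongr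
          · linarith
          · omega
      _ = _ := by rw [hm, pow_succ]; ring
  calc (A : ℝ) * ((2 ^ j) ^ 8 * Real.log A ^ 8) = (A : ℝ) * (2 ^ j) ^ 8 * Real.log A ^ 8 := by ring
    _ ≤ _ := by gcongr

lemma exists_card_chain_le : ∃ C A₀ : ℝ, 1 ≤ C ∧ 3 ≤ A₀ ∧ ∀ (q : ℕ) [NeZero q] (Z A J : ℕ),
    16 ≤ q → A₀ ≤ A → (∀ j < J, (A : ℝ) ^ 2 ^ (j + 1) ≤ (q : ℝ) ^ ((1 : ℝ) / 50)) →
    ((Finset.univ.filter fun χ : DirichletCharacter ℂ q => ¬ ∀ θ : ℝ,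
      ‖∑ n ∈ maxPrimeRange Z A (A ^ 2 ^ J), χ (n : ZMod q) * e2pi (n * θ) / n‖ ≤
        Real.exp eulerMascheroniConstant * (16 / Real.log A ^ 3)).card : ℝ) ≤
      q.totient * (C * (2 * Real.exp (-(A / Real.log A ^ 8)) +
        J * (q : ℝ) ^ (-(1 / (100 * Real.log (Real.log q)))))) := by
  obtain ⟨C, a₁, hC1, ha₁, hC⟩ := exists_card_square_range_le
  obtain ⟨a₂, ha₂, hN⟩ := exists_norm_sum_square_range_le
  refine ⟨C, max (max a₁ a₂) 256, hC1, le_trans (by norm_num) (le_max_right _ _),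
    fun q _ Z A J hq hA hAq => ?_⟩
  have hA256 : (256 : ℝ) ≤ A := (le_max_right _ _).trans hA
  have hA1 : a₁ ≤ A := (le_max_left _ _).trans ((le_max_left _ _).trans hA)
  have hA2 : a₂ ≤ A := (le_max_right _ _).trans ((le_max_left _ _).trans hA)
  have hA256' : 256 ≤ A := by exact_mod_cast hA256
  have hl : 0 < Real.log A := Real.log_pos (by linarith)
  have hmono : ∀ j, (A : ℝ) ≤ (A ^ 2 ^ j : ℕ) := fun j => by
    exact_mod_cast Nat.le_self_pow (by positivity) A
  set E := (q : ℝ) ^ (-(1 / (100 * Real.log (Real.log q))))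
  set Bad : ℕ → Finset (DirichletCharacter ℂ q) := fun j =>
    Finset.univ.filter fun χ : DirichletCharacter ℂ q =>
      ¬ PrimeSumsLE χ (A ^ 2 ^ j) ((A ^ 2 ^ j) ^ 2) (2 / Real.log (A ^ 2 ^ j : ℕ) ^ 4) with hBad
  have hsub : (Finset.univ.filter fun χ : DirichletCharacter ℂ q => ¬ ∀ θ : ℝ,
      ‖∑ n ∈ maxPrimeRange Z A (A ^ 2 ^ J), χ (n : ZMod q) * e2pi (n * θ) / n‖ ≤
        Real.exp eulerMascheroniConstant * (16 / Real.log A ^ 3)) ⊆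
      (Finset.range J).biUnion Bad := by
    intro χ hχ
    rw [Finset.mem_filter] at hχ
    by_contra hcon
    refine hχ.2 fun θ => ?_
    have hgood : ∀ j ∈ Finset.range J,
        PrimeSumsLE χ (A ^ 2 ^ j) ((A ^ 2 ^ j) ^ 2) (2 / Real.log (A ^ 2 ^ j : ℕ) ^ 4) := by
      intro j hj
      by_contra h
      exact hcon (Finset.mem_biUnion.2 ⟨j, hj, Finset.mem_filter.2 ⟨Finset.mem_univ _, h⟩⟩)
    rw [sum_maxPrimeRange_pow_two_pow Z (by omega)]
    refine (norm_sum_le _ _).trans ?_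
    calc ∑ j ∈ Finset.range J, ‖∑ n ∈ maxPrimeRange Z (A ^ 2 ^ j) ((A ^ 2 ^ j) ^ 2),
          χ (n : ZMod q) * e2pi (n * θ) / n‖
        ≤ ∑ j ∈ Finset.range J,
          Real.exp eulerMascheroniConstant * (8 / Real.log A ^ 3) * (1 / 2) ^ j := by
          refine Finset.sum_le_sum fun j hj => ?_
          refine (hN q χ Z _ (hA2.trans (hmono j)) (hgood j hj) θ).trans ?_
          rw [mul_assoc]
          gcongr
          push_cast
          rw [Real.log_pow]
          push_cast
          rw [one_div, inv_pow, ← div_eq_mul_inv, div_div]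
          gcongr
          rw [mul_pow, mul_comm]
          gcongr
          exact le_self_pow₀ (one_le_pow₀ (by norm_num)) (by norm_num)
      _ = Real.exp eulerMascheroniConstant * (8 / Real.log A ^ 3) *
            ∑ j ∈ Finset.range J, (1 / 2 : ℝ) ^ j := by rw [Finset.mul_sum]
      _ ≤ Real.exp eulerMascheroniConstant * (8 / Real.log A ^ 3) * 2 := by
          gcongr
          exact sum_geometric_two_le J
      _ = _ := by ring
  calc ((Finset.univ.filter fun χ : DirichletCharacter ℂ q => ¬ ∀ θ : ℝ,
      ‖∑ n ∈ maxPrimeRange Z A (A ^ 2 ^ J), χ (n : ZMod q) * e2pi (n * θ) / n‖ ≤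
        Real.exp eulerMascheroniConstant * (16 / Real.log A ^ 3)).card : ℝ)
      ≤ ((Finset.range J).biUnion Bad).card := by exact_mod_cast Finset.card_le_card hsub
    _ ≤ ∑ j ∈ Finset.range J, ((Bad j).card : ℝ) := by exact_mod_cast Finset.card_biUnion_le
    _ ≤ ∑ j ∈ Finset.range J, (q.totient * C *
          ((1 / 2) ^ j * Real.exp (-(A / Real.log A ^ 8)) + E)) := by
        refine Finset.sum_le_sum fun j hj => ?_
        have h1 := hC q (A ^ 2 ^ j) hq (hA1.trans (hmono j)) (by
          have := hAq j (Finset.mem_range.1 hj)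
          rw [pow_succ, pow_mul] at this
          push_cast
          exact this)
        refine h1.trans ?_
        rw [mul_assoc]
        refine mul_le_mul_of_nonneg_left (mul_le_mul_of_nonneg_left (add_le_add_left ?_ _)
          (by linarith)) (Nat.cast_nonneg _)
        refine mul_le_mul ?_ (Real.exp_le_exp.2 (neg_le_neg (div_log_pow_le_pow_two_pow hA256' j)))
          (Real.exp_pos _).le (by positivity)
        rw [one_div_pow]
        refine one_div_le_one_div_of_le (by positivity) ?_
        have : 2 ^ j ≤ A ^ 2 ^ j := calc
          2 ^ j ≤ 2 ^ 2 ^ j := Nat.pow_le_pow_right (by norm_num) (Nat.lt_two_pow_self).le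
          _ ≤ A ^ 2 ^ j := Nat.pow_le_pow_left (by omega) _
        exact_mod_cast this
    _ = q.totient * (C * ((∑ j ∈ Finset.range J, (1 / 2 : ℝ) ^ j) *
          Real.exp (-(A / Real.log A ^ 8)) + J * E)) := by
        rw [← Finset.mul_sum, Finset.sum_add_distrib, ← Finset.sum_mul, Finset.sum_const,
          Finset.card_range, nsmul_eq_mul, mul_assoc]
    _ ≤ _ := by
        refine mul_le_mul_of_nonneg_left (mul_le_mul_of_nonneg_left (add_le_add_left ?_ _)
          (by linarith)) (Nat.cast_nonneg _)
        gcongr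
        exact sum_geometric_two_le J

lemma ceil_mul_log_pow_bounds {y : ℝ} (hl : 2 ≤ Real.log y) (hy : Real.log y ^ 12 ≤ y) :
    y * Real.log y ^ 11 ≤ (⌈y * Real.log y ^ 11⌉₊ : ℝ) ∧
    (⌈y * Real.log y ^ 11⌉₊ : ℝ) ≤ y ^ 2 ∧ y ≤ (⌈y * Real.log y ^ 11⌉₊ : ℝ) ∧
    Real.log (⌈y * Real.log y ^ 11⌉₊ : ℝ) ≤ Real.log y + 12 * Real.log (Real.log y) := by
  set l := Real.log y with hldef
  have hl0 : 0 < l := by linarith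
  have hy1 : 1 ≤ y := (one_le_pow₀ (by linarith)).trans hy
  have h11 : 1 ≤ l ^ 11 := one_le_pow₀ (by linarith)
  have h1 : y * l ^ 11 ≤ (⌈y * l ^ 11⌉₊ : ℝ) := Nat.le_ceil _
  have h2 : (⌈y * l ^ 11⌉₊ : ℝ) ≤ y * l ^ 12 := by
    have h3 : (⌈y * l ^ 11⌉₊ : ℝ) < y * l ^ 11 + 1 := Nat.ceil_lt_add_one (by positivity)
    have h4 : y * l ^ 12 = y * l ^ 11 * l := by ring
    have h5 : 1 ≤ y * l ^ 11 := by nlinarith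
    nlinarith
  refine ⟨h1, ?_, ?_, ?_⟩
  · nlinarith
  · nlinarith
  · have h0 : 0 < (⌈y * l ^ 11⌉₊ : ℝ) := lt_of_lt_of_le (by positivity) h1
    refine (Real.log_le_log h0 h2).trans (le_of_eq ?_)
    rw [Real.log_mul (by positivity) (by positivity), Real.log_pow]
    norm_num
    exact hldef.symm

lemma exists_card_initial_range_le : ∃ C y₀ : ℝ, 1 ≤ C ∧ 3 ≤ y₀ ∧ ∀ (q : ℕ) [NeZero q] (Z : ℕ)
    (y δ : ℝ), 16 ≤ q → y₀ ≤ y → y < (q : ℝ) ^ ((1 : ℝ) / 100) → 1 / Real.log y ≤ δ → δ ≤ 1 →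
    ((Finset.univ.filter fun χ : DirichletCharacter ℂ q => ¬ ∀ θ : ℝ,
      ‖∑ n ∈ maxPrimeRange Z ⌊y⌋₊ ⌈y * Real.log y ^ 11⌉₊,
        χ (n : ZMod q) * e2pi (n * θ) / n‖ ≤
        Real.exp eulerMascheroniConstant *
          (δ * (1 - Real.log (Real.log y) / Real.log y))).card : ℝ) ≤
      q.totient * (C * (Real.exp (-(δ ^ 2 * y / Real.log y) *
          (1 - 34 * Real.log (Real.log y) / Real.log y)) +
        (q : ℝ) ^ (-(1 / (100 * Real.log (Real.log q)))))) := by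
  obtain ⟨C, hC1, hC⟩ := exists_card_not_primeSumsLE_le
  obtain ⟨D, hD0, hD⟩ := exists_sum_prime_inv_sq_le
  obtain ⟨K, hK0, hK⟩ := exists_sum_smooth_inv_le
  have hev : ∀ᶠ x : ℝ in Filter.atTop, max (max D (2 * K)) 2 ≤ Real.log (Real.log x) ∧
      68 * Real.log (Real.log x) ≤ Real.log x ∧ 1 * Real.log x ^ 12 ≤ x ^ (1 : ℝ) ∧
      2 * Real.pi * Real.log x ^ 3 ≤ x ^ (1 : ℝ) ∧ 2 * Real.log x ^ 3 ≤ x ^ ((1 : ℝ) / 5) ∧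
      15 * Real.log x ^ 5 ≤ x ^ (1 : ℝ) := by
    refine ((Real.tendsto_log_atTop.comp Real.tendsto_log_atTop).eventually_ge_atTop _).and
      (Filter.Eventually.and ?_
      ((eventually_mul_log_pow_le 12 _ (by norm_num)).and
        ((eventually_mul_log_pow_le 3 _ (by norm_num)).and
          ((eventually_mul_log_pow_le 3 _ (by norm_num)).and
          (eventually_mul_log_pow_le 5 _ (by norm_num))))))
    have := Real.tendsto_log_atTop.eventually
      (eventually_mul_log_pow_le 1 68 (show (0 : ℝ) < 1 by norm_num))
    simpa using this
  obtain ⟨y₀, hy₀⟩ := Filter.eventually_atTop.1 hev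
  refine ⟨C, max y₀ 3, hC1, le_max_right _ _, fun q _ Z y δ hq hy hyq hδ1 hδ2 => ?_⟩
  obtain ⟨h1, h2, h3, h4, h5, h6⟩ := hy₀ y ((le_max_left _ _).trans hy)
  have hy3 : (3 : ℝ) ≤ y := (le_max_right _ _).trans hy
  have hy0 : (0 : ℝ) < y := by linarith
  set l := Real.log y with hl
  set m := Real.log l with hm
  have hmD : D ≤ m := (le_max_left _ _).trans ((le_max_left _ _).trans h1)
  have hmK : 2 * K ≤ m := (le_max_right _ _).trans ((le_max_left _ _).trans h1)
  have hm2 : 2 ≤ m := (le_max_right _ _).trans h1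
  have hl136 : 136 ≤ l := by linarith
  have hl0 : 0 < l := by linarith
  rw [Real.rpow_one] at h3 h4 h6
  rw [one_mul] at h3
  obtain ⟨hA1, hA2, hA3, hA4⟩ := ceil_mul_log_pow_bounds (y := y) (by rw [← hl]; linarith) h3
  rw [← hl] at hA1 hA2 hA3 hA4
  rw [← hm] at hA4
  set A := ⌈y * l ^ 11⌉₊
  have hA0 : (0 : ℝ) < A := by linarith
  have hAn : 3 ≤ A := by exact_mod_cast hy3.trans hA3
  set u := m / l with hu
  have hu0 : 0 < u := by positivity
  have hu68 : 68 * u ≤ 1 := by rw [hu, ← mul_div_assoc, div_le_one hl0]; exact h2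
  have hul : u * l = m := by rw [hu]; field_simp
  have hδ0 : 0 < δ := lt_of_lt_of_le (by positivity) hδ1
  have hδl : 1 ≤ δ * l := by rwa [div_le_iff₀ hl0] at hδ1
  have h34 : 34 * m / l = 34 * u := by rw [hu]; ring
  rw [h34]
  set X := δ ^ 2 * y / l with hX
  have hX0 : 0 < X := by positivity
  have hXl : y ≤ X * l ^ 3 := by
    have : X * l ^ 3 = y * (δ * l) ^ 2 := by rw [hX]; field_simp
    rw [this]
    exact le_mul_of_one_le_right hy0.le (one_le_pow₀ hδl)
  have hXy : X ≤ y := by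
    rw [hX, div_le_iff₀ hl0]
    have : δ ^ 2 ≤ 1 := pow_le_one₀ hδ0.le hδ2
    linarith [mul_le_mul_of_nonneg_right this hy0.le,
      le_mul_of_one_le_right hy0.le (show 1 ≤ l by linarith)]
  set κ := X * (1 - 33 * u) with hκ
  have hκX : X / 2 ≤ κ := by rw [hκ]; linarith [mul_le_mul_of_nonneg_left hu68 hX0.le]
  have hκy : κ ≤ y := by rw [hκ]; linarith [mul_pos hX0 hu0]
  have hκ0 : 0 < κ := by linarith
  set t := δ / l * (1 - 16 * u) with ht
  have ht0 : 0 < t := by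
    have : 0 < 1 - 16 * u := by linarith
    positivity
  have hmain := hC q ⌊y⌋₊ A κ t hq hAn ?_ ?_ ht0 ?_
  · refine le_trans ?_ (hmain.trans ?_)
    · refine Nat.cast_le.2 (Finset.card_le_card fun χ hχ => ?_)
      rw [Finset.mem_filter] at hχ ⊢
      refine ⟨hχ.1, fun h => hχ.2 fun θ => ?_⟩
      refine (norm_sum_maxPrimeRange_le χ (by positivity) h (hK A (by omega)) θ).trans ?_
      rw [mul_assoc, mul_assoc]
      refine mul_le_mul_of_nonneg_left ?_ (Real.exp_pos _).le
      have hlA : l ≤ Real.log A := Real.log_le_log hy0 hA3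
      have hexp : Real.exp (K / Real.log A) ≤ 1 + u := by
        have e1 : K / Real.log A ≤ u / 2 := by
          rw [hu, div_div, div_le_div_iff₀ (by linarith) (by positivity)]
          linarith [mul_le_mul hmK hlA hl0.le (show 0 ≤ m by linarith)]
        have e2 : |u / 2| ≤ 1 := by rw [abs_of_pos (by positivity)]; linarith
        have e3 := Real.abs_exp_sub_one_sub_id_le e2
        have e4 := (abs_le.1 e3).2
        have e5 := Real.exp_le_exp.2 e1
        linarith [mul_le_mul_of_nonneg_left (abs_le.1 e2).2 (show 0 ≤ u / 2 by positivity)]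
      have htπ : t + 2 * Real.pi / A ≤ δ / l * (1 - 15 * u) := by
        have e1 : 2 * Real.pi / A ≤ u * (δ / l) := by
          calc 2 * Real.pi / A ≤ 2 * Real.pi / y := by gcongr
            _ ≤ 1 / l ^ 3 := by
              rw [div_le_div_iff₀ (by positivity) (by positivity)]; linarith
            _ ≤ u * (δ / l) := by
              rw [div_le_iff₀ (by positivity)]
              have : u * (δ / l) * l ^ 3 = (u * l) * (δ * l) := by field_simp
              rw [this, hul]
              exact one_le_mul_of_one_le_of_one_le (by linarith) hδl
        rw [ht]
        linarith
      calc Real.log A * (Real.exp (K / Real.log A) * (t + 2 * Real.pi / A))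
          ≤ (l + 12 * m) * ((1 + u) * (δ / l * (1 - 15 * u))) := by
            gcongr
        _ = δ * ((1 + 12 * u) * (1 + u) * (1 - 15 * u)) := by
            rw [← hul]; field_simp
        _ ≤ δ * (1 - u) := by
            gcongr
            linarith [mul_pos hu0 hu0, mul_pos hu0 (mul_pos hu0 hu0)]
    · refine mul_le_mul_of_nonneg_left (mul_le_mul_of_nonneg_left (add_le_add_left ?_ _)
        (by linarith)) (Nat.cast_nonneg _)
      have e1 : 15 * l ≤ X * u := by
        have : 15 * l ^ 5 ≤ X * l ^ 3 * 1 := by linarith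
        have e2 : X * l ^ 3 ≤ (X * u) * l ^ 4 := by
          rw [show (X * u) * l ^ 4 = X * l ^ 3 * (u * l) by ring, hul]
          exact le_mul_of_one_le_right (by positivity) (by linarith)
        have e3 : 15 * l * l ^ 4 ≤ X * u * l ^ 4 := by linarith
        exact le_of_mul_le_mul_right e3 (by positivity)
      have hy13 : y ^ 13 = Real.exp (13 * l) := by
        rw [show 13 * l = ((13 : ℕ) : ℝ) * l by norm_num, ← Real.log_pow,
          Real.exp_log (by positivity)]
      calc (A : ℝ) ^ 6 * κ * Real.exp (-κ) ≤ (y ^ 2) ^ 6 * y * Real.exp (-κ) := by gcongr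
        _ = Real.exp (13 * l + -κ) := by rw [Real.exp_add, ← hy13]; ring
        _ ≤ _ := by
          refine Real.exp_le_exp.2 ?_
          rw [hκ]
          linarith
  · refine hA2.trans ?_
    have hq0 : (0 : ℝ) ≤ q := Nat.cast_nonneg _
    calc y ^ 2 ≤ ((q : ℝ) ^ ((1 : ℝ) / 100)) ^ 2 := by gcongr
      _ = _ := by rw [← Real.rpow_natCast, ← Real.rpow_mul hq0]; norm_num
  · calc (A : ℝ) ^ ((2 : ℝ) / 5) ≤ (y ^ 2) ^ ((2 : ℝ) / 5) := by gcongr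
      _ = y ^ ((4 : ℝ) / 5) := by rw [← Real.rpow_two, ← Real.rpow_mul hy0.le]; norm_num
      _ ≤ X / 2 := by
        have e1 : y = y ^ ((4 : ℝ) / 5) * y ^ ((1 : ℝ) / 5) := by
          rw [← Real.rpow_add hy0]; norm_num
        have e2 : y ^ ((4 : ℝ) / 5) * (2 * l ^ 3) ≤ X * l ^ 3 := by
          refine le_trans ?_ hXl
          conv_rhs => rw [e1]
          gcongr
        have e3 : y ^ ((4 : ℝ) / 5) * 2 ≤ X :=
          le_of_mul_le_mul_right (by linarith) (pow_pos hl0 3)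
        linarith
      _ ≤ κ := hκX
  · refine (hD y _ (by rw [← hl]; linarith) hy0 fun p hp => ?_).trans ?_
    · rw [Finset.mem_filter, Finset.mem_Ioc] at hp
      exact ⟨hp.2, (Nat.floor_lt hy0.le).1 hp.1.1⟩
    · rw [← hl, div_le_div_iff₀ (by positivity) hκ0]
      have e1 : D / l ≤ u := by rw [hu]; gcongr
      have e2 : t ^ 2 * (y * l) = X * (1 - 16 * u) ^ 2 := by rw [ht, hX]; field_simp
      rw [e2, hκ]
      have e3 : (1 + D / l) * (1 - 33 * u) ≤ (1 - 16 * u) ^ 2 := by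
        calc (1 + D / l) * (1 - 33 * u) ≤ (1 + u) * (1 - 33 * u) := by
              gcongr
              linarith
          _ ≤ _ := by linarith [sq_nonneg u]
      calc (1 + D / l) * (X * (1 - 33 * u)) = X * ((1 + D / l) * (1 - 33 * u)) := by ring
        _ ≤ _ := by gcongr

lemma Syz_le {q : ℕ} (χ : DirichletCharacter ℂ q) {y z B : ℝ} (hy : 0 ≤ y)
    (h : ∀ θ : ℝ, ‖∑ n ∈ (Finset.Icc 1 ⌊z⌋₊).filter (fun n => ⌊y⌋₊ < maxPrimeFac n),
      χ (n : ZMod q) * e2pi (n * θ) / n‖ ≤ B) : Syz χ y z ≤ B := by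
  rw [Syz, SA, filter_exists_prime_eq hy]
  have : Nonempty (Set.Icc (0 : ℝ) 1) := ⟨⟨0, by simp⟩⟩
  exact ciSup_le fun α => h α

lemma sum_lt_maxPrimeFac_eq {Z a b : ℕ} (hab : a ≤ b) (F : ℕ → ℂ) :
    ∑ n ∈ (Finset.Icc 1 Z).filter (fun n => a < maxPrimeFac n), F n =
      ∑ n ∈ maxPrimeRange Z a b, F n +
        ∑ n ∈ (Finset.Icc 1 Z).filter (fun n => b < maxPrimeFac n), F n := by
  rw [← Finset.sum_union]
  · refine Finset.sum_congr ?_ fun _ _ => rfl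
    ext n
    simp only [maxPrimeRange, Finset.mem_filter, Finset.mem_union]
    constructor
    · rintro ⟨h, h1⟩
      rcases le_or_gt (maxPrimeFac n) b with h3 | h3
      · exact Or.inl ⟨h, h1, h3⟩
      · exact Or.inr ⟨h, h3⟩
    · rintro (⟨h, h1, h2⟩ | ⟨h, h1⟩)
      · exact ⟨h, h1⟩
      · exact ⟨h, by omega⟩
  · rw [Finset.disjoint_left]
    intro n h1 h2
    simp only [maxPrimeRange, Finset.mem_filter] at h1 h2
    omega

lemma maxPrimeFac_le_self {n : ℕ} (hn : n ≠ 0) : maxPrimeFac n ≤ n :=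
  (maxPrimeFac_le_iff hn).2 fun _ _ hd => Nat.le_of_dvd (Nat.pos_of_ne_zero hn) hd

lemma exists_card_rough_le : ∃ C : ℝ, 1 ≤ C ∧ ∀ (q : ℕ) [NeZero q] (a : ℕ),
    (q : ℝ) ^ ((1 : ℝ) / 100) ≤ a + 1 →
    ((Finset.univ.filter fun χ : DirichletCharacter ℂ q => ¬ ∀ θ : ℝ,
      ‖∑ n ∈ (Finset.Icc 1 ⌊(q : ℝ) ^ ((11 : ℝ) / 21)⌋₊).filter (fun n => a < maxPrimeFac n),
        χ (n : ZMod q) * e2pi (n * θ) / n‖ ≤ 8 * (q : ℝ) ^ (-(1 : ℝ) / 800)).card : ℝ) ≤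
      q.totient * (C * (q : ℝ) ^ (-(1 : ℝ) / 8)) := by
  obtain ⟨C, hC1, hC⟩ := exists_card_large_le
  refine ⟨C, hC1, fun q _ a ha => ?_⟩
  have hq1 : (1 : ℝ) ≤ q := by exact_mod_cast Nat.one_le_iff_ne_zero.2 (NeZero.ne q)
  refine hC q _ _ (Nat.le_floor ?_) (Nat.floor_le (by positivity)) fun n hn => ?_
  · rw [Nat.cast_one]
    exact Real.one_le_rpow hq1 (by norm_num)
  · rw [Finset.mem_filter] at hn
    refine ⟨ha.trans ?_, hn.1⟩
    have h0 : n ≠ 0 := by have := (Finset.mem_Icc.1 hn.1).1; omega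
    exact_mod_cast hn.2.trans_le (maxPrimeFac_le_self h0)

lemma exists_mul_rpow_neg_log_log_le : ∃ C : ℝ, 1 ≤ C ∧ ∀ q : ℕ, 16 ≤ q →
    Real.log q * (q : ℝ) ^ (-(1 / (100 * Real.log (Real.log q)))) ≤
      C * (q : ℝ) ^ (-(1 / (500 * Real.log (Real.log q)))) := by
  obtain ⟨C, hC1, hC⟩ := exists_pow_le_mul_exp_div_log 1 (show (0 : ℝ) < 1 / 125 by norm_num)
  refine ⟨C, hC1, fun q hq => ?_⟩
  have hll := one_le_log_log hq
  have hq0 : (0 : ℝ) < q := by exact_mod_cast (by omega : 0 < q)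
  have hL0 : 0 < Real.log q := Real.log_pos (by exact_mod_cast (by omega : 1 < q))
  have h := hC _ hL0 hll
  rw [pow_one] at h
  rw [Real.rpow_def_of_pos hq0, Real.rpow_def_of_pos hq0]
  refine (mul_le_mul_of_nonneg_right h (Real.exp_pos _).le).trans (le_of_eq ?_)
  rw [mul_assoc, ← Real.exp_add]
  congr 2
  field_simp
  ring

lemma exists_pow_two_pow_ge {A q : ℕ} (hA : 3 ≤ A) (hq : 16 ≤ q) : ∃ J : ℕ,
    (q : ℝ) ^ ((1 : ℝ) / 100) ≤ (A : ℝ) ^ 2 ^ J ∧ (J : ℝ) ≤ Real.log q ∧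
    ∀ j < J, (A : ℝ) ^ 2 ^ (j + 1) ≤ (q : ℝ) ^ ((1 : ℝ) / 50) := by
  have hA3 : (3 : ℝ) ≤ A := by exact_mod_cast hA
  have hq0 : (0 : ℝ) < q := by exact_mod_cast (by omega : 0 < q)
  have hL0 : 0 < Real.log q := Real.log_pos (by exact_mod_cast (by omega : 1 < q))
  have hex : ∃ J : ℕ, (q : ℝ) ^ ((1 : ℝ) / 100) ≤ (A : ℝ) ^ 2 ^ J := by
    obtain ⟨n, hn⟩ := pow_unbounded_of_one_lt ((q : ℝ) ^ ((1 : ℝ) / 100))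
      (show (1 : ℝ) < A by linarith)
    exact ⟨n, hn.le.trans (pow_le_pow_right₀ (by linarith) Nat.lt_two_pow_self.le)⟩
  refine ⟨Nat.find hex, Nat.find_spec hex, ?_, fun j hj => ?_⟩
  · rcases h : Nat.find hex with _ | J
    · simpa using hL0.le
    · have h1 := Nat.find_min hex (m := J) (by omega)
      push Not at h1
      have h2 := Real.log_lt_log (by positivity) h1
      rw [Real.log_pow, Real.log_rpow hq0] at h2
      have h3 : 1 ≤ Real.log A := by
        rw [Real.le_log_iff_exp_le (by linarith)]
        have := Real.exp_one_lt_d9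
        linarith
      have h4 : ((J + 1 : ℕ) : ℝ) ≤ ((2 ^ J : ℕ) : ℝ) := by
        exact_mod_cast (Nat.lt_two_pow_self (n := J))
      nlinarith
  · have h1 := Nat.find_min hex hj
    push Not at h1
    calc (A : ℝ) ^ 2 ^ (j + 1) = ((A : ℝ) ^ 2 ^ j) ^ 2 := by rw [← pow_mul, ← pow_succ]
      _ ≤ ((q : ℝ) ^ ((1 : ℝ) / 100)) ^ 2 := by gcongr
      _ = _ := by rw [← Real.rpow_natCast, ← Real.rpow_mul hq0.le]; norm_num

lemma one_le_exp_eulerMascheroniConstant : 1 ≤ Real.exp eulerMascheroniConstant :=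
  Real.one_le_exp (by linarith [Real.one_half_lt_eulerMascheroniConstant])

lemma exists_card_lt_Syz_le_of_rpow_le : ∃ C y₀ : ℝ, 1 ≤ C ∧ 3 ≤ y₀ ∧ ∀ (q : ℕ) [NeZero q]
    (y δ : ℝ), 16 ≤ q → y₀ ≤ y → y ≤ (q : ℝ) ^ ((11 : ℝ) / 21) →
    (q : ℝ) ^ ((1 : ℝ) / 100) ≤ y → 1 / Real.log y ≤ δ →
    ((Finset.univ.filter fun χ : DirichletCharacter ℂ q =>
      Real.exp eulerMascheroniConstant * δ < Syz χ y ((q : ℝ) ^ ((11 : ℝ) / 21))).card : ℝ) ≤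
      q.totient * (C * (q : ℝ) ^ (-(1 / (500 * Real.log (Real.log q))))) := by
  obtain ⟨C, hC1, hC⟩ := exists_card_rough_le
  obtain ⟨y₀, hy₀⟩ := Filter.eventually_atTop.1
    (eventually_mul_log_pow_le 1 8 (show (0 : ℝ) < 1 / 800 by norm_num))
  refine ⟨C, max y₀ 3, hC1, le_max_right _ _, fun q _ y δ hq hy hyq hqy hδ => ?_⟩
  have h1 := hy₀ y ((le_max_left _ _).trans hy)
  have hy3 : (3 : ℝ) ≤ y := (le_max_right _ _).trans hy
  have hq1 : (1 : ℝ) ≤ q := by exact_mod_cast (by omega : 1 ≤ q)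
  have hl0 : 0 < Real.log y := Real.log_pos (by linarith)
  have hδ0 : 0 ≤ δ := le_trans (by positivity) hδ
  have hsmall : 8 * (q : ℝ) ^ (-(1 : ℝ) / 800) ≤ Real.exp eulerMascheroniConstant * δ := by
    refine le_trans ?_ (le_mul_of_one_le_left hδ0 one_le_exp_eulerMascheroniConstant)
    refine le_trans ?_ hδ
    have h2 : y ≤ q := hyq.trans (by
      conv_rhs => rw [← Real.rpow_one (q : ℝ)]
      exact Real.rpow_le_rpow_of_exponent_le hq1 (by norm_num))
    have h3 : y ^ ((1 : ℝ) / 800) ≤ (q : ℝ) ^ ((1 : ℝ) / 800) :=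
      Real.rpow_le_rpow (by linarith) h2 (by norm_num)
    rw [neg_div, Real.rpow_neg (by linarith), ← div_eq_mul_inv,
      div_le_div_iff₀ (by positivity) hl0]
    linarith
  refine le_trans (Nat.cast_le.2 (Finset.card_le_card fun χ hχ => ?_))
    ((hC q ⌊y⌋₊ (hqy.trans (Nat.lt_floor_add_one y).le)).trans ?_)
  · rw [Finset.mem_filter] at hχ ⊢
    refine ⟨hχ.1, fun h => absurd hχ.2 (not_lt.2 ?_)⟩
    exact Syz_le χ (by linarith) fun θ => (h θ).trans hsmall
  · refine mul_le_mul_of_nonneg_left (mul_le_mul_of_nonneg_left ?_ (by linarith))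
      (Nat.cast_nonneg _)
    rw [neg_div]
    exact rpow_neg_le_rpow_neg_log_log hq (by norm_num) (by norm_num)

set_option maxHeartbeats 400000 in
lemma exists_card_lt_Syz_le_of_lt_rpow : ∃ C y₀ : ℝ, 1 ≤ C ∧ 3 ≤ y₀ ∧ ∀ (q : ℕ) [NeZero q]
    (y δ : ℝ), 16 ≤ q → y₀ ≤ y → y < (q : ℝ) ^ ((1 : ℝ) / 100) → 1 / Real.log y ≤ δ → δ ≤ 1 →
    ((Finset.univ.filter fun χ : DirichletCharacter ℂ q =>
      Real.exp eulerMascheroniConstant * δ < Syz χ y ((q : ℝ) ^ ((11 : ℝ) / 21))).card : ℝ) ≤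
      q.totient * (C * (Real.exp (-(δ ^ 2 * y / Real.log y) *
          (1 - 34 * Real.log (Real.log y) / Real.log y)) +
        (q : ℝ) ^ (-(1 / (500 * Real.log (Real.log q)))))) := by
  obtain ⟨C₁, hC₁, hR⟩ := exists_card_rough_le
  obtain ⟨C₂, A₀, hC₂, hA₀, hCh⟩ := exists_card_chain_le
  obtain ⟨C₃, y₁, hC₃, hy₁, hI⟩ := exists_card_initial_range_le
  obtain ⟨C₄, hC₄, hLog⟩ := exists_mul_rpow_neg_log_log_le
  have hev : ∀ᶠ x : ℝ in Filter.atTop, 256 ≤ Real.log (Real.log x) ∧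
      68 * Real.log (Real.log x) ≤ Real.log x ∧ 1 * Real.log x ^ 12 ≤ x ^ (1 : ℝ) ∧
      1 * Real.log x ^ 3 ≤ x ^ ((1 : ℝ) / 8) := by
    refine ((Real.tendsto_log_atTop.comp Real.tendsto_log_atTop).eventually_ge_atTop _).and
      (Filter.Eventually.and ?_
      ((eventually_mul_log_pow_le 12 _ (by norm_num)).and
        (eventually_mul_log_pow_le 3 _ (by norm_num))))
    have := Real.tendsto_log_atTop.eventually
      (eventually_mul_log_pow_le 1 68 (show (0 : ℝ) < 1 by norm_num))
    simpa using this
  obtain ⟨y₂, hy₂⟩ := Filter.eventually_atTop.1 hev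
  refine ⟨C₃ + 2 * C₂ + C₂ * C₄ + C₁, max (max y₁ y₂) A₀, by nlinarith,
    hA₀.trans (le_max_right _ _), fun q _ y δ hq hy hyq hδ1 hδ2 => ?_⟩
  have hyy₁ : y₁ ≤ y := (le_max_left _ _).trans ((le_max_left _ _).trans hy)
  have hyA : A₀ ≤ y := (le_max_right _ _).trans hy
  obtain ⟨h1, h2, h3, h4⟩ := hy₂ y ((le_max_right _ _).trans ((le_max_left _ _).trans hy))
  have hy3 : (3 : ℝ) ≤ y := hA₀.trans hyA
  have hy0 : (0 : ℝ) < y := by linarith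
  have hq1 : (1 : ℝ) ≤ q := by exact_mod_cast (by omega : 1 ≤ q)
  rw [Real.rpow_one, one_mul] at h3
  rw [one_mul] at h4
  obtain ⟨hA1, -, hA3, hA4⟩ := ceil_mul_log_pow_bounds (y := y) (by linarith) h3
  obtain hIn := hI q ⌊(q : ℝ) ^ ((11 : ℝ) / 21)⌋₊ y δ hq hyy₁ hyq hδ1 hδ2
  set l := Real.log y with hl
  set m := Real.log l with hm
  set A := ⌈y * l ^ 11⌉₊ with hA
  have hl0 : 0 < l := by linarith
  have hAn : 3 ≤ A := by exact_mod_cast hy3.trans hA3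
  obtain ⟨J, hJ1, hJ2, hJ3⟩ := exists_pow_two_pow_ge hAn hq
  have hChain := hCh q ⌊(q : ℝ) ^ ((11 : ℝ) / 21)⌋₊ A J hq (hyA.trans hA3) hJ3
  have hRough := hR q (A ^ 2 ^ J) (by push_cast; linarith)
  set Z := ⌊(q : ℝ) ^ ((11 : ℝ) / 21)⌋₊
  set Q := (q : ℝ) ^ (-(1 / (500 * Real.log (Real.log q)))) with hQ
  set Q' := (q : ℝ) ^ (-(1 / (100 * Real.log (Real.log q)))) with hQ'
  set G := Real.exp eulerMascheroniConstant with hG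
  have hG1 : 1 ≤ G := one_le_exp_eulerMascheroniConstant
  set E := Real.exp (-(δ ^ 2 * y / l) * (1 - 34 * m / l)) with hE
  have hδ0 : 0 < δ := lt_of_lt_of_le (by positivity) hδ1
  have hlA : l ≤ Real.log A := Real.log_le_log hy0 hA3
  have hlog3 : 24 * (1 / l ^ 3) ≤ δ * (m / l) := by
    calc 24 * (1 / l ^ 3) ≤ 1 / l * (m / l) := by
          rw [mul_one_div, div_mul_div_comm, div_le_div_iff₀ (by positivity) (by positivity)]
          have : 24 ≤ m * l := by nlinarith
          nlinarith [pow_pos hl0 2]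
      _ ≤ _ := by gcongr
  have hq800 : (q : ℝ) ^ (-(1 : ℝ) / 800) ≤ 1 / l ^ 3 := by
    have e1 : y ^ ((1 : ℝ) / 8) ≤ ((q : ℝ) ^ ((1 : ℝ) / 100)) ^ ((1 : ℝ) / 8) := by gcongr
    rw [← Real.rpow_mul (by linarith), show (1 : ℝ) / 100 * (1 / 8) = 1 / 800 by norm_num] at e1
    rw [neg_div, Real.rpow_neg (by linarith), ← one_div]
    exact one_div_le_one_div_of_le (by positivity) (h4.trans e1)
  have hsub : (Finset.univ.filter fun χ : DirichletCharacter ℂ q =>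
      G * δ < Syz χ y ((q : ℝ) ^ ((11 : ℝ) / 21))) ⊆
      ((Finset.univ.filter fun χ : DirichletCharacter ℂ q => ¬ ∀ θ : ℝ,
        ‖∑ n ∈ maxPrimeRange Z ⌊y⌋₊ A, χ (n : ZMod q) * e2pi (n * θ) / n‖ ≤
          G * (δ * (1 - m / l))) ∪
      (Finset.univ.filter fun χ : DirichletCharacter ℂ q => ¬ ∀ θ : ℝ,
        ‖∑ n ∈ maxPrimeRange Z A (A ^ 2 ^ J), χ (n : ZMod q) * e2pi (n * θ) / n‖ ≤
          G * (16 / Real.log A ^ 3))) ∪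
      (Finset.univ.filter fun χ : DirichletCharacter ℂ q => ¬ ∀ θ : ℝ,
        ‖∑ n ∈ (Finset.Icc 1 Z).filter (fun n => A ^ 2 ^ J < maxPrimeFac n),
          χ (n : ZMod q) * e2pi (n * θ) / n‖ ≤ 8 * (q : ℝ) ^ (-(1 : ℝ) / 800)) := by
    intro χ hχ
    rw [Finset.mem_filter] at hχ
    by_contra hcon
    simp only [Finset.mem_union, Finset.mem_filter, Finset.mem_univ, true_and, not_or,
      not_not] at hcon
    obtain ⟨⟨g1, g2⟩, g3⟩ := hcon
    refine absurd hχ.2 (not_lt.2 (Syz_le χ hy0.le fun θ => ?_))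
    have hyA' : ⌊y⌋₊ ≤ A := by
      exact_mod_cast (Nat.floor_le hy0.le).trans hA3
    have hAJ : A ≤ A ^ 2 ^ J := Nat.le_self_pow (by positivity) A
    rw [sum_lt_maxPrimeFac_eq (hyA'.trans hAJ), sum_maxPrimeRange_add hyA' hAJ]
    refine (norm_add_le _ _).trans ((add_le_add_left (norm_add_le _ _) _).trans ?_)
    have e1 : G * (16 / Real.log A ^ 3) ≤ G * (16 * (1 / l ^ 3)) := by
      rw [mul_one_div]
      gcongr
    have e2 : 8 * (1 / l ^ 3) ≤ G * (8 * (1 / l ^ 3)) :=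
      le_mul_of_one_le_left (by positivity) hG1
    have e3 := mul_le_mul_of_nonneg_left hlog3 (show 0 ≤ G by linarith)
    linarith [g1 θ, g2 θ, g3 θ]
  have hexpA : Real.exp (-(A / Real.log A ^ 8)) ≤ E := by
    refine Real.exp_le_exp.2 ?_
    have e1 : y ≤ A / Real.log A ^ 8 := by
      rw [le_div_iff₀ (pow_pos (hl0.trans_le hlA) 8)]
      calc y * Real.log A ^ 8 ≤ y * (2 * l) ^ 8 := by
            gcongr
            linarith
        _ = y * (256 * l ^ 8) := by ring
        _ ≤ y * l ^ 11 := by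
            gcongr
            rw [show l ^ 11 = l ^ 3 * l ^ 8 by ring]
            gcongr
            exact (show 256 ≤ l by linarith).trans (le_self_pow₀ (by linarith) (by norm_num))
        _ ≤ A := hA1
    have e2 : δ ^ 2 * y / l ≤ y := by
      rw [div_le_iff₀ hl0]
      have : δ ^ 2 ≤ 1 := pow_le_one₀ hδ0.le hδ2
      linarith [mul_le_mul_of_nonneg_right this hy0.le,
        le_mul_of_one_le_right hy0.le (show 1 ≤ l by linarith)]
    have e3 : 0 ≤ δ ^ 2 * y / l * (34 * m / l) := by positivity
    linarith
  have hQQ : Q' ≤ Q := by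
    refine Real.rpow_le_rpow_of_exponent_le hq1 (neg_le_neg ?_)
    have := one_le_log_log hq
    gcongr
    norm_num
  have hJQ : J * Q' ≤ C₄ * Q :=
    (mul_le_mul_of_nonneg_right hJ2 (by positivity)).trans (hLog q hq)
  have hq8 : (q : ℝ) ^ (-(1 : ℝ) / 8) ≤ Q := by
    rw [neg_div]
    exact rpow_neg_le_rpow_neg_log_log hq (by norm_num) (by norm_num)
  have hE0 : 0 < E := Real.exp_pos _
  have hQ0 : 0 < Q := by positivity
  have hcard := (Finset.card_le_card hsub).trans ((Finset.card_union_le _ _).trans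
    (add_le_add_left (Finset.card_union_le _ _) _))
  refine (Nat.cast_le.2 hcard).trans ?_
  push_cast
  refine (add_le_add (add_le_add hIn hChain) hRough).trans ?_
  rw [← mul_add, ← mul_add]
  refine mul_le_mul_of_nonneg_left ?_ (Nat.cast_nonneg _)
  have f1 : C₃ * (E + Q') ≤ C₃ * (E + Q) := by gcongr
  have f2 : C₂ * (2 * Real.exp (-(A / Real.log A ^ 8)) + J * Q') ≤ C₂ * (2 * E + C₄ * Q) := by
    gcongr
  have f3 : C₁ * (q : ℝ) ^ (-(1 : ℝ) / 8) ≤ C₁ * Q := by gcongr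
  have f4 : 0 ≤ C₂ * C₄ * E + 2 * C₂ * Q + C₁ * E := by positivity
  linarith

lemma card_le_totient (q : ℕ) [NeZero q] (P : DirichletCharacter ℂ q → Prop) :
    ((Finset.univ.filter P).card : ℝ) ≤ q.totient := by
  have h := DirichletCharacter.card_eq_totient_of_hasEnoughRootsOfUnity ℂ q
  rw [Nat.card_eq_fintype_card] at h
  rw [← h]
  exact_mod_cast Finset.card_filter_le _ _

/-- Theorem 9: tail bound for `S_{y,q^{11/21}}`. -/
theorem tail_bound_corollary :
    ∃ C : ℝ, 0 < C ∧
      ∀ q : ℕ, 16 ≤ q → ∀ y δ : ℝ, 3 ≤ y → y ≤ (q : ℝ) ^ ((11 : ℝ) / 21) →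
        1 / Real.log y ≤ δ → δ ≤ 1 →
        (Nat.card {χ : DirichletCharacter ℂ q //
            Real.exp Real.eulerMascheroniConstant * δ < Syz χ y ((q : ℝ) ^ ((11 : ℝ) / 21))} : ℝ) /
            q.totient ≤
          C * (Real.exp (-(δ ^ 2 * y / Real.log y) *
                (1 - C * Real.log (Real.log y) / Real.log y)) +
              (q : ℝ) ^ (-(1 / (500 * Real.log (Real.log q))))) := by
  obtain ⟨C₁, y₁, hC₁, hy₁, h₁⟩ := exists_card_lt_Syz_le_of_rpow_le
  obtain ⟨C₂, y₂, hC₂, hy₂, h₂⟩ := exists_card_lt_Syz_le_of_lt_rpow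
  have hlog3 : 1 < Real.log 3 := by
    rw [Real.lt_log_iff_exp_lt (by norm_num)]
    linarith [Real.exp_one_lt_d9]
  have hloglog3 : 0 < Real.log (Real.log 3) := Real.log_pos hlog3
  set y₀ := max y₁ y₂ with hy₀
  have hy₀3 : 3 ≤ y₀ := hy₁.trans (le_max_left _ _)
  have hR : 0 < Real.log y₀ / Real.log (Real.log 3) :=
    div_pos (Real.log_pos (by linarith)) hloglog3
  set C := C₁ + C₂ + 34 + Real.log y₀ / Real.log (Real.log 3) with hC
  have hC34 : 34 ≤ C := by linarith
  refine ⟨C, by linarith, fun q hq y δ hy3 hyq hδ1 hδ2 => ?_⟩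
  have : NeZero q := ⟨by omega⟩
  have hφ : (0 : ℝ) < q.totient := by exact_mod_cast Nat.totient_pos.2 (by omega)
  rw [Nat.card_eq_fintype_card, Fintype.card_subtype, div_le_iff₀ hφ, mul_comm _ (q.totient : ℝ)]
  have hl1 : 1 < Real.log y := hlog3.trans_le (Real.log_le_log (by norm_num) hy3)
  have hl0 : 0 < Real.log y := by linarith
  have hm : Real.log (Real.log 3) ≤ Real.log (Real.log y) :=
    Real.log_le_log (by linarith) (Real.log_le_log (by norm_num) hy3)
  have hm0 : 0 < Real.log (Real.log y) := hloglog3.trans_le hm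
  have hQ0 : 0 < (q : ℝ) ^ (-(1 / (500 * Real.log (Real.log q)))) := by positivity
  have hX0 : 0 < δ ^ 2 * y / Real.log y := by
    have : 0 < δ := lt_of_lt_of_le (by positivity) hδ1
    positivity
  rcases lt_or_ge y y₀ with hlt | hge
  · refine (card_le_totient q _).trans (le_mul_of_one_le_right hφ.le ?_)
    have hu : 1 ≤ C * Real.log (Real.log y) / Real.log y := by
      rw [one_le_div hl0]
      calc Real.log y ≤ Real.log y₀ := Real.log_le_log (by linarith) hlt.le
        _ = Real.log y₀ / Real.log (Real.log 3) * Real.log (Real.log 3) := by field_simp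
        _ ≤ _ := mul_le_mul (by linarith) hm hloglog3.le (by linarith)
    have hexp : 1 ≤ Real.exp (-(δ ^ 2 * y / Real.log y) *
        (1 - C * Real.log (Real.log y) / Real.log y)) := by
      apply Real.one_le_exp
      nlinarith
    nlinarith
  · rcases le_or_gt ((q : ℝ) ^ ((1 : ℝ) / 100)) y with hqy | hqy
    · refine (h₁ q y δ hq ((le_max_left _ _).trans hge) hyq hqy hδ1).trans
        (mul_le_mul_of_nonneg_left (mul_le_mul (by linarith) ?_ hQ0.le (by linarith)) hφ.le)
      exact le_add_of_nonneg_left (Real.exp_pos _).le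
    · refine (h₂ q y δ hq ((le_max_right _ _).trans hge) hqy hδ1 hδ2).trans
        (mul_le_mul_of_nonneg_left (mul_le_mul (by linarith) (add_le_add_left
          (Real.exp_le_exp.2 ?_) _) (by positivity) (by linarith)) hφ.le)
      refine mul_le_mul_of_nonpos_left ?_ (by linarith)
      gcongr
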